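/- arXiv:2411.01407 — 11 statements merged into one kernel-verified Lean document; each statement's English description precedes it below -/
import Mathlib

section
/- Let G=(V,E) be a finite simple graph with |V|=n and E ≠ ∅, and let t ≥ 2. Then (1+B(G))/2 ≤ S^u_t(G,n) ≤ B(G); in particular B(G)/2 ≤ S^u_t(G,n) ≤ B(G), so the graph bandwidth is a 2-approximation of the uncoded stretch metric with no redundancy. -/
/-- The bandwidth of a finite simple graph on `Fin n`: the minimum over bijections
(permutations of `Fin n`, i.e. linear arrangements) of the maximum stretch of an edge.
Formulated as the least `B` admitting an arrangement in which every edge has stretch `≤ B`;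
if there are no edges this is `0`. -/
noncomputable def bandwidth {n : ℕ} (G : SimpleGraph (Fin n)) : ℕ :=
  sInf { B : ℕ | ∃ σ : Equiv.Perm (Fin n),
    ∀ u v : Fin n, G.Adj u v → ((σ u : ℤ) - (σ v : ℤ)).natAbs ≤ B }

/-- The uncoded stretch metric `S^u_t(G,m)`: the minimum over uncoded chunk stores
`s : Fin m → V` (sequences in which every vertex occurs) of the maximum over simple paths
`p` of `G` with at most `t` vertices of `MinS(s,p)`, where
`MinS(s,p) = (min{b-a+1 : every vertex of p occurs in s on [a,b]})/ℓ(p)`.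
Expressed as the infimum of all `r` such that some store `s` satisfies `MinS(s,p) ≤ r`
for every such path `p`. -/
noncomputable def uncodedStretch {V : Type*} (G : SimpleGraph V) (t m : ℕ) : ℝ :=
  sInf { r : ℝ | ∃ s : Fin m → V, Function.Surjective s ∧
    ∀ (u v : V) (p : G.Walk u v), p.IsPath → p.length + 1 ≤ t →
      ∃ a b : ℕ, a ≤ b ∧ b < m ∧
        (∀ x ∈ p.support, ∃ j : Fin m, a ≤ (j : ℕ) ∧ (j : ℕ) ≤ b ∧ s j = x) ∧
        ((b - a + 1 : ℕ) : ℝ) ≤ r * ((p.length : ℝ) + 1) }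

lemma walk_interval {n : ℕ} (G : SimpleGraph (Fin n)) (σ : Equiv.Perm (Fin n)) (B : ℕ)
    (h : ∀ u v : Fin n, G.Adj u v → ((σ u : ℤ) - (σ v : ℤ)).natAbs ≤ B)
    {u v : Fin n} (p : G.Walk u v) :
    ∃ a b : ℕ, a ≤ b ∧ b < n ∧ b ≤ a + B * p.length ∧
      ∀ x ∈ p.support, a ≤ (σ x : ℕ) ∧ (σ x : ℕ) ≤ b := by
  induction p with
  | @nil u => exact ⟨σ u, σ u, le_rfl, (σ u).isLt, by simp, by simp⟩
  | @cons u v w hadj p ih =>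
    obtain ⟨a, b, hab, hbn, hle, hx⟩ := ih
    have hv := hx v p.start_mem_support
    have huv := h u v hadj
    have hu := (σ u).isLt
    refine ⟨min a (σ u), max b (σ u), by omega, by omega, ?_, ?_⟩
    · rw [SimpleGraph.Walk.length_cons, Nat.mul_add, Nat.mul_one]
      omega
    · intro x hxs
      rw [SimpleGraph.Walk.support_cons, List.mem_cons] at hxs
      rcases hxs with rfl | hxs
      · omega
      · have := hx x hxs
        omega

lemma stretch_lower {n : ℕ} (G : SimpleGraph (Fin n)) (hE : G.edgeSet.Nonempty)
    (t : ℕ) (ht : 2 ≤ t) (r : ℝ) (s : Fin n → Fin n) (hs : Function.Surjective s)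
    (h : ∀ (u v : Fin n) (p : G.Walk u v), p.IsPath → p.length + 1 ≤ t →
      ∃ a b : ℕ, a ≤ b ∧ b < n ∧
        (∀ x ∈ p.support, ∃ j : Fin n, a ≤ (j : ℕ) ∧ (j : ℕ) ≤ b ∧ s j = x) ∧
        ((b - a + 1 : ℕ) : ℝ) ≤ r * ((p.length : ℝ) + 1)) :
    (1 + (bandwidth G : ℝ)) / 2 ≤ r := by
  have hbij : Function.Bijective s := Finite.surjective_iff_bijective.mp hs
  let e := Equiv.ofBijective s hbij
  have he : ∀ j, e.symm (s j) = j := fun j => e.symm_apply_apply j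
  have key : ∀ u v, G.Adj u v →
      ((((e.symm u : Fin n) : ℤ) - ((e.symm v : Fin n) : ℤ)).natAbs : ℝ) ≤ 2 * r - 1 := by
    intro u v huv
    obtain ⟨a, b, hab, hbn, hx, hr⟩ := h u v huv.toWalk
      (SimpleGraph.Walk.IsPath.of_adj huv) (by simpa using ht)
    obtain ⟨j, hj1, hj2, rfl⟩ := hx u (by simp)
    obtain ⟨k, hk1, hk2, rfl⟩ := hx v (by simp)
    rw [he, he]
    have h1 : ((j : ℤ) - (k : ℤ)).natAbs + 1 ≤ b - a + 1 := by omega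
    have h2 : ((((j : ℤ) - (k : ℤ)).natAbs + 1 : ℕ) : ℝ) ≤ ((b - a + 1 : ℕ) : ℝ) :=
      Nat.cast_le.mpr h1
    simp only [SimpleGraph.Walk.length_cons, SimpleGraph.Walk.length_nil] at hr
    have h3 := h2.trans hr
    rw [Nat.cast_add] at h3
    norm_num at h3 ⊢
    linarith
  obtain ⟨⟨u, v⟩, huv⟩ := hE
  have h0 : (0 : ℝ) ≤ 2 * r - 1 := (Nat.cast_nonneg _).trans (key u v huv)
  have hB : bandwidth G ≤ ⌊2 * r - 1⌋₊ :=
    Nat.sInf_le ⟨e.symm, fun u v huv => Nat.le_floor (key u v huv)⟩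
  have := (Nat.le_floor_iff h0).mp hB
  linarith

theorem statement_0 {n : ℕ} (G : SimpleGraph (Fin n)) (hE : G.edgeSet.Nonempty)
    (t : ℕ) (ht : 2 ≤ t) :
    (1 + (bandwidth G : ℝ)) / 2 ≤ uncodedStretch G t n ∧
      uncodedStretch G t n ≤ (bandwidth G : ℝ) := by
  have hne : { B : ℕ | ∃ σ : Equiv.Perm (Fin n),
      ∀ u v : Fin n, G.Adj u v → ((σ u : ℤ) - (σ v : ℤ)).natAbs ≤ B }.Nonempty :=
    ⟨n, 1, fun u v _ => by
      simp only [Equiv.Perm.one_apply]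
      omega⟩
  obtain ⟨σ, hσ⟩ := Nat.sInf_mem hne
  change ∀ u v : Fin n, G.Adj u v → ((σ u : ℤ) - (σ v : ℤ)).natAbs ≤ bandwidth G at hσ
  have hpos : 1 ≤ bandwidth G := by
    obtain ⟨⟨u, v⟩, huv⟩ := hE
    have huv' : G.Adj u v := huv
    have h1 := hσ u v huv'
    have h2 : (σ u : ℕ) ≠ (σ v : ℕ) := fun h => huv'.ne (σ.injective (Fin.ext h))
    omega
  have hmem : (bandwidth G : ℝ) ∈ { r : ℝ | ∃ s : Fin n → Fin n, Function.Surjective s ∧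
    ∀ (u v : Fin n) (p : G.Walk u v), p.IsPath → p.length + 1 ≤ t →
      ∃ a b : ℕ, a ≤ b ∧ b < n ∧
        (∀ x ∈ p.support, ∃ j : Fin n, a ≤ (j : ℕ) ∧ (j : ℕ) ≤ b ∧ s j = x) ∧
        ((b - a + 1 : ℕ) : ℝ) ≤ r * ((p.length : ℝ) + 1) } := by
    refine ⟨σ.symm, σ.symm.surjective, fun u v p _ _ => ?_⟩
    obtain ⟨a, b, hab, hbn, hle, hx⟩ := walk_interval G σ _ hσ p
    refine ⟨a, b, hab, hbn, fun x hxs => ⟨σ x, (hx x hxs).1, (hx x hxs).2, by simp⟩, ?_⟩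
    have : b - a + 1 ≤ bandwidth G * (p.length + 1) := by
      rw [Nat.mul_add, Nat.mul_one]
      omega
    exact_mod_cast this
  refine ⟨le_csInf ⟨_, hmem⟩ ?_, csInf_le ⟨(1 + (bandwidth G : ℝ)) / 2, ?_⟩ hmem⟩
  · rintro r ⟨s, hs, h⟩
    exact stretch_lower G hE t ht r s hs h
  · rintro r ⟨s, hs, h⟩
    exact stretch_lower G hE t ht r s hs h
end

section
/- Let G be a sparse Hamiltonian graph on n ≥ 2 vertices and let G' be its subdivided graph. Then foldings of G' exist, and letting T* denote the minimum thickness of a folding of G', one has T* ≤ 3·B(G) and B(G) ≤ 2·T(h) for every folding h of G'; consequently B(G) ≤ 2·T* ≤ 6·B(G), i.e., an optimal folding of G' yields a linearization of G whose maximum edge stretch is at most 6·B(G). -/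
/-- `A` is a valid arc set for a sparse Hamiltonian graph on `Fin n` (0-indexed vertices):
each arc `(u,v)` satisfies `u + 1 < v` (so `|u - v| > 1`), and no two distinct arcs share a
foot. -/
def IsArcSet (n : ℕ) (A : Finset (Fin n × Fin n)) : Prop :=
  (∀ p ∈ A, (p.1 : ℕ) + 1 < (p.2 : ℕ)) ∧
  (∀ p ∈ A, ∀ q ∈ A, p ≠ q → p.1 ≠ q.1 ∧ p.1 ≠ q.2 ∧ p.2 ≠ q.1 ∧ p.2 ≠ q.2)

/-- The sparse Hamiltonian graph on vertices `0, 1, …, n-1` with line edges `{i, i+1}`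
and arc set `A`. -/
def sparseHamGraph (n : ℕ) (A : Finset (Fin n × Fin n)) : SimpleGraph (Fin n) :=
  SimpleGraph.fromRel (fun u v => (u : ℕ) + 1 = (v : ℕ) ∨ (u, v) ∈ A)

/-- `h` (as a function on 0-indexed positions `0, …, n-1`) is a folding of the sparse
Hamiltonian graph on `n` vertices with arc set `A`:
(P1) consecutive values differ by `±1`; (P2) the two feet of every arc have equal values. -/
def IsFolding (n : ℕ) (A : Finset (Fin n × Fin n)) (h : ℕ → ℤ) : Prop :=
  (∀ i : ℕ, i + 1 < n → h (i + 1) - h i = 1 ∨ h (i + 1) - h i = -1) ∧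
  (∀ p ∈ A, h (p.1 : ℕ) = h (p.2 : ℕ))

/-- The thickness `T(h)` of a folding: the maximal number of positions in `{0,…,n-1}`
sharing a common value. -/
def thickness (n : ℕ) (h : ℕ → ℤ) : ℕ :=
  (Finset.range n).sup fun i => ((Finset.range n).filter fun j => h j = h i).card

/-- The arcs of the subdivided graph `G'` on `2n-1` vertices: each arc `(u,v)` (0-indexed)
becomes `(2u, 2v)`. -/
def subdivArcs {n : ℕ} (A : Finset (Fin n × Fin n)) :
    Finset (Fin (2 * n - 1) × Fin (2 * n - 1)) :=
  A.image fun p =>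
    (⟨2 * (p.1 : ℕ), by have := p.1.isLt; omega⟩, ⟨2 * (p.2 : ℕ), by have := p.2.isLt; omega⟩)

theorem core_fold (n B : ℕ) (hB : 1 ≤ B) (s m : ℕ → ℤ)
    (h1 : ∀ i, i < n → m i ≤ s i) (h2 : ∀ i, i < n → s i ≤ m i + B)
    (h3 : ∀ i, i + 1 < n → s i ≤ s (i+1) + B ∧ s (i+1) ≤ s i + B)
    (hinj : ∀ i j, i < n → j < n → s i = s j → i = j) :
    ∃ h : ℕ → ℤ, (∀ i : ℕ, i + 1 < 2 * n - 1 → h (i + 1) - h i = 1 ∨ h (i + 1) - h i = -1) ∧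
      (∀ i j, m i = m j → h (2 * i) = h (2 * j)) ∧ thickness (2 * n - 1) h ≤ 3 * B := by
  obtain ⟨k, hk⟩ : ∃ k : ℕ → ℤ, k = fun i => m i / (2 * B) := ⟨_, rfl⟩
  have hBz : (1 : ℤ) ≤ B := by exact_mod_cast hB
  have k1 : ∀ i, 2 * B * k i ≤ m i := fun i => by
    rw [hk]; exact Int.mul_ediv_self_le (by omega)
  have k2 : ∀ i, m i < 2 * B * k i + 2 * B := fun i => by
    rw [hk]; exact Int.lt_mul_ediv_self_add (by omega)
  have kd : ∀ i, i + 1 < n → k i = k (i+1) ∨ k i = k (i+1) + 1 ∨ k (i+1) = k i + 1 := by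
    intro i hi
    have a1 := h1 i (by omega)
    have a2 := h2 i (by omega)
    have b1 := h1 (i+1) hi
    have b2 := h2 (i+1) hi
    obtain ⟨c1, c2⟩ := h3 i hi
    have d1 := k1 i
    have d2 := k2 i
    have e1 := k1 (i+1)
    have e2 := k2 (i+1)
    have f1 : k i < k (i+1) + 2 := by
      by_contra hh
      push Not at hh
      nlinarith
    have f2 : k (i+1) < k i + 2 := by
      by_contra hh
      push Not at hh
      nlinarith
    omega
  let h : ℕ → ℤ := fun j => if j % 2 = 0 then 2 * k (j/2) else
    if k (j/2) ≠ k (j/2+1) then k (j/2) + k (j/2+1) else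
      if 2 * B * k (j/2) + B ≤ s (j/2) then 2 * k (j/2) + 1 else 2 * k (j/2) - 1
  have he : ∀ i, h (2 * i) = 2 * k i := fun i => by simp [h]
  have ho : ∀ i, h (2 * i + 1) = if k i ≠ k (i+1) then k i + k (i+1) else
      if 2 * B * k i + B ≤ s i then 2 * k i + 1 else 2 * k i - 1 := fun i => by
    have : (2 * i + 1) / 2 = i := by omega
    have h' : (2 * i + 1) % 2 ≠ 0 := by omega
    simp only [h, this, if_neg h']
  have heb : ∀ i, i < n → B * h (2 * i) ≤ s i ∧ s i < B * h (2 * i) + 3 * B := by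
    intro i hi
    have a1 := h1 i (by omega)
    have a2 := h2 i (by omega)
    have d1 := k1 i
    have d2 := k2 i
    rw [he]
    constructor <;> nlinarith
  have hob : ∀ i, i + 1 < n → B * h (2 * i + 1) ≤ s i ∧ s i < B * h (2 * i + 1) + 3 * B := by
    intro i hi
    have a1 := h1 i (by omega)
    have a2 := h2 i (by omega)
    have b1 := h1 (i+1) hi
    have b2 := h2 (i+1) hi
    obtain ⟨c1, c2⟩ := h3 i hi
    have d1 := k1 i
    have d2 := k2 i
    have e1 := k1 (i+1)
    have e2 := k2 (i+1)
    rw [ho]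
    rcases kd i hi with q | q | q
    · rw [if_neg (by simpa using q)]
      split_ifs
      · constructor <;> nlinarith
      · constructor <;> nlinarith
    · rw [if_pos (by omega)]
      rw [q] at d1 d2 ⊢
      constructor <;> nlinarith
    · rw [if_pos (by omega)]
      rw [q] at e1 e2 ⊢
      constructor <;> nlinarith
  have hop : ∀ i, i + 1 < n → h (2 * i + 1) % 2 = 1 := by
    intro i hi
    rw [ho]
    have := kd i hi
    split_ifs <;> omega
  refine ⟨h, ?_, ?_, ?_⟩
  · intro i hi
    obtain ⟨t, rfl | rfl⟩ : ∃ t, i = 2 * t ∨ i = 2 * t + 1 := ⟨i / 2, by omega⟩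
    · rw [ho, he]
      have := kd t (by omega)
      split_ifs <;> omega
    · rw [show 2 * t + 1 + 1 = 2 * (t + 1) by ring, ho, he]
      have := kd t (by omega)
      split_ifs <;> omega
  · intro i j hij
    rw [he, he, hk]
    simp [hij]
  · unfold thickness
    refine Finset.sup_le fun i _ => ?_
    have hall : ∀ j, j < 2 * n - 1 → (B * h j ≤ s (j/2) ∧ s (j/2) < B * h j + 3 * B) ∧
        h j % 2 = (j % 2 : ℕ) := by
      intro j hj
      obtain ⟨t, rfl | rfl⟩ : ∃ t, j = 2 * t ∨ j = 2 * t + 1 := ⟨j / 2, by omega⟩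
      · have : 2 * t / 2 = t := by omega
        rw [this]
        refine ⟨heb t (by omega), ?_⟩
        rw [he]; omega
      · have : (2 * t + 1) / 2 = t := by omega
        rw [this]
        refine ⟨hob t (by omega), ?_⟩
        rw [hop t (by omega)]; omega
    calc _ ≤ (Finset.Ico (B * h i) (B * h i + 3 * B)).card := by
          apply Finset.card_le_card_of_injOn (fun j => s (j/2))
          · intro j hj
            simp only [Finset.coe_filter, Finset.mem_range, Set.mem_setOf_eq] at hj
            have := (hall j hj.1).1
            rw [hj.2] at this
            simpa using this
          · intro a ha b hb hab
            simp only [Finset.coe_filter, Finset.mem_range, Set.mem_setOf_eq] at ha hb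
            have h1 := (hall a ha.1).2
            have h2 := (hall b hb.1).2
            have h3 := hinj _ _ (by omega) (by omega) hab
            rw [ha.2] at h1
            rw [hb.2] at h2
            omega
      _ = 3 * B := by
          rw [Int.card_Ico]; omega

theorem adj_line {n : ℕ} (A : Finset (Fin n × Fin n)) (u v : Fin n) (h : (u : ℕ) + 1 = v) :
    (sparseHamGraph n A).Adj u v := by
  unfold sparseHamGraph
  rw [SimpleGraph.fromRel_adj]
  refine ⟨fun e => ?_, Or.inl (Or.inl h)⟩
  subst e; omega

theorem bw_spec {n : ℕ} (G : SimpleGraph (Fin n)) : ∃ σ : Equiv.Perm (Fin n),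
    ∀ u v : Fin n, G.Adj u v → ((σ u : ℤ) - (σ v : ℤ)).natAbs ≤ bandwidth G := by
  have : bandwidth G ∈ { B : ℕ | ∃ σ : Equiv.Perm (Fin n),
    ∀ u v : Fin n, G.Adj u v → ((σ u : ℤ) - (σ v : ℤ)).natAbs ≤ B } := by
    apply Nat.sInf_mem
    refine ⟨n, Equiv.refl _, fun u v _ => ?_⟩
    simp only [Equiv.refl_apply]
    omega
  exact this

theorem partner {n : ℕ} (A : Finset (Fin n × Fin n)) (hA : IsArcSet n A) :
    ∃ p : Fin n → Fin n, (∀ q ∈ A, p q.1 = q.2 ∧ p q.2 = q.1) ∧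
      ∀ u, p u = u ∨ (sparseHamGraph n A).Adj u (p u) := by
  classical
  obtain ⟨hA1, hA2⟩ := hA
  have key : ∀ u : Fin n, ∃ w : Fin n, (∀ q ∈ A, (q.1 = u → w = q.2) ∧ (q.2 = u → w = q.1)) ∧
      (w = u ∨ (sparseHamGraph n A).Adj u w) := by
    intro u
    by_cases hu : ∃ q ∈ A, q.1 = u ∨ q.2 = u
    · obtain ⟨q, hq, hqu⟩ := hu
      have hlt := hA1 q hq
      have uniq : ∀ r ∈ A, (r.1 = u ∨ r.2 = u) → r = q := by
        intro r hr hru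
        by_contra hne
        have := hA2 r hr q hq hne
        rcases hqu with e | e <;> rcases hru with e' | e' <;> simp_all
      rcases hqu with e | e
      · refine ⟨q.2, fun r hr => ⟨fun h => ?_, fun h => ?_⟩, Or.inr ?_⟩
        · rw [uniq r hr (Or.inl h)]
        · have := uniq r hr (Or.inr h)
          subst this
          rw [← e] at h; rw [h] at hlt; omega
        · rw [← e]
          unfold sparseHamGraph
          rw [SimpleGraph.fromRel_adj]
          refine ⟨fun e => ?_, Or.inl (Or.inr hq)⟩
          rw [e] at hlt; omega
      · refine ⟨q.1, fun r hr => ⟨fun h => ?_, fun h => ?_⟩, Or.inr ?_⟩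
        · have := uniq r hr (Or.inl h)
          subst this
          rw [← e] at h; rw [h] at hlt; omega
        · rw [uniq r hr (Or.inr h)]
        · rw [← e]
          unfold sparseHamGraph
          rw [SimpleGraph.fromRel_adj]
          refine ⟨fun e => ?_, Or.inr (Or.inr hq)⟩
          rw [e] at hlt; omega
    · push Not at hu
      exact ⟨u, fun q hq => ⟨fun h => absurd h (hu q hq).1, fun h => absurd h (hu q hq).2⟩, Or.inl rfl⟩
  choose p hp1 hp2 using key
  exact ⟨p, fun q hq => ⟨(hp1 _ q hq).1 rfl, (hp1 _ q hq).2 rfl⟩, hp2⟩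

theorem upper_fold {n : ℕ} (hn : 2 ≤ n) (A : Finset (Fin n × Fin n)) (hA : IsArcSet n A) :
    ∃ h : ℕ → ℤ, IsFolding (2 * n - 1) (subdivArcs A) h ∧
      thickness (2 * n - 1) h ≤ 3 * bandwidth (sparseHamGraph n A) := by
  obtain ⟨σ, hσ⟩ := bw_spec (sparseHamGraph n A)
  obtain ⟨p, hp1, hp2⟩ := partner A hA
  generalize bandwidth (sparseHamGraph n A) = B at *
  have hB : 1 ≤ B := by
    have h := hσ ⟨0, by omega⟩ ⟨1, by omega⟩ (adj_line A _ _ rfl)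
    have hne : σ ⟨0, by omega⟩ ≠ σ ⟨1, by omega⟩ := fun e => by
      have := σ.injective e
      simp at this
    have : (σ ⟨0, by omega⟩ : ℕ) ≠ σ ⟨1, by omega⟩ := fun e => hne (Fin.ext e)
    omega
  have hpB : ∀ u, ((σ u : ℤ) - (σ (p u) : ℤ)).natAbs ≤ B := by
    intro u
    rcases hp2 u with h | h
    · rw [h]; simp
    · exact hσ _ _ h
  let s : ℕ → ℤ := fun i => if hi : i < n then (σ ⟨i, hi⟩ : ℕ) else 0
  let m : ℕ → ℤ := fun i => if hi : i < n then
    min ((σ ⟨i, hi⟩ : ℕ) : ℤ) ((σ (p ⟨i, hi⟩) : ℕ) : ℤ) else 0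
  obtain ⟨h, c1, c2, c3⟩ := core_fold n B hB s m
    (fun i hi => by simp only [s, m, dif_pos hi]; exact min_le_left _ _)
    (fun i hi => by
      have := hpB ⟨i, hi⟩
      simp only [s, m, dif_pos hi]; omega)
    (fun i hi => by
      have := hσ ⟨i, by omega⟩ ⟨i+1, hi⟩ (adj_line A _ _ rfl)
      simp only [s, dif_pos hi, dif_pos (show i < n by omega)]; omega)
    (fun i j hi hj hij => by
      simp only [s, dif_pos hi, dif_pos hj] at hij
      have := σ.injective (Fin.ext (by exact_mod_cast hij))
      simpa using this)
  refine ⟨h, ⟨c1, ?_⟩, c3⟩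
  intro q hq
  unfold subdivArcs at hq
  rw [Finset.mem_image] at hq
  obtain ⟨r, hr, rfl⟩ := hq
  apply c2
  simp only [m, dif_pos r.1.isLt, dif_pos r.2.isLt, Fin.eta]
  rw [(hp1 r hr).1, (hp1 r hr).2, min_comm]

theorem lower_fold {n : ℕ} (A : Finset (Fin n × Fin n)) (h : ℕ → ℤ)
    (hh : IsFolding (2 * n - 1) (subdivArcs A) h) :
    bandwidth (sparseHamGraph n A) ≤ 2 * thickness (2 * n - 1) h := by
  classical
  obtain ⟨P1, P2⟩ := hh
  let f : Fin n → ℤ := fun u => h (2 * u)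
  have par : ∀ i, i < n → h (2 * i) % 2 = h 0 % 2 := by
    intro i
    induction i with
    | zero => intro _; rfl
    | succ i ih =>
      intro hi
      have a := ih (by omega)
      have b := P1 (2 * i) (by omega)
      have c := P1 (2 * i + 1) (by omega)
      rw [show 2 * i + 1 + 1 = 2 * (i + 1) by ring] at c
      omega
  have hadj : ∀ u v, (sparseHamGraph n A).Adj u v → f u ≤ f v + 2 ∧ f v ≤ f u + 2 := by
    have line : ∀ u v : Fin n, (u : ℕ) + 1 = v → f u ≤ f v + 2 ∧ f v ≤ f u + 2 := by
      intro u v e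
      have := v.isLt
      have b := P1 (2 * u) (by omega)
      have c := P1 (2 * u + 1) (by omega)
      rw [show 2 * (u : ℕ) + 1 + 1 = 2 * v by omega] at c
      simp only [f]
      omega
    have arc : ∀ u v : Fin n, (u, v) ∈ A → f u = f v := by
      intro u v e
      exact P2 _ (Finset.mem_image_of_mem _ e)
    intro u v huv
    unfold sparseHamGraph at huv
    rw [SimpleGraph.fromRel_adj] at huv
    rcases huv.2 with (e | e) | (e | e)
    · exact line u v e
    · have := arc _ _ e; omega
    · exact (line v u e).symm
    · have := arc _ _ e; omega
  have fib : ∀ u : Fin n, ((Finset.range (2 * n - 1)).filter fun j => h j = f u).card ≤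
      thickness (2 * n - 1) h := by
    intro u
    have hu := u.isLt
    exact Finset.le_sup (f := fun i => ((Finset.range (2 * n - 1)).filter fun j => h j = h i).card)
      (Finset.mem_range.2 (show 2 * (u : ℕ) < 2 * n - 1 by omega))
  let τ := Tuple.sort f
  have mono : Monotone (f ∘ τ) := Tuple.monotone_sort f
  have main : ∀ u v, (sparseHamGraph n A).Adj u v → τ.symm u ≤ τ.symm v →
      ((τ.symm v : ℕ) : ℤ) - ((τ.symm u : ℕ) : ℤ) ≤ 2 * thickness (2 * n - 1) h := by
    intro u v huv hle
    have c : (Finset.Icc (τ.symm u) (τ.symm v)).card ≤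
        (((Finset.range (2 * n - 1)).filter fun j => h j = f u) ∪
        ((Finset.range (2 * n - 1)).filter fun j => h j = f v)).card := by
      apply Finset.card_le_card_of_injOn (fun i => 2 * (τ i : ℕ))
      · intro i hi
        rw [Finset.coe_Icc, Set.mem_Icc] at hi
        have m1 := mono hi.1
        have m2 := mono hi.2
        simp only [Function.comp, Equiv.apply_symm_apply] at m1 m2
        have p1 := par _ (τ i).isLt
        have p2 := par _ u.isLt
        have p3 := par _ v.isLt
        have := hadj u v huv
        have := (τ i).isLt
        simp only [Finset.coe_union, Finset.coe_filter, Set.mem_union, Set.mem_setOf_eq, Finset.mem_range]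
        simp only [f] at *
        omega
      · intro a _ b _ hab
        apply τ.injective
        apply Fin.ext
        simp only at hab
        omega
    have c2 := Finset.card_union_le ((Finset.range (2 * n - 1)).filter fun j => h j = f u)
        ((Finset.range (2 * n - 1)).filter fun j => h j = f v)
    have := fib u
    have := fib v
    rw [Fin.card_Icc] at c
    omega
  refine Nat.sInf_le ⟨τ.symm, fun u v huv => ?_⟩
  rcases le_total (τ.symm u) (τ.symm v) with e | e
  · have := main u v huv e
    have : (τ.symm u : ℕ) ≤ τ.symm v := e
    omega
  · have := main v u huv.symm e
    have : (τ.symm v : ℕ) ≤ τ.symm u := e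
    omega

/-- For a sparse Hamiltonian graph `G` on `n ≥ 2` vertices with subdivided
graph `G'`: foldings of `G'` exist; the minimum thickness `T*` of a folding of `G'`
satisfies `T* ≤ 3·B(G)`; `B(G) ≤ 2·T(h)` for every folding `h` of `G'`; and consequently
`B(G) ≤ 2·T* ≤ 6·B(G)`. -/
theorem statement_1 {n : ℕ} (hn : 2 ≤ n) (A : Finset (Fin n × Fin n)) (hA : IsArcSet n A) :
    (∃ h : ℕ → ℤ, IsFolding (2 * n - 1) (subdivArcs A) h) ∧
    sInf {T : ℕ | ∃ h : ℕ → ℤ,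
        IsFolding (2 * n - 1) (subdivArcs A) h ∧ thickness (2 * n - 1) h = T} ≤
      3 * bandwidth (sparseHamGraph n A) ∧
    (∀ h : ℕ → ℤ, IsFolding (2 * n - 1) (subdivArcs A) h →
      bandwidth (sparseHamGraph n A) ≤ 2 * thickness (2 * n - 1) h) ∧
    bandwidth (sparseHamGraph n A) ≤
      2 * sInf {T : ℕ | ∃ h : ℕ → ℤ,
        IsFolding (2 * n - 1) (subdivArcs A) h ∧ thickness (2 * n - 1) h = T} ∧
    2 * sInf {T : ℕ | ∃ h : ℕ → ℤ,
        IsFolding (2 * n - 1) (subdivArcs A) h ∧ thickness (2 * n - 1) h = T} ≤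
      6 * bandwidth (sparseHamGraph n A) := by
  obtain ⟨h0, hf, ht⟩ := upper_fold hn A hA
  have hlow := fun h hh => lower_fold A h hh
  have hle : sInf {T : ℕ | ∃ h : ℕ → ℤ,
        IsFolding (2 * n - 1) (subdivArcs A) h ∧ thickness (2 * n - 1) h = T} ≤
      3 * bandwidth (sparseHamGraph n A) := le_trans (Nat.sInf_le ⟨h0, hf, rfl⟩) ht
  obtain ⟨h1, hf1, ht1⟩ := Nat.sInf_mem (s := {T : ℕ | ∃ h : ℕ → ℤ,
        IsFolding (2 * n - 1) (subdivArcs A) h ∧ thickness (2 * n - 1) h = T}) ⟨_, h0, hf, rfl⟩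
  refine ⟨⟨h0, hf⟩, hle, hlow, ?_, by omega⟩
  rw [← ht1]
  exact hlow h1 hf1
end

section
/- Let G be a sparse Hamiltonian graph on n ≥ 2 vertices. If h is a folding of G whose number of breakpoints, i.e., indices d with 1 < d < n and h(d−1) = h(d+1), equals L−1 for some L ≥ 1 (so h consists of L monotone linear pieces), then B(G) ≤ L. -/
/-- the breakpoints of a folding -/
def bpSet (n : ℕ) (h : ℕ → ℤ) : Finset ℕ :=
  (Finset.range n).filter (fun j => 0 < j ∧ j + 1 < n ∧ h (j - 1) = h (j + 1))

/-- index of the piece containing the edge from `j` to `j+1` -/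
def pc (n : ℕ) (h : ℕ → ℤ) (j : ℕ) : ℕ := ((bpSet n h).filter (fun b => b ≤ j)).card

lemma pc_mono (n : ℕ) (h : ℕ → ℤ) {i j : ℕ} (hij : i ≤ j) : pc n h i ≤ pc n h j := by
  apply Finset.card_le_card
  intro b hb
  simp only [Finset.mem_filter] at hb ⊢
  exact ⟨hb.1, hb.2.trans hij⟩

lemma pc_le (n : ℕ) (h : ℕ → ℤ) (j : ℕ) : pc n h j ≤ (bpSet n h).card :=
  Finset.card_le_card (Finset.filter_subset _ _)

lemma pc_step (n : ℕ) (h : ℕ → ℤ) (j : ℕ) (hj : j + 2 < n) (he : h j = h (j + 2)) :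
    pc n h j < pc n h (j + 1) := by
  apply Finset.card_lt_card
  rw [Finset.ssubset_iff_of_subset]
  · refine ⟨j + 1, ?_, ?_⟩
    · simp only [bpSet, Finset.mem_filter, Finset.mem_range]
      refine ⟨⟨by omega, by omega, by omega, ?_⟩, le_refl _⟩
      simpa using he
    · simp
  · intro b hb
    simp only [Finset.mem_filter] at hb ⊢
    exact ⟨hb.1, by omega⟩

lemma piece_aux (n : ℕ) (h : ℕ → ℤ)
    (hs : ∀ i : ℕ, i + 1 < n → h (i + 1) - h i = 1 ∨ h (i + 1) - h i = -1) (a k : ℕ)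
    (hk : a + k + 1 < n) (hp : pc n h a = pc n h (a + k)) :
    (h (a + k + 1) - h (a + k) = 1 ∧ h (a + k + 1) - h a = k + 1) ∨
    (h (a + k + 1) - h (a + k) = -1 ∧ h (a + k + 1) - h a = -(k + 1)) := by
  induction k with
  | zero =>
    have := hs a (by omega)
    simpa using this
  | succ k ih =>
    have h1 := pc_mono n h (show a ≤ a + k by omega)
    have h2 := pc_mono n h (show a + k ≤ a + (k + 1) by omega)
    have ih := ih (by omega) (by omega)
    have h3 := hs (a + k + 1) (by omega)
    have h4 : h (a + k) ≠ h (a + k + 2) := by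
      intro he
      have := pc_step n h (a + k) (by omega) he
      rw [← add_assoc] at hp h2
      omega
    have e1 : a + (k + 1) + 1 = a + k + 2 := by omega
    have e2 : a + (k + 1) = a + k + 1 := by omega
    have e3 : a + k + 1 + 1 = a + k + 2 := by omega
    rw [e1, e2]
    rw [e3] at h3
    push_cast
    omega

lemma piece_lem (n : ℕ) (h : ℕ → ℤ)
    (hs : ∀ i : ℕ, i + 1 < n → h (i + 1) - h i = 1 ∨ h (i + 1) - h i = -1) (a b : ℕ)
    (hab : a < b) (hb : b < n) (hp : pc n h (b - 1) ≤ pc n h a) :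
    h b - h a = (b : ℤ) - a ∨ h b - h a = (a : ℤ) - b := by
  obtain ⟨k, rfl⟩ : ∃ k, b = a + k + 1 := ⟨b - a - 1, by omega⟩
  have h1 := pc_mono n h (show a ≤ a + k by omega)
  have := piece_aux n h hs a k hb (le_antisymm h1 hp)
  push_cast
  omega

/-- the lexicographic order -/
def klt {n : ℕ} (h : ℕ → ℤ) (u v : Fin n) : Prop :=
  h u < h v ∨ (h u = h v ∧ (u : ℕ) < v)

open Classical in
/-- rank of a vertex in the lexicographic order -/
noncomputable def rk {n : ℕ} (h : ℕ → ℤ) (u : Fin n) : ℕ :=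
  (Finset.univ.filter (fun w : Fin n => klt h w u)).card

open Classical in
/-- half-open interval of the lexicographic order -/
noncomputable def ivl {n : ℕ} (h : ℕ → ℤ) (u v : Fin n) : Finset (Fin n) :=
  Finset.univ.filter (fun w : Fin n => ¬ klt h w u ∧ klt h w v)

lemma rk_add {n : ℕ} (h : ℕ → ℤ) (u v : Fin n) (huv : klt h u v) :
    rk h v = rk h u + (ivl h u v).card := by
  classical
  unfold rk ivl
  rw [← Finset.card_union_of_disjoint]
  · congr 1
    ext w
    simp only [Finset.mem_filter, Finset.mem_univ, true_and, Finset.mem_union]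
    simp only [klt] at *
    omega
  · rw [Finset.disjoint_left]
    intro w hw hw'
    simp only [Finset.mem_filter, Finset.mem_univ, true_and] at hw hw'
    exact hw'.1 hw

lemma rk_lt_rk {n : ℕ} (h : ℕ → ℤ) (u v : Fin n) (huv : klt h u v) : rk h u < rk h v := by
  rw [rk_add h u v huv]
  have : 0 < (ivl h u v).card := by
    apply Finset.card_pos.mpr
    refine ⟨u, ?_⟩
    simp only [ivl, Finset.mem_filter, Finset.mem_univ, true_and]
    exact ⟨by unfold klt; omega, huv⟩
  omega

lemma klt_total {n : ℕ} (h : ℕ → ℤ) (u v : Fin n) (huv : u ≠ v) : klt h u v ∨ klt h v u := by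
  have : (u : ℕ) ≠ v := fun e => huv (Fin.ext e)
  unfold klt
  omega

lemma rk_lt {n : ℕ} (h : ℕ → ℤ) (u : Fin n) : rk h u < n := by
  classical
  have : rk h u < (Finset.univ : Finset (Fin n)).card := by
    apply Finset.card_lt_card
    rw [Finset.ssubset_iff_of_subset (Finset.subset_univ _)]
    refine ⟨u, Finset.mem_univ _, ?_⟩
    simp [klt]
  simpa using this

lemma ivl_card {n : ℕ} (h : ℕ → ℤ)
    (hs : ∀ i : ℕ, i + 1 < n → h (i + 1) - h i = 1 ∨ h (i + 1) - h i = -1)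
    (u v : Fin n) (i : ℕ)
    (hc : (i = u ∧ i + 1 = v ∧ h v = h u + 1) ∨ (i = v ∧ i + 1 = u ∧ h v = h u + 1) ∨
      (i = u ∧ (u : ℕ) < v ∧ h u = h v)) :
    (ivl h u v).card ≤ (bpSet n h).card + 1 := by
  rw [← Finset.card_range ((bpSet n h).card + 1)]
  apply Finset.card_le_card_of_injOn
    (fun w : Fin n => if (w : ℕ) ≤ i then pc n h w else pc n h (w - 1))
  · intro w _
    simp only [Finset.coe_range, Set.mem_Iio]
    split_ifs
    · exact Nat.lt_succ_of_le (pc_le _ _ _)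
    · exact Nat.lt_succ_of_le (pc_le _ _ _)
  · have key : ∀ a b : Fin n, a ∈ ivl h u v → b ∈ ivl h u v → (a : ℕ) < b →
        (if (a : ℕ) ≤ i then pc n h a else pc n h (a - 1)) =
        (if (b : ℕ) ≤ i then pc n h b else pc n h (b - 1)) → False := by
      intro a b ha hb hab he
      simp only [ivl, Finset.mem_filter, Finset.mem_univ, true_and] at ha hb
      simp only [klt] at ha hb
      have e1 : (a : ℕ) = u → h a = h u := fun e => by rw [e]
      have e2 : (a : ℕ) = v → h a = h v := fun e => by rw [e]
      have e3 : (b : ℕ) = u → h b = h u := fun e => by rw [e]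
      have e4 : (b : ℕ) = v → h b = h v := fun e => by rw [e]
      have hbn := b.2
      have hun := u.2
      have hvn := v.2
      have m1 := pc_mono n h (show (b : ℕ) - 1 ≤ b by omega)
      have m2 := pc_mono n h (show (a : ℕ) - 1 ≤ a by omega)
      have q1 := piece_lem n h hs a b hab hbn
      by_cases hbi : (b : ℕ) ≤ i
      · have hai : (a : ℕ) ≤ i := by omega
        rw [if_pos hai, if_pos hbi] at he
        have q1 := q1 (by omega)
        have q2 := piece_lem n h hs a (b + 1) (by omega)
        simp only [Nat.add_sub_cancel] at q2
        rcases hc with ⟨c1, c2, c3⟩ | ⟨c1, c2, c3⟩ | ⟨c1, c2, c3⟩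
        · have q2 := q2 (by omega) (by omega)
          by_cases hbu : (b : ℕ) = i
          · rw [hbu, c2] at q2
            rw [hbu, c1] at q1
            push_cast at q2
            omega
          · have : (b : ℕ) ≠ u := by omega
            omega
        · omega
        · omega
      · rw [if_neg hbi] at he
        by_cases hai : (a : ℕ) ≤ i
        · rw [if_pos hai] at he
          have q1 := q1 (by omega)
          omega
        · rw [if_neg hai] at he
          have q1 := q1 (by omega)
          omega
    intro a ha b hb he
    rcases lt_trichotomy (a : ℕ) b with hl | hl | hl
    · exact (key a b ha hb hl he).elim
    · exact Fin.ext hl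
    · exact (key b a hb ha hl he.symm).elim

/-- If a sparse Hamiltonian graph `G` on `n ≥ 2` vertices admits a folding
`h` whose number of breakpoints (interior positions `j` with `h (j-1) = h (j+1)`, 0-indexed)
equals `L − 1` for some `L ≥ 1` (so `h` consists of `L` monotone linear pieces), then
`B(G) ≤ L`. -/
theorem statement_2 {n : ℕ} (hn : 2 ≤ n) (A : Finset (Fin n × Fin n)) (hA : IsArcSet n A)
    (h : ℕ → ℤ) (hf : IsFolding n A h) (L : ℕ) (hL : 1 ≤ L)
    (hbp : ((Finset.range n).filter
        (fun j => 0 < j ∧ j + 1 < n ∧ h (j - 1) = h (j + 1))).card = L - 1) :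
    bandwidth (sparseHamGraph n A) ≤ L := by
  classical
  have hbp' : (bpSet n h).card = L - 1 := hbp
  obtain ⟨hs, harc⟩ := hf
  have hinj : Function.Injective (fun u : Fin n => (⟨rk h u, rk_lt h u⟩ : Fin n)) := by
    intro u v huv
    by_contra hne
    have e : rk h u = rk h v := congrArg Fin.val huv
    rcases klt_total h u v hne with hl | hl
    · have := rk_lt_rk h u v hl
      omega
    · have := rk_lt_rk h v u hl
      omega
  apply Nat.sInf_le
  refine ⟨Equiv.ofBijective _ (Finite.injective_iff_bijective.mp hinj), ?_⟩
  have key : ∀ u v : Fin n, ((u : ℕ) + 1 = (v : ℕ) ∨ (u, v) ∈ A) →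
      ((rk h u : ℤ) - (rk h v : ℤ)).natAbs ≤ L := by
    intro u v huv
    rcases huv with huv | huv
    · have hvn := v.2
      have := hs u (by omega)
      rw [huv] at this
      rcases this with h1 | h1
      · have e := rk_add h u v (by unfold klt; omega)
        have c := ivl_card h hs u v u (by omega)
        omega
      · have e := rk_add h v u (by unfold klt; omega)
        have c := ivl_card h hs v u u (by omega)
        omega
    · have h1 := hA.1 _ huv
      have h2 := harc _ huv
      simp only at h1 h2
      have e := rk_add h u v (by unfold klt; omega)
      have c := ivl_card h hs u v u (by omega)
      omega
  intro u v huv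
  simp only [sparseHamGraph, SimpleGraph.fromRel_adj] at huv
  simp only [Equiv.ofBijective_apply]
  rcases huv.2 with h1 | h1
  · exact key u v h1
  · have := key v u h1
    omega
end

section
/- For every sparse Hamiltonian graph G = (V, E_line ∪ E_arc) with exactly 3 arcs, the bandwidth satisfies B(G) ≤ 5. -/
/-- A finite stretch of path of `N` interior vertices laid out between the positions `c1` and `c2`,
all interior positions satisfying `Z`. -/
def SegOK (Z : ℤ → Prop) (N c1 c2 : ℤ) : Prop :=
  ∃ h : ℤ → ℤ, h 0 = c1 ∧ h (N + 1) = c2 ∧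
    (∀ t, 0 ≤ t → t ≤ N → |h (t + 1) - h t| ≤ 5) ∧
    (∀ t, 1 ≤ t → t ≤ N → Z (h t)) ∧
    (∀ t t', 1 ≤ t → t ≤ N → 1 ≤ t' → t' ≤ N → h t = h t' → t = t')

theorem SegOK.symm {Z : ℤ → Prop} {N c1 c2 : ℤ} (H : SegOK Z N c1 c2) : SegOK Z N c2 c1 := by
  obtain ⟨h, h0, h1, hs, hz, hi⟩ := H
  refine ⟨fun t => h (N + 1 - t), by simpa using h1, by simpa using h0, ?_, ?_, ?_⟩
  · intro t ht ht'
    have := hs (N - t) (by omega) (by omega)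
    rw [abs_sub_comm] at this
    have e1 : N + 1 - (t + 1) = N - t := by ring
    have e2 : N + 1 - t = N - t + 1 := by ring
    simpa only [e1, e2] using this
  · intro t ht ht'
    exact hz _ (by omega) (by omega)
  · intro t t' a b c e heq
    have := hi _ _ (by omega) (by omega) (by omega) (by omega) heq
    omega

theorem SegOK.neg {Z : ℤ → Prop} {N c1 c2 : ℤ}
    (H : SegOK (fun z => Z (-z)) N (-c1) (-c2)) : SegOK Z N c1 c2 := by
  obtain ⟨h, h0, h1, hs, hz, hi⟩ := H
  refine ⟨fun t => - h t, by simp [h0], by simp [h1], ?_, ?_, ?_⟩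
  · intro t ht ht'
    have := hs t ht ht'
    rw [abs_le] at this ⊢
    dsimp only
    omega
  · intro t ht ht'
    exact hz t ht ht'
  · intro t t' a b c e heq
    exact hi t t' a b c e (by simpa using heq)

/-- Left-going excursion; the first end carries the longer strand. -/
theorem seg_left {Z : ℤ → Prop} {N c1 c2 : ℤ} (g S1 S2 : ℤ) (hg : 0 ≤ g) (hgN : g ≤ N)
    (h1 : c1 ≤ S1) (h1' : S1 ≤ c1 + 10) (h2 : c2 ≤ S2) (h2' : S2 ≤ c2 + 5)
    (h3 : S2 ≤ S1 - 5 * g) (h3' : S1 - 5 * g ≤ c2 + 5)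
    (h4 : g = 0 → |c1 - c2| ≤ 5)
    (hne : N = g ∨ (S1 - S2) % 5 ≠ 0)
    (hZ1 : ∀ τ, 1 ≤ τ → (N = g → τ ≤ g) → Z (S1 - 5 * τ))
    (hZ2 : N ≠ g → ∀ τ, 1 ≤ τ → Z (S2 - 5 * τ)) : SegOK Z N c1 c2 := by
  obtain ⟨n, hn⟩ : ∃ n, n = g + (N - g + 1) / 2 := ⟨_, rfl⟩
  refine ⟨fun t => if t = 0 then c1 else if t ≤ n then S1 - 5 * t else
    if t ≤ N then S2 - 5 * (N + 1 - t) else c2, by simp, ?_, ?_, ?_, ?_⟩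
  · have a1 : N + 1 ≠ 0 := by omega
    have a2 : ¬ N + 1 ≤ n := by omega
    have a3 : ¬ N + 1 ≤ N := by omega
    simp only [a1, a2, a3, if_false]
  · intro t ht ht'
    rw [abs_le] at *
    dsimp only
    split_ifs <;> omega
  · intro t ht ht'
    dsimp only
    split_ifs with a b
    · omega
    · exact hZ1 t ht (by omega)
    · exact hZ2 (by omega) _ (by omega)
  · intro t t' a b c e
    dsimp only
    split_ifs <;> omega

/-- Right-going version of `seg_left`. -/
theorem seg_right {Z : ℤ → Prop} {N c1 c2 : ℤ} (g S1 S2 : ℤ) (hg : 0 ≤ g) (hgN : g ≤ N)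
    (h1 : S1 ≤ c1) (h1' : c1 - 10 ≤ S1) (h2 : S2 ≤ c2) (h2' : c2 - 5 ≤ S2)
    (h3 : S1 + 5 * g ≤ S2) (h3' : c2 - 5 ≤ S1 + 5 * g)
    (h4 : g = 0 → |c1 - c2| ≤ 5)
    (hne : N = g ∨ (S1 - S2) % 5 ≠ 0)
    (hZ1 : ∀ τ, 1 ≤ τ → (N = g → τ ≤ g) → Z (S1 + 5 * τ))
    (hZ2 : N ≠ g → ∀ τ, 1 ≤ τ → Z (S2 + 5 * τ)) : SegOK Z N c1 c2 := by
  apply SegOK.neg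
  refine seg_left g (-S1) (-S2) hg hgN (by omega) (by omega) (by omega) (by omega) (by omega)
    (by omega) ?_ (by omega) ?_ ?_
  · intro h
    have := h4 h
    rw [abs_le] at *
    omega
  · intro τ a b
    have := hZ1 τ a b
    rwa [show -(-S1 - 5 * τ) = S1 + 5 * τ by ring]
  · intro h τ a
    have := hZ2 h τ a
    rwa [show -(-S2 - 5 * τ) = S2 + 5 * τ by ring]

/-- Gluing: stretches of path whose positions carry increasing codes fit together injectively. -/
theorem glue (code : ℤ → ℕ) (x c : ℕ → ℤ) (hx : ∀ j < 5, x j < x (j + 1))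
    (T0 T1 : ℤ → ℤ)
    (hT0 : ∀ t, 0 ≤ t → |T0 (t + 1) - T0 t| ≤ 5) (hT00 : T0 0 = c 0)
    (hT0c : ∀ t, 1 ≤ t → code (T0 t) = 0)
    (hT0i : ∀ t t', 1 ≤ t → 1 ≤ t' → T0 t = T0 t' → t = t')
    (hT1 : ∀ t, 0 ≤ t → |T1 (t + 1) - T1 t| ≤ 5) (hT10 : T1 0 = c 5)
    (hT1c : ∀ t, 1 ≤ t → code (T1 t) = 12)
    (hT1i : ∀ t t', 1 ≤ t → 1 ≤ t' → T1 t = T1 t' → t = t')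
    (hc : ∀ j < 6, code (c j) = 2 * j + 1)
    (hseg : ∀ j < 5, SegOK (fun z => code z = 2 * j + 2) (x (j + 1) - x j - 1) (c j) (c (j + 1))) :
    ∃ f : ℤ → ℤ, (∀ i, |f (i + 1) - f i| ≤ 5) ∧ Function.Injective f ∧
      ∀ j < 6, f (x j) = c j := by
  have key : ∀ k ≤ 5, ∃ f : ℤ → ℤ, (∀ i < x k, |f (i + 1) - f i| ≤ 5) ∧
      (∀ i i', i ≤ x k → i' ≤ x k → f i = f i' → i = i') ∧
      (∀ i ≤ x k, code (f i) ≤ 2 * k + 1) ∧ ∀ j ≤ k, x j ≤ x k ∧ f (x j) = c j := by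
    intro k
    induction k with
    | zero =>
      intro _
      refine ⟨fun i => T0 (x 0 - i), ?_, ?_, ?_, ?_⟩
      · intro i hi
        have := hT0 (x 0 - (i + 1)) (by omega)
        rw [abs_sub_comm] at this
        simpa [show x 0 - (i + 1) + 1 = x 0 - i by ring] using this
      · intro i i' hi hi' heq
        dsimp only at heq
        have hc0 := hc 0 (by omega)
        rcases eq_or_lt_of_le hi with rfl | hi
        · rcases eq_or_lt_of_le hi' with h | hi'
          · exact h.symm
          · have := hT0c (x 0 - i') (by omega)
            rw [← heq, sub_self, hT00] at this
            omega
        · rcases eq_or_lt_of_le hi' with rfl | hi'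
          · have := hT0c (x 0 - i) (by omega)
            rw [heq, sub_self, hT00] at this
            omega
          · have := hT0i _ _ (by omega) (by omega) heq
            omega
      · intro i hi
        rcases eq_or_lt_of_le hi with rfl | hi
        · simp [hT00, hc 0]
        · simp [hT0c (x 0 - i) (by omega)]
      · intro j hj
        obtain rfl : j = 0 := by omega
        simp [hT00]
    | succ k ih =>
      intro hk
      obtain ⟨f, fs, fi, fc, fx⟩ := ih (by omega)
      obtain ⟨h, h0, h1, hs, hz, hi⟩ := hseg k (by omega)
      have hxk := hx k (by omega)
      have hck := hc (k + 1) (by omega)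
      have e1 : x (k + 1) - x k - 1 + 1 = x (k + 1) - x k := by ring
      rw [e1] at h1
      have hcode : ∀ i, x k < i → i ≤ x (k + 1) →
          (i < x (k + 1) ∧ code (h (i - x k)) = 2 * k + 2) ∨
          (i = x (k + 1) ∧ code (h (i - x k)) = 2 * k + 3) := by
        intro i a b
        rcases eq_or_lt_of_le b with rfl | b
        · right
          rw [h1]
          exact ⟨rfl, by omega⟩
        · left
          exact ⟨b, hz _ (by omega) (by omega)⟩
      refine ⟨fun i => if i ≤ x k then f i else h (i - x k), ?_, ?_, ?_, ?_⟩
      · intro i hi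
        dsimp only
        rcases lt_trichotomy i (x k) with a | a | a
        · rw [if_pos (by omega), if_pos (by omega)]
          exact fs i a
        · subst a
          rw [if_neg (by omega), if_pos le_rfl, (fx k le_rfl).2, ← h0]
          have := hs 0 le_rfl (by omega)
          simpa using this
        · rw [if_neg (by omega), if_neg (by omega)]
          have := hs (i - x k) (by omega) (by omega)
          rwa [show i - x k + 1 = i + 1 - x k by ring] at this
      · intro i i' a b
        dsimp only
        split_ifs with p q q
        · exact fi i i' p q
        · intro heq
          have := fc i p
          have := hcode i' (by omega) b
          rw [← heq] at this
          omega
        · intro heq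
          have := fc i' q
          have := hcode i (by omega) a
          rw [heq] at this
          omega
        · intro heq
          have u1 := hcode i (by omega) a
          have u2 := hcode i' (by omega) b
          rw [heq] at u1
          rcases u1 with u1 | u1 <;> rcases u2 with u2 | u2
          · have := hi _ _ (by omega) (by omega) (by omega) (by omega) heq
            omega
          · omega
          · omega
          · omega
      · intro i a
        dsimp only
        split_ifs with p
        · have := fc i p
          omega
        · have := hcode i (by omega) a
          omega
      · intro j hj
        dsimp only
        rcases Nat.lt_or_ge k j with a | a
        · obtain rfl : j = k + 1 := by omega
          rw [if_neg (by omega), h1]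
          exact ⟨le_rfl, rfl⟩
        · have := fx j a
          rw [if_pos this.1]
          exact ⟨by omega, this.2⟩
  obtain ⟨f, fs, fi, fc, fx⟩ := key 5 le_rfl
  refine ⟨fun i => if i ≤ x 5 then f i else T1 (i - x 5), ?_, ?_, ?_⟩
  · intro i
    dsimp only
    rcases lt_trichotomy i (x 5) with a | a | a
    · rw [if_pos (by omega), if_pos (by omega)]
      exact fs i a
    · subst a
      rw [if_neg (by omega), if_pos le_rfl, (fx 5 le_rfl).2, ← hT10]
      have := hT1 0 le_rfl
      simpa using this
    · rw [if_neg (by omega), if_neg (by omega)]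
      have := hT1 (i - x 5) (by omega)
      rwa [show i - x 5 + 1 = i + 1 - x 5 by ring] at this
  · intro i i'
    dsimp only
    split_ifs with p q q
    · exact fi i i' p q
    · intro heq
      have := fc i p
      have := hT1c (i' - x 5) (by omega)
      rw [← heq] at this
      omega
    · intro heq
      have := fc i' q
      have := hT1c (i - x 5) (by omega)
      rw [heq] at this
      omega
    · intro heq
      have := hT1i _ _ (by omega) (by omega) heq
      omega
  · intro j hj
    have := fx j (by omega)
    dsimp only
    rw [if_pos this.1]
    exact this.2

/-- The label of a position: which lane of the layout it belongs to. Labels `0..4`: left-going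
lanes; `11..15`: right-going lanes; `20..25`: the six arc endpoints; `30, 31`: the lanes of
residue `0` and `1` between the two groups of endpoints. -/
def lab (d z : ℤ) : ℕ :=
  if z < 0 then (z % 5).toNat
  else if z ≤ 1 then 20 + z.toNat
  else if 5 * d + 6 ≤ z then 11 + ((z - 1) % 5).toNat
  else if 5 * d + 2 ≤ z then 20 + (z - 5 * d).toNat
  else if 2 ≤ z % 5 then (z % 5).toNat
  else 30 + (z % 5).toNat

theorem lab_left {d s τ p : ℤ} (hd : 0 ≤ d) (h0 : 0 ≤ s) (h4 : s ≤ 4) (hp : 2 ≤ p → 2 ≤ s)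
    (hτ : 1 ≤ τ) : lab d (s + 5 * (if p ≤ 1 then 0 else d) - 5 * τ) = s.toNat := by
  unfold lab
  split_ifs <;> omega

theorem lab_right {d s τ : ℤ} (hd : 0 ≤ d) (h0 : 1 ≤ s) (h4 : s ≤ 5)
    (hτ : 1 ≤ τ) : lab d (s + 5 * d + 5 * τ) = 10 + s.toNat := by
  unfold lab
  split_ifs <;> omega

theorem lab_mid {d s τ : ℤ} (h0 : 0 ≤ s) (h4 : s ≤ 1)
    (hτ : 1 ≤ τ) (hτd : τ ≤ d) : lab d (s + 5 * τ) = 30 + s.toNat := by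
  unfold lab
  split_ifs <;> omega

theorem lab_one {d τ : ℤ} (_hd : 0 ≤ d) (hτ : 1 ≤ τ) :
    lab d (1 + 5 * τ) = 11 ∨ lab d (1 + 5 * τ) = 31 := by
  unfold lab
  split_ifs <;> omega

theorem lab_center {d p : ℤ} (hd : 0 ≤ d) (h0 : 0 ≤ p) (h5 : p ≤ 5) :
    lab d (p + 5 * (if p ≤ 1 then 0 else d)) = 20 + p.toNat := by
  unfold lab
  split_ifs <;> omega

/-- Admissible data for a left-going excursion (long strand at the endpoint with slot `p`). -/
def LeftOK (own : ℕ → ℕ) (k : ℕ) (p q a b : ℤ) : Prop :=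
  p ≤ a ∧ q ≤ b ∧ b < a ∧ a ≤ 4 ∧ (2 ≤ q → 2 ≤ p) ∧ (2 ≤ p → 2 ≤ a) ∧ (2 ≤ q → 2 ≤ b) ∧
    own a.toNat = k ∧ own b.toNat = k

/-- Admissible data for a right-going excursion. -/
def RightOK (own : ℕ → ℕ) (k : ℕ) (p q a b : ℤ) : Prop :=
  a ≤ p ∧ b ≤ q ∧ a < b ∧ b ≤ 5 ∧ 1 ≤ a ∧ own (10 + a.toNat) = k ∧ own (10 + b.toNat) = k ∧
    (p ≤ 1 → own 31 = k)

/-- Admissible data for the taut stretch. -/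
def TautOK (own : ℕ → ℕ) (k : ℕ) (p q : ℤ) : Prop :=
  p ≤ 1 ∧ 2 ≤ q ∧ own (30 + p.toNat) = k

instance (own k p q a b) : Decidable (LeftOK own k p q a b) := by unfold LeftOK; infer_instance
instance (own k p q a b) : Decidable (RightOK own k p q a b) := by unfold RightOK; infer_instance
instance (own k p q) : Decidable (TautOK own k p q) := by unfold TautOK; infer_instance

/-- Position of the endpoint with slot `p`. -/
def ctr (d p : ℤ) : ℤ := p + 5 * (if p ≤ 1 then 0 else d)

theorem seg_of_left {own : ℕ → ℕ} {k : ℕ} {p q a b d N : ℤ} (hd : 0 ≤ d) (hN : 0 ≤ N)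
    (hp : 0 ≤ p ∧ p ≤ 5) (hq : 0 ≤ q ∧ q ≤ 5) (H : LeftOK own k p q a b)
    (hm : ¬ (p ≤ 1 ↔ q ≤ 1) → d ≤ N) :
    SegOK (fun z => own (lab d z) = k) N (ctr d p) (ctr d q) := by
  obtain ⟨h1, h2, h3, h4, h5, h6, h7, h8, h9⟩ := H
  refine seg_left (if (p ≤ 1 ↔ q ≤ 1) then 0 else d) (a + 5 * (if p ≤ 1 then 0 else d))
    (b + 5 * (if q ≤ 1 then 0 else d)) ?_ ?_ ?_ ?_ ?_ ?_ ?_ ?_ ?_ ?_ ?_ ?_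
  · split_ifs <;> omega
  · split_ifs with h
    · omega
    · exact hm h
  · unfold ctr; omega
  · unfold ctr; omega
  · unfold ctr; omega
  · unfold ctr; omega
  · split_ifs <;> omega
  · unfold ctr; split_ifs <;> omega
  · unfold ctr
    rw [abs_le]
    split_ifs <;> omega
  · right
    split_ifs <;> omega
  · intro τ hτ _
    rw [lab_left hd (by omega) h4 h6 hτ, h8]
  · intro _ τ hτ
    rw [lab_left hd (by omega) (by omega) h7 hτ, h9]

theorem seg_of_right {own : ℕ → ℕ} {k : ℕ} {p q a b d N : ℤ} (hd : 0 ≤ d) (hN : 0 ≤ N)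
    (hp : 0 ≤ p ∧ p ≤ 5) (hq : 0 ≤ q ∧ q ≤ 5) (H : RightOK own k p q a b)
    (hm : ¬ (p ≤ 1 ↔ q ≤ 1) → d ≤ N) :
    SegOK (fun z => own (lab d z) = k) N (ctr d p) (ctr d q) := by
  obtain ⟨h1, h2, h3, h4, h5, h6, h7, h8⟩ := H
  have hq1 : ¬ q ≤ 1 := by omega
  refine seg_right (if (p ≤ 1 ↔ q ≤ 1) then 0 else d) (a + 5 * (if p ≤ 1 then 0 else d))
    (b + 5 * d) ?_ ?_ ?_ ?_ ?_ ?_ ?_ ?_ ?_ ?_ ?_ ?_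
  · split_ifs <;> omega
  · split_ifs with h
    · omega
    · exact hm h
  · unfold ctr; omega
  · unfold ctr; omega
  · unfold ctr; rw [if_neg hq1]; omega
  · unfold ctr; rw [if_neg hq1]; omega
  · split_ifs <;> omega
  · unfold ctr; split_ifs <;> omega
  · unfold ctr
    rw [abs_le]
    split_ifs <;> omega
  · right
    split_ifs <;> omega
  · intro τ hτ _
    split_ifs with hp1
    · obtain rfl : a = 1 := by omega
      rcases lab_one hd hτ with e | e
      · simpa [e] using h6
      · simpa [e] using h8 hp1
    · rw [lab_right hd h5 (by omega) hτ, h6]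
  · intro _ τ hτ
    rw [lab_right hd (by omega) h4 hτ, h7]

theorem seg_of_taut {own : ℕ → ℕ} {k : ℕ} {p q d N : ℤ} (hd : 0 ≤ d) (hN : N = d)
    (hp : 0 ≤ p ∧ p ≤ 5) (hq : 0 ≤ q ∧ q ≤ 5) (H : TautOK own k p q) :
    SegOK (fun z => own (lab d z) = k) N (ctr d p) (ctr d q) := by
  obtain ⟨h1, h2, h3⟩ := H
  have hq1 : ¬ q ≤ 1 := by omega
  subst hN
  unfold ctr
  rw [if_pos h1, if_neg hq1]
  refine seg_right N p (q + 5 * N) hd le_rfl ?_ ?_ ?_ ?_ ?_ ?_ ?_ (Or.inl rfl) ?_ ?_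
  · omega
  · omega
  · omega
  · omega
  · omega
  · omega
  · intro h
    rw [abs_le]
    omega
  · intro τ hτ hτd
    rw [lab_mid hp.1 h1 hτ (hτd rfl), h3]
  · intro h
    exact absurd rfl h

/-- Admissible data for a tail. -/
def TailOK (own : ℕ → ℕ) (k : ℕ) (p s : ℤ) (sd : ℕ) : Prop :=
  (sd = 0 ∧ p ≤ s ∧ s ≤ 4 ∧ (2 ≤ p → 2 ≤ s) ∧ own s.toNat = k) ∨
  (sd = 1 ∧ 2 ≤ p ∧ s ≤ p ∧ 1 ≤ s ∧ own (10 + s.toNat) = k)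

instance (own k p s sd) : Decidable (TailOK own k p s sd) := by unfold TailOK; infer_instance

theorem tail_of {own : ℕ → ℕ} {k sd : ℕ} {p s d : ℤ} (hd : 0 ≤ d)
    (hp : 0 ≤ p ∧ p ≤ 5) (H : TailOK own k p s sd) :
    ∃ T : ℤ → ℤ, (∀ t, 0 ≤ t → |T (t + 1) - T t| ≤ 5) ∧ T 0 = ctr d p ∧
    (∀ t, 1 ≤ t → own (lab d (T t)) = k) ∧
    (∀ t t', 1 ≤ t → 1 ≤ t' → T t = T t' → t = t') := by
  rcases H with ⟨-, h1, h2, h3, h4⟩ | ⟨-, h1, h2, h3, h4⟩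
  · refine ⟨fun t => if t = 0 then ctr d p else s + 5 * (if p ≤ 1 then 0 else d) - 5 * t,
      ?_, by simp, ?_, ?_⟩
    · intro t ht
      rw [abs_le]
      unfold ctr
      dsimp only
      split_ifs <;> omega
    · intro t ht
      dsimp only
      rw [if_neg (by omega), lab_left hd (by omega) h2 h3 ht, h4]
    · intro t t' ht ht'
      dsimp only
      rw [if_neg (show t ≠ 0 by omega), if_neg (show t' ≠ 0 by omega)]
      omega
  · refine ⟨fun t => if t = 0 then ctr d p else s + 5 * d + 5 * t,
      ?_, by simp, ?_, ?_⟩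
    · intro t ht
      rw [abs_le]
      unfold ctr
      dsimp only
      split_ifs <;> omega
    · intro t ht
      dsimp only
      rw [if_neg (by omega), lab_right hd h3 (by omega) ht, h4]
    · intro t t' ht ht'
      dsimp only
      rw [if_neg (show t ≠ 0 by omega), if_neg (show t' ≠ 0 by omega)]
      omega

/-- Combinatorial description of a layout. -/
structure Row where
  /-- slots of the six endpoints -/
  p : List ℤ
  /-- for each inner segment: direction (0 left, 1 right, 2 taut) and the two strand slots -/
  s : List (ℕ × ℤ × ℤ)
  /-- the two tails: direction and slot -/
  t0 : ℕ × ℤ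
  t1 : ℕ × ℤ

/-- Slot of the `j`-th endpoint. -/
def Row.pt (r : Row) (j : ℕ) : ℤ := r.p.getD j 0

/-- Data of the `j`-th segment. -/
def Row.sg (r : Row) (j : ℕ) : ℕ × ℤ × ℤ := r.s.getD j (0, 0, 0)

/-- The labels used by the `k`-th piece of the path. -/
def Row.labels (r : Row) (k : ℕ) : List ℕ :=
  if k = 0 then [10 * r.t0.1 + r.t0.2.toNat]
  else if k = 12 then [10 * r.t1.1 + r.t1.2.toNat]
  else if k % 2 = 1 then [20 + (r.pt (k / 2)).toNat]
  else
    let j := k / 2 - 1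
    let e := r.sg j
    let m := min (r.pt j) (r.pt (j + 1))
    if e.1 = 2 then [30 + m.toNat]
    else [10 * e.1 + e.2.1.toNat, 10 * e.1 + e.2.2.toNat] ++
      (if e.1 = 1 ∧ m ≤ 1 then [31] else [])

/-- The piece of the path owning a label. -/
def Row.own (r : Row) (l : ℕ) : ℕ :=
  (List.range 13).findIdx (fun k => l ∈ r.labels k)

/-- Admissibility of a row. -/
def Row.OK (r : Row) : Prop :=
  (∀ j < 6, 0 ≤ r.pt j ∧ r.pt j ≤ 5 ∧ r.own (20 + (r.pt j).toNat) = 2 * j + 1) ∧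
  TailOK r.own 0 (r.pt 0) r.t0.2 r.t0.1 ∧ TailOK r.own 12 (r.pt 5) r.t1.2 r.t1.1 ∧
  ∀ j < 5,
    ((r.sg j).1 = 0 ∧ (LeftOK r.own (2 * j + 2) (r.pt j) (r.pt (j + 1)) (r.sg j).2.1 (r.sg j).2.2 ∨
      LeftOK r.own (2 * j + 2) (r.pt (j + 1)) (r.pt j) (r.sg j).2.2 (r.sg j).2.1)) ∨
    ((r.sg j).1 = 1 ∧ (RightOK r.own (2 * j + 2) (r.pt j) (r.pt (j + 1)) (r.sg j).2.1 (r.sg j).2.2 ∨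
      RightOK r.own (2 * j + 2) (r.pt (j + 1)) (r.pt j) (r.sg j).2.2 (r.sg j).2.1)) ∨
    ((r.sg j).1 = 2 ∧ (TautOK r.own (2 * j + 2) (r.pt j) (r.pt (j + 1)) ∨
      TautOK r.own (2 * j + 2) (r.pt (j + 1)) (r.pt j)))

instance (r : Row) : Decidable r.OK := by unfold Row.OK; infer_instance

theorem row_layout (r : Row) (hr : r.OK) (x : ℕ → ℤ) (d : ℤ) (hd : 0 ≤ d)
    (hx : ∀ j < 5, x j < x (j + 1))
    (hm : ∀ j < 5, ¬ (r.pt j ≤ 1 ↔ r.pt (j + 1) ≤ 1) → d + 1 ≤ x (j + 1) - x j)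
    (ht : ∀ j < 5, (r.sg j).1 = 2 → x (j + 1) - x j = d + 1) :
    ∃ f : ℤ → ℤ, (∀ i, |f (i + 1) - f i| ≤ 5) ∧ Function.Injective f ∧
      ∀ i < 6, ∀ j < 6, (r.pt i ≤ 1 ↔ r.pt j ≤ 1) → |f (x i) - f (x j)| ≤ 5 := by
  obtain ⟨hp, h0, h1, hs⟩ := hr
  have hp' : ∀ j < 6, 0 ≤ r.pt j ∧ r.pt j ≤ 5 := fun j hj => ⟨(hp j hj).1, (hp j hj).2.1⟩
  obtain ⟨T0, a1, a2, a3, a4⟩ := tail_of hd (hp' 0 (by omega)) h0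
  obtain ⟨T1, b1, b2, b3, b4⟩ := tail_of hd (hp' 5 (by omega)) h1
  obtain ⟨f, fs, fi, fx⟩ := glue (fun z => r.own (lab d z)) x (fun j => ctr d (r.pt j)) hx T0 T1
    a1 a2 a3 a4 b1 b2 b3 b4
    (by
      intro j hj
      obtain ⟨c1, c2, c3⟩ := hp j hj
      unfold ctr
      rw [lab_center hd c1 c2, c3])
    (by
      intro j hj
      have q1 := hp' j (by omega)
      have q2 := hp' (j + 1) (by omega)
      have m := hm j hj
      have t := ht j hj
      have hxj := hx j hj
      rcases hs j hj with ⟨-, H | H⟩ | ⟨-, H | H⟩ | ⟨e, H | H⟩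
      · exact seg_of_left hd (by omega) q1 q2 H (by intro h; have := m h; omega)
      · exact (seg_of_left hd (by omega) q2 q1 H
          (by intro h; have := m (by tauto); omega)).symm
      · exact seg_of_right hd (by omega) q1 q2 H (by intro h; have := m h; omega)
      · exact (seg_of_right hd (by omega) q2 q1 H
          (by intro h; have := m (by tauto); omega)).symm
      · exact seg_of_taut hd (by have := t e; omega) q1 q2 H
      · exact (seg_of_taut hd (by have := t e; omega) q2 q1 H).symm)
  refine ⟨f, fs, fi, ?_⟩
  intro i hi j hj hij
  rw [fx i hi, fx j hj]
  have q1 := hp' i hi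
  have q2 := hp' j hj
  unfold ctr
  rw [abs_le]
  split_ifs <;> omega

/-- The layouts, indexed by the partner `e` of the third endpoint and the taut segment `j`. -/
def rows : List ((ℕ × ℕ) × Row) := [
  ((0, 0), ⟨[0, 2, 1, 3, 4, 5], [(2, 0, 0), (0, 2, 1), (0, 3, 4), (1, 1, 2), (1, 3, 4)],
    (0, 0), (1, 5)⟩),
  ((0, 1), ⟨[0, 2, 1, 3, 4, 5], [(0, 0, 2), (2, 0, 0), (0, 1, 3), (1, 1, 2), (1, 3, 4)],
    (0, 4), (1, 5)⟩),
  ((0, 2), ⟨[0, 2, 1, 3, 4, 5], [(0, 0, 2), (0, 3, 1), (2, 0, 0), (1, 1, 2), (1, 3, 4)],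
    (0, 4), (1, 5)⟩),
  ((1, 0), ⟨[2, 0, 1, 3, 4, 5], [(2, 0, 0), (0, 0, 1), (0, 2, 3), (1, 1, 2), (1, 3, 4)],
    (0, 4), (1, 5)⟩),
  ((1, 2), ⟨[2, 0, 1, 3, 4, 5], [(0, 2, 0), (0, 1, 3), (2, 0, 0), (1, 1, 2), (1, 3, 4)],
    (0, 4), (1, 5)⟩),
  ((3, 1), ⟨[2, 3, 0, 1, 4, 5], [(0, 2, 3), (2, 0, 0), (0, 0, 1), (1, 1, 2), (1, 3, 4)],
    (0, 4), (1, 5)⟩),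
  ((3, 3), ⟨[2, 3, 1, 0, 4, 5], [(0, 2, 3), (1, 2, 1), (0, 1, 0), (2, 0, 0), (1, 3, 4)],
    (0, 4), (1, 5)⟩),
  ((4, 1), ⟨[2, 4, 0, 3, 1, 5], [(1, 2, 3), (2, 0, 0), (0, 0, 3), (0, 4, 1), (1, 1, 4)],
    (0, 2), (1, 5)⟩),
  ((4, 2), ⟨[2, 3, 0, 4, 1, 5], [(1, 2, 3), (0, 3, 0), (2, 0, 0), (0, 4, 1), (1, 1, 4)],
    (0, 2), (1, 5)⟩),
  ((4, 3), ⟨[2, 3, 1, 5, 0, 4], [(1, 2, 3), (0, 3, 1), (1, 1, 5), (2, 0, 0), (0, 0, 4)],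
    (0, 2), (1, 4)⟩),
  ((4, 4), ⟨[2, 3, 1, 4, 0, 5], [(1, 2, 3), (0, 3, 1), (1, 1, 4), (0, 4, 0), (2, 0, 0)],
    (0, 2), (1, 5)⟩),
  ((5, 1), ⟨[2, 3, 0, 4, 5, 1], [(0, 2, 3), (2, 0, 0), (0, 0, 4), (1, 3, 4), (1, 5, 1)],
    (1, 2), (0, 1)⟩),
  ((5, 2), ⟨[2, 3, 0, 4, 5, 1], [(0, 2, 3), (0, 4, 0), (2, 0, 0), (1, 3, 4), (1, 5, 1)],
    (1, 2), (0, 1)⟩),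
  ((5, 4), ⟨[2, 3, 1, 4, 5, 0], [(0, 2, 3), (0, 4, 1), (1, 1, 3), (1, 4, 5), (2, 0, 0)],
    (1, 2), (0, 0)⟩)]

theorem rows_ok : ∀ r ∈ rows, r.2.OK ∧ (∀ i < 6, (r.2.pt i ≤ 1 ↔ i = 2 ∨ i = r.1.1)) ∧
    ∀ j < 5, (r.2.sg j).1 = 2 → j = r.1.2 := by decide +kernel

theorem rows_mem : ∀ e < 6, e ≠ 2 → ∀ j < 5, ¬ ((j = 2 ∨ j = e) ↔ (j + 1 = 2 ∨ j + 1 = e)) →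
    (e, j) ∈ rows.map Prod.fst := by
  intro e he he2 j hj h
  interval_cases e <;> interval_cases j <;> first | (exfalso; omega) | simp [rows]

theorem exists_layout (x : ℕ → ℤ) (hx : ∀ j < 5, x j < x (j + 1)) (e : ℕ) (he : e < 6)
    (he2 : e ≠ 2) :
    ∃ f : ℤ → ℤ, (∀ i, |f (i + 1) - f i| ≤ 5) ∧ Function.Injective f ∧
      ∀ i < 6, ∀ j < 6, ((i = 2 ∨ i = e) ↔ (j = 2 ∨ j = e)) → |f (x i) - f (x j)| ≤ 5 := by
  classical
  let S := (Finset.range 5).filter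
    (fun j => ¬ ((j = 2 ∨ j = e) ↔ (j + 1 = 2 ∨ j + 1 = e)))
  have hS : S.Nonempty := by
    by_cases h : e = 1
    · exact ⟨2, by simp [S, h]⟩
    · exact ⟨1, by simp [S]; omega⟩
  obtain ⟨m, hmS, hmin⟩ := Finset.exists_min_image S (fun j => x (j + 1) - x j) hS
  have hm := Finset.mem_filter.1 hmS
  have hm5 := Finset.mem_range.1 hm.1
  obtain ⟨r, hr, hre⟩ := List.mem_map.1 <| rows_mem e he he2 m hm5 hm.2
  obtain ⟨hok, hpt, htaut⟩ := rows_ok r hr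
  rw [hre] at hpt htaut
  have hxm := hx m hm5
  obtain ⟨f, fs, fi, fx⟩ := row_layout r.2 hok x (x (m + 1) - x m - 1) (by omega) hx
    (by
      intro j hj hne
      rw [hpt j (by omega), hpt (j + 1) (by omega)] at hne
      have := hmin j (Finset.mem_filter.2 ⟨Finset.mem_range.2 hj, hne⟩)
      omega)
    (by
      intro j hj h2
      have := htaut j hj h2
      dsimp only at this
      subst this
      omega)
  refine ⟨f, fs, fi, ?_⟩
  intro i hi j hj hij
  apply fx i hi j hj
  rw [hpt i hi, hpt j hj]
  exact hij

/-- An injective integer labelling bounds the bandwidth. -/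
theorem bandwidth_le_of_injective {n : ℕ} (G : SimpleGraph (Fin n)) (F : Fin n → ℤ)
    (hF : Function.Injective F) (B : ℕ) (hB : ∀ u v, G.Adj u v → |F u - F v| ≤ B) :
    bandwidth G ≤ B := by
  classical
  let R : Fin n → Finset (Fin n) := fun u => Finset.univ.filter (fun w => F w < F u)
  have hlt : ∀ u, (R u).card < n := by
    intro u
    have : R u ⊂ Finset.univ := by
      refine Finset.ssubset_univ_iff.2 ?_
      intro h
      have : u ∈ R u := by rw [h]; exact Finset.mem_univ u
      simp [R] at this
    simpa using Finset.card_lt_card this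
  have hle : ∀ u v, F u ≤ F v → (R u).card ≤ (R v).card ∧
      ((R v).card : ℤ) - (R u).card ≤ F v - F u := by
    intro u v huv
    have hsub : R u ⊆ R v := by
      intro w hw
      simp only [R, Finset.mem_filter, Finset.mem_univ, true_and] at hw ⊢
      omega
    refine ⟨Finset.card_le_card hsub, ?_⟩
    have h1 := Finset.card_sdiff_add_card_eq_card hsub
    have h2 : (R v \ R u).card ≤ (Finset.Ico (F u) (F v)).card := by
      refine Finset.card_le_card_of_injOn F ?_ hF.injOn
      intro w hw
      simp only [R, Finset.coe_sdiff, Set.mem_sdiff, Finset.mem_coe, Finset.mem_filter,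
        Finset.mem_univ, true_and] at hw
      simp only [Finset.mem_coe, Finset.mem_Ico]
      omega
    rw [Int.card_Ico] at h2
    omega
  have hstrict : ∀ u v, F u < F v → (R u).card < (R v).card := by
    intro u v huv
    apply Finset.card_lt_card
    refine Finset.ssubset_iff_subset_ne.2 ⟨?_, ?_⟩
    · intro w hw
      simp only [R, Finset.mem_filter, Finset.mem_univ, true_and] at hw ⊢
      omega
    · intro h
      have : u ∈ R v := by simpa [R] using huv
      rw [← h] at this
      simp [R] at this
  let σ0 : Fin n → Fin n := fun u => ⟨(R u).card, hlt u⟩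
  have hinj : Function.Injective σ0 := by
    intro u v huv
    have huv' : (R u).card = (R v).card := by simpa [σ0] using huv
    rcases lt_trichotomy (F u) (F v) with h | h | h
    · have := hstrict u v h
      omega
    · exact hF h
    · have := hstrict v u h
      omega
  apply Nat.sInf_le
  refine ⟨Equiv.ofBijective σ0 (Finite.injective_iff_bijective.1 hinj), ?_⟩
  intro u v huv
  have h := hB u v huv
  rw [abs_le] at h
  simp only [Equiv.ofBijective_apply, σ0]
  rcases le_total (F u) (F v) with h' | h'
  · have := hle u v h'
    omega
  · have := hle v u h'
    omega

/-- The six arc endpoints in increasing order, with the partner of the third one. -/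
theorem arcs_sorted {n : ℕ} (A : Finset (Fin n × Fin n)) (hA : IsArcSet n A) (hk : A.card = 3) :
    ∃ (x : ℕ → ℤ) (e : ℕ), (∀ j < 5, x j < x (j + 1)) ∧ e < 6 ∧ e ≠ 2 ∧
      ∀ p ∈ A, ∃ i < 6, ∃ j < 6, ((p.1 : ℕ) : ℤ) = x i ∧ ((p.2 : ℕ) : ℤ) = x j ∧
        ((i = 2 ∨ i = e) ↔ (j = 2 ∨ j = e)) := by
  classical
  obtain ⟨h1, h2⟩ := hA
  let S : Finset (Fin n) := A.image Prod.fst ∪ A.image Prod.snd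
  have hS : S.card = 6 := by
    have c1 : (A.image Prod.fst).card = 3 := by
      rw [Finset.card_image_of_injOn, hk]
      intro p hp q hq hpq
      by_contra hne
      exact (h2 p hp q hq hne).1 hpq
    have c2 : (A.image Prod.snd).card = 3 := by
      rw [Finset.card_image_of_injOn, hk]
      intro p hp q hq hpq
      by_contra hne
      exact (h2 p hp q hq hne).2.2.2 hpq
    have hdis : Disjoint (A.image Prod.fst) (A.image Prod.snd) := by
      rw [Finset.disjoint_left]
      intro z hz hz'
      obtain ⟨p, hp, rfl⟩ := Finset.mem_image.1 hz
      obtain ⟨q, hq, hpq⟩ := Finset.mem_image.1 hz'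
      by_cases hne : p = q
      · subst hne
        have := h1 p hp
        rw [hpq] at this
        omega
      · exact (h2 p hp q hq hne).2.1 hpq.symm
    rw [Finset.card_union_of_disjoint hdis, c1, c2]
  let X := S.orderEmbOfFin hS
  have hX : ∀ z ∈ S, ∃ i : Fin 6, X i = z := by
    intro z hz
    have : z ∈ Set.range X := by rw [Finset.range_orderEmbOfFin]; exact hz
    exact this
  have hf : ∀ p ∈ A, p.1 ∈ S := fun p hp =>
    Finset.mem_union_left _ (Finset.mem_image_of_mem _ hp)
  have hs : ∀ p ∈ A, p.2 ∈ S := fun p hp =>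
    Finset.mem_union_right _ (Finset.mem_image_of_mem _ hp)
  -- the partner of the third endpoint
  have hpart : ∃ r ∈ A, ∃ e : Fin 6, e ≠ 2 ∧
      ((r.1 = X 2 ∧ r.2 = X e) ∨ (r.2 = X 2 ∧ r.1 = X e)) := by
    have hX2 : X 2 ∈ S := Finset.orderEmbOfFin_mem S hS 2
    rcases Finset.mem_union.1 hX2 with h | h
    · obtain ⟨r, hr, hr2⟩ := Finset.mem_image.1 h
      obtain ⟨e, he⟩ := hX _ (hs r hr)
      refine ⟨r, hr, e, ?_, Or.inl ⟨hr2, he.symm⟩⟩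
      rintro rfl
      have := h1 r hr
      rw [← he, hr2] at this
      omega
    · obtain ⟨r, hr, hr2⟩ := Finset.mem_image.1 h
      obtain ⟨e, he⟩ := hX _ (hf r hr)
      refine ⟨r, hr, e, ?_, Or.inr ⟨hr2, he.symm⟩⟩
      rintro rfl
      have := h1 r hr
      rw [← he, hr2] at this
      omega
  obtain ⟨r, hr, e, he2, hre⟩ := hpart
  refine ⟨fun j => if hj : j < 6 then ((X ⟨j, hj⟩ : Fin n) : ℕ) else 0, e, ?_, e.2, ?_, ?_⟩
  · intro j hj
    have hlt : X ⟨j, by omega⟩ < X ⟨j + 1, by omega⟩ := X.strictMono (by simp)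
    have : (X ⟨j, by omega⟩ : ℕ) < (X ⟨j + 1, by omega⟩ : ℕ) := hlt
    simp only [show j < 6 by omega, show j + 1 < 6 by omega, dif_pos]
    exact_mod_cast this
  · intro h
    exact he2 (Fin.ext h)
  · intro p hp
    obtain ⟨i, hi⟩ := hX _ (hf p hp)
    obtain ⟨j, hj⟩ := hX _ (hs p hp)
    refine ⟨i, i.2, j, j.2, by simp [hi], by simp [hj], ?_⟩
    have t : ∀ k : Fin 6, ((k : ℕ) = 2 ∨ (k : ℕ) = (e : ℕ)) ↔ (X k = X 2 ∨ X k = X e) := by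
      intro k
      rw [X.injective.eq_iff, X.injective.eq_iff, Fin.ext_iff, Fin.ext_iff]
      rfl
    rw [t, t, hi, hj]
    by_cases hpr : p = r
    · subst hpr
      tauto
    · obtain ⟨q1, q2, q3, q4⟩ := h2 p hp r hr hpr
      rcases hre with ⟨w1, w2⟩ | ⟨w1, w2⟩ <;> rw [← w1, ← w2] <;> tauto

/-- For every sparse Hamiltonian graph `G` with exactly 3 arcs,
`B(G) ≤ 5`. -/
theorem statement_4 {n : ℕ} (A : Finset (Fin n × Fin n)) (hA : IsArcSet n A)
    (hk : A.card = 3) :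
    bandwidth (sparseHamGraph n A) ≤ 5 := by
  obtain ⟨x, e, hx, he, he2, harc⟩ := arcs_sorted A hA hk
  obtain ⟨f, fs, fi, fx⟩ := exists_layout x hx e he he2
  apply bandwidth_le_of_injective _ (fun u => f ((u : ℕ) : ℤ))
  · intro u v huv
    have := fi huv
    exact Fin.ext (by exact_mod_cast this)
  · have key : ∀ u v : Fin n, ((u : ℕ) + 1 = (v : ℕ) ∨ (u, v) ∈ A) →
        |f ((u : ℕ) : ℤ) - f ((v : ℕ) : ℤ)| ≤ 5 := by
      intro u v h
      rcases h with h | h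
      · have := fs ((u : ℕ) : ℤ)
        rw [← h, abs_sub_comm]
        push_cast
        exact this
      · obtain ⟨i, hi, j, hj, e1, e2, hij⟩ := harc _ h
        dsimp only at e1 e2
        rw [e1, e2]
        exact fx i hi j hj hij
    intro u v huv
    rw [sparseHamGraph, SimpleGraph.fromRel_adj] at huv
    rcases huv.2 with h | h
    · exact_mod_cast key u v h
    · rw [abs_sub_comm]
      exact_mod_cast key v u h
end

section
/- For every finite simple graph G on n vertices and every t ≥ 1, the general coded stretch metric with no redundancy equals the uncoded one: S^gc_t(G,n) = S^u_t(G,n). That is, coding (linear or nonlinear) cannot reduce the stretch metric when the store has exactly n chunks. -/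
/-- Chunk `i` is recoverable from the interval `[a,b]` of positions of the (general,
possibly nonlinear) coded store `f`: the values of the stored chunks with positions in
`[a,b]` determine `x i`. -/
def Recovers {n m : ℕ} {σ : Type*} (f : Fin m → (Fin n → σ) → σ) (a b : ℕ) (i : Fin n) :
    Prop :=
  ∀ x y : Fin n → σ, (∀ j : Fin m, a ≤ (j : ℕ) → (j : ℕ) ≤ b → f j x = f j y) → x i = y i

/-- The general coded stretch metric `S^gc_t(G,m)` over the alphabet `σ`: the minimum over
coded chunk stores (injective `m`-tuples of functions `(Fin n → σ) → σ`) of the maximum over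
simple paths with at most `t` vertices of `MinS^gc(s,p)`. -/
noncomputable def gcStretch (σ : Type*) {n : ℕ} (G : SimpleGraph (Fin n)) (t m : ℕ) : ℝ :=
  sInf { r : ℝ | ∃ f : Fin m → (Fin n → σ) → σ,
    Function.Injective (fun (x : Fin n → σ) (j : Fin m) => f j x) ∧
    ∀ (u v : Fin n) (p : G.Walk u v), p.IsPath → p.length + 1 ≤ t →
      ∃ a b : ℕ, a ≤ b ∧ b < m ∧ (∀ i ∈ p.support, Recovers f a b i) ∧
        ((b - a + 1 : ℕ) : ℝ) ≤ r * ((p.length : ℝ) + 1) }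

/-- Recoverability from an arbitrary finite set of positions. -/
def RecSet {n : ℕ} {σ : Type*} (f : Fin n → (Fin n → σ) → σ) (i : Fin n)
    (S : Finset (Fin n)) : Prop :=
  ∀ x y : Fin n → σ, (∀ j ∈ S, f j x = f j y) → x i = y i

/-- With no redundancy, there is a permutation placing every chunk inside every interval
recovering it. -/
theorem exists_rep {n : ℕ} {σ : Type*} [Fintype σ] (hσ : 2 ≤ Fintype.card σ)
    (f : Fin n → (Fin n → σ) → σ)
    (hf : Function.Injective (fun (x : Fin n → σ) (j : Fin n) => f j x)) :
    ∃ e : Fin n → Fin n, Function.Injective e ∧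
      ∀ i S, RecSet f i S → e i ∈ S := by
  classical
  have hsurj : Function.Surjective (fun (x : Fin n → σ) (j : Fin n) => f j x) :=
    Finite.surjective_of_injective hf
  have : Nonempty σ := Fintype.card_pos_iff.1 (by omega)
  obtain ⟨d⟩ := this
  let T : Fin n → Finset (Fin n) := fun i => (Finset.univ.filter (RecSet f i)).inf id
  have hT : ∀ i, RecSet f i (T i) := by
    intro i
    refine Finset.inf_induction ?_ ?_ ?_
    · intro x y h
      have : x = y := hf (funext fun j => h j (Finset.mem_univ j))
      rw [this]
    · intro S hS S' hS' x y h
      obtain ⟨z, hz⟩ := hsurj (fun j => if j ∈ S then f j x else f j y)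
      have hz' : ∀ j, f j z = if j ∈ S then f j x else f j y := fun j => congrFun hz j
      have h1 : x i = z i := hS x z (fun j hj => by rw [hz', if_pos hj])
      have h2 : z i = y i := hS' z y (fun j hj => by
        rw [hz']
        split_ifs with hj'
        · exact h j (Finset.mem_inter.2 ⟨hj', hj⟩)
        · rfl)
      exact h1.trans h2
    · intro S hS
      exact (Finset.mem_filter.1 hS).2
  have hall : ∀ A : Finset (Fin n), A.card ≤ (A.biUnion T).card := by
    intro A
    let ext : (A → σ) → Fin n → σ := fun w i => if h : i ∈ A then w ⟨i, h⟩ else d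
    let φ : (A → σ) → (A.biUnion T → σ) := fun w j => f j (ext w)
    have hφ : Function.Injective φ := by
      intro w w' h
      funext i
      have := hT i (ext w) (ext w') (fun j hj =>
        congrFun h ⟨j, Finset.mem_biUnion.2 ⟨i, i.2, hj⟩⟩)
      simpa [ext] using this
    have hc := Fintype.card_le_of_injective φ hφ
    simp only [Fintype.card_fun, Fintype.card_coe] at hc
    exact (Nat.pow_le_pow_iff_right (by omega)).1 hc
  obtain ⟨e, he, hm⟩ := (Finset.all_card_le_biUnion_card_iff_exists_injective T).1 hall
  refine ⟨e, he, fun i S hS => ?_⟩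
  have hle : T i ≤ S := Finset.inf_le (f := id) (Finset.mem_filter.2 ⟨Finset.mem_univ S, hS⟩)
  exact hle (hm i)

/-- For every finite simple graph `G` on `n` vertices and every `t ≥ 1`
(and every finite alphabet with at least two symbols), the general coded stretch metric with
no redundancy equals the uncoded one: coding cannot reduce the stretch metric when the store
has exactly `n` chunks. -/
theorem statement_6 {n : ℕ} (G : SimpleGraph (Fin n)) (t : ℕ) (ht : 1 ≤ t)
    (σ : Type*) [Fintype σ] (hσ : 2 ≤ Fintype.card σ) :
    gcStretch σ G t n = uncodedStretch G t n := by
  classical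
  unfold gcStretch uncodedStretch
  congr 1
  ext r
  constructor
  · rintro ⟨f, hf, h⟩
    obtain ⟨e, he, hrep⟩ := exists_rep hσ f hf
    let E : Fin n ≃ Fin n := Equiv.ofBijective e (Finite.injective_iff_bijective.1 he)
    refine ⟨E.symm, E.symm.surjective, fun u v p hp hl => ?_⟩
    obtain ⟨a, b, hab, hb, hr, hle⟩ := h u v p hp hl
    refine ⟨a, b, hab, hb, fun x hx => ?_, hle⟩
    have hmem := hrep x (Finset.univ.filter (fun j : Fin n => a ≤ (j : ℕ) ∧ (j : ℕ) ≤ b))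
      (fun y z hyz => hr x hx y z (fun j h1 h2 => hyz j (by simp [h1, h2])))
    have hm := (Finset.mem_filter.1 hmem).2
    exact ⟨e x, hm.1, hm.2, E.symm_apply_apply x⟩
  · rintro ⟨s, hs, h⟩
    refine ⟨fun j x => x (s j), ?_, fun u v p hp hl => ?_⟩
    · intro x y hxy
      funext i
      obtain ⟨j, rfl⟩ := hs i
      exact congrFun hxy j
    · obtain ⟨a, b, hab, hb, hr, hle⟩ := h u v p hp hl
      refine ⟨a, b, hab, hb, fun i hi x y hxy => ?_, hle⟩
      obtain ⟨j, h1, h2, rfl⟩ := hr i hi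
      exact hxy j h1 h2
end

section
/- For every finite simple graph G on n vertices x_1,…,x_n and every t ≥ 1, the minimum linearly coded stretch S^c_t(G,n+1) over linearly coded chunk stores with one redundant chunk is attained by a store of the following special form: there exist N with 1 ≤ N ≤ n and a partition of {1,…,n} into sequences a_1,…,a_{n−N} and b_1,…,b_N such that the optimal store s of length n+1 is an interleaving (a merge preserving the relative order of each sequence) of the uncoded chunks x_{a_1},…,x_{a_{n−N}} with the coded chunks y_1,…,y_{N+1}, where y_1 = x_{b_1}, y_{N+1} = x_{b_N}, and y_i = x_{b_{i−1}} ⊕ x_{b_i} for 1 < i < N+1 (equivalently, the defining subsets at the y-positions are {b_1},{b_1,b_2},…,{b_{N−1},b_N},{b_N} and singletons {a_j} elsewhere). -/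
/-- The linear map of a linearly coded chunk store: position `j` stores the XOR
`⊕_{i ∈ A j} x i`. -/
def linMap {n m : ℕ} (A : Fin m → Finset (Fin n)) (x : Fin n → ZMod 2) : Fin m → ZMod 2 :=
  fun j => ∑ i ∈ A j, x i

/-- `A` is a linearly coded chunk store: the map `(x_1,…,x_n) ↦ (s_1,…,s_m)` is injective. -/
def IsLinStore {n m : ℕ} (A : Fin m → Finset (Fin n)) : Prop :=
  Function.Injective (linMap A)

/-- Coordinate `i` is recoverable from the interval `[a,b]` of positions of the linearly
coded store `A`: some subset `D` of positions in `[a,b]` has `Σ_{j ∈ D} 1_{A j} = e_i`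
over `𝔽₂`. -/
def LinRecovers {n m : ℕ} (A : Fin m → Finset (Fin n)) (a b : ℕ) (i : Fin n) : Prop :=
  ∃ D : Finset (Fin m), (∀ j ∈ D, a ≤ (j : ℕ) ∧ (j : ℕ) ≤ b) ∧
    ∀ i' : Fin n, (∑ j ∈ D, if i' ∈ A j then (1 : ZMod 2) else 0) = if i' = i then 1 else 0

/-- The linearly coded stretch metric `S^c_t(G,m)`. -/
noncomputable def linStretch {n : ℕ} (G : SimpleGraph (Fin n)) (t m : ℕ) : ℝ :=
  sInf { r : ℝ | ∃ A : Fin m → Finset (Fin n), IsLinStore A ∧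
    ∀ (u v : Fin n) (p : G.Walk u v), p.IsPath → p.length + 1 ≤ t →
      ∃ a b : ℕ, a ≤ b ∧ b < m ∧ (∀ i ∈ p.support, LinRecovers A a b i) ∧
        ((b - a + 1 : ℕ) : ℝ) ≤ r * ((p.length : ℝ) + 1) }

/-- The special form of Theorem 5.4: the store of length `n+1` is an interleaving of uncoded
chunks `x_{a_1},…,x_{a_{n−N}}` with coded chunks `y_1 = x_{b_1}`, `y_i = x_{b_{i−1}} ⊕ x_{b_i}`
(`1 < i < N+1`), `y_{N+1} = x_{b_N}`, where `b_1,…,b_N, a_1,…,a_{n−N}` partition the user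
chunks. -/
def SpecialForm {n : ℕ} (A : Fin (n + 1) → Finset (Fin n)) : Prop :=
  ∃ (N : ℕ) (hN1 : 1 ≤ N) (_ : N ≤ n) (b : Fin N → Fin n) (pos : Fin (N + 1) → Fin (n + 1)),
    Function.Injective b ∧ StrictMono pos ∧
    (∀ i : Fin (N + 1), A (pos i) =
      if h0 : (i : ℕ) = 0 then {b ⟨0, hN1⟩}
      else if hN : (i : ℕ) = N then {b ⟨N - 1, by omega⟩}
      else {b ⟨(i : ℕ) - 1, by have := i.isLt; omega⟩, b ⟨(i : ℕ), by have := i.isLt; omega⟩}) ∧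
    (∀ j : Fin (n + 1), j ∉ Set.range pos →
      ∃ a : Fin n, a ∉ Set.range b ∧ A j = {a}) ∧
    (∀ a : Fin n, a ∉ Set.range b → ∃ j : Fin (n + 1), j ∉ Set.range pos ∧ A j = {a}) ∧
    (∀ j j' : Fin (n + 1), j ∉ Set.range pos → j' ∉ Set.range pos → j ≠ j' → A j ≠ A j')

lemma sp_exchange {K V ι : Type*} [Field K] [AddCommGroup V] [Module K V] [DecidableEq ι]
    (v : ι → V) (hv : LinearIndependent K v) (S : ι → Set V) (s : Finset ι) :
    (∀ i ∈ s, v i ∈ Submodule.span K (S i ∪ v '' {j | j ∉ s})) →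
    ∃ w : ι → V, LinearIndependent K w ∧ (∀ j, j ∉ s → w j = v j) ∧ ∀ i ∈ s, w i ∈ S i := by
  induction s using Finset.induction_on with
  | empty => exact fun _ => ⟨v, hv, by simp, by simp⟩
  | insert i s his ih =>
    intro h
    obtain ⟨w, hw, hw1, hw2⟩ := ih (by
      intro j hj
      refine Submodule.span_mono ?_ (h j (Finset.mem_insert_of_mem hj))
      refine Set.union_subset_union_right _ (Set.image_mono ?_)
      intro k hk
      simp only [Set.mem_ofPred_eq, Finset.mem_insert, not_or] at hk ⊢
      exact hk.2)
    have hx : ∃ x ∈ S i, x ∉ Submodule.span K (w '' {j | j ≠ i}) := by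
      by_contra hcon
      push Not at hcon
      have h1 : v i ∈ Submodule.span K (w '' {j | j ≠ i}) := by
        refine Submodule.span_le.2 ?_ (h i (Finset.mem_insert_self _ _))
        rintro y (hy | ⟨j, hj, rfl⟩)
        · exact hcon y hy
        · simp only [Set.mem_ofPred_eq, Finset.mem_insert, not_or] at hj
          rw [← hw1 j hj.2]
          exact Submodule.subset_span ⟨j, hj.1, rfl⟩
      rw [← hw1 i his] at h1
      exact hw.notMem_span_image (s := {j | j ≠ i}) (x := i) (by simp) h1
    obtain ⟨x, hxS, hxn⟩ := hx
    refine ⟨Function.update w i x, ?_, ?_, ?_⟩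
    · rw [linearIndependent_iff']
      intro t g hg
      have key : ∀ j, j ≠ i → Function.update w i x j = w j := fun j hj => Function.update_of_ne hj _ _
      by_cases hit : i ∈ t ∧ g i ≠ 0
      · exfalso
        apply hxn
        rw [← Finset.add_sum_erase _ _ hit.1, Function.update_self] at hg
        have hxe : x = (-(g i)⁻¹) • ∑ j ∈ t.erase i, g j • Function.update w i x j := by
          have : ∑ j ∈ t.erase i, g j • Function.update w i x j = -(g i • x) := by
            rw [eq_neg_iff_add_eq_zero, add_comm]; exact hg
          rw [this, smul_neg, neg_smul, neg_neg, smul_smul, inv_mul_cancel₀ hit.2, one_smul]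
        rw [hxe]
        refine Submodule.smul_mem _ _ (Submodule.sum_mem _ fun j hj => Submodule.smul_mem _ _ ?_)
        have hji := (Finset.mem_erase.1 hj).1
        rw [key j hji]
        exact Submodule.subset_span ⟨j, hji, rfl⟩
      · have hgi : i ∈ t → g i = 0 := by
          intro hi; by_contra h0; exact hit ⟨hi, h0⟩
        have : ∑ j ∈ t, g j • w j = 0 := by
          rw [← hg]
          refine Finset.sum_congr rfl fun j hj => ?_
          by_cases hji : j = i
          · subst hji; simp [hgi hj]
          · rw [key j hji]
        exact linearIndependent_iff'.1 hw t g this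
    · intro j hj
      simp only [Finset.mem_insert, not_or] at hj
      rw [Function.update_of_ne hj.1, hw1 j hj.2]
    · intro j hj
      by_cases hji : j = i
      · subst hji; simpa using hxS
      · rw [Function.update_of_ne hji]
        exact hw2 j ((Finset.mem_insert.1 hj).resolve_left hji)

lemma sp_abel {K V : Type*} [Field K] [AddCommGroup V] [Module K V] (M : Submodule K V)
    (f : ℕ → K) (u : ℕ → V) (N : ℕ)
    (hG : ∀ l < N, f l ≠ f (l + 1) → ∑ k ∈ Finset.range (l + 1), u k ∈ M)
    (hN : ∑ k ∈ Finset.range (N + 1), u k ∈ M) :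
    ∑ k ∈ Finset.range (N + 1), f k • u k ∈ M := by
  have key : ∀ k ≤ N, ∑ i ∈ Finset.range (k + 1), f i • u i
      - f k • ∑ i ∈ Finset.range (k + 1), u i ∈ M := by
    intro k
    induction k with
    | zero => intro _; simp
    | succ k ih =>
      intro hk
      have h1 := ih (by omega)
      have h2 : (f k - f (k + 1)) • ∑ i ∈ Finset.range (k + 1), u i ∈ M := by
        by_cases h : f k = f (k + 1)
        · simp [h]
        · exact M.smul_mem _ (hG k (by omega) h)
      have h3 := M.add_mem h1 h2
      rw [Finset.sum_range_succ (fun i => f i • u i) (k + 1), Finset.sum_range_succ u (k + 1)]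
      convert h3 using 1
      module
  have := M.add_mem (key N le_rfl) (M.smul_mem (f N) hN)
  simpa using this

def SpIn {m : ℕ} (v : Fin m → ZMod 2) (a b : ℕ) : Prop :=
  ∀ j, v j ≠ 0 → a ≤ (j : ℕ) ∧ (j : ℕ) ≤ b

def SpT {m : ℕ} (C v : Fin m → ZMod 2) : Prop :=
  ∀ a b, SpIn (v + C) a b → SpIn v a b

def SpO {m : ℕ} (C v : Fin m → ZMod 2) : Prop :=
  (∀ a b, SpIn v a b → ∀ j, C j ≠ 0 → a ≤ (j : ℕ)) ∧
  (∀ a b, SpIn (v + C) a b → ∀ j, C j ≠ 0 → (j : ℕ) ≤ b)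

lemma sp_minmax {m : ℕ} (v : Fin m → ZMod 2) (hv : v ≠ 0) :
    ∃ a b : Fin m, v a ≠ 0 ∧ v b ≠ 0 ∧ ∀ j, v j ≠ 0 → a ≤ j ∧ j ≤ b := by
  obtain ⟨j, hj⟩ := Function.ne_iff.1 hv
  have hne : (Finset.univ.filter fun j => v j ≠ 0).Nonempty := ⟨j, by simpa using hj⟩
  refine ⟨_, _, (Finset.mem_filter.1 (Finset.min'_mem _ hne)).2,
    (Finset.mem_filter.1 (Finset.max'_mem _ hne)).2, fun k hk => ⟨?_, ?_⟩⟩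
  · exact Finset.min'_le _ _ (by simpa using hk)
  · exact Finset.le_max' _ _ (by simpa using hk)

lemma sp_add_add {m : ℕ} (v C : Fin m → ZMod 2) : v + C + C = v := by
  ext j
  simp [add_assoc, CharTwo.add_self_eq_zero]

lemma sp_class {m : ℕ} (C v : Fin m → ZMod 2) (hv : v ≠ 0) (hv2 : v + C ≠ 0) :
    (SpT C v ∨ SpO C v) ∨ (SpT C (v + C) ∨ SpO C (v + C)) := by
  unfold SpT SpO
  rw [sp_add_add]
  obtain ⟨a, b, ha, hb, h1⟩ := sp_minmax v hv
  obtain ⟨c, d, hc, hd, h2⟩ := sp_minmax (v + C) hv2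
  have hC : ∀ j, C j ≠ 0 → v j ≠ 0 ∨ (v + C) j ≠ 0 := by
    intro j hj
    by_contra hcon
    push Not at hcon
    apply hj
    have := hcon.2
    rw [Pi.add_apply, hcon.1, zero_add] at this
    exact this
  have e1 : ∀ x y, SpIn v x y ↔ x ≤ (a : ℕ) ∧ (b : ℕ) ≤ y := by
    intro x y
    refine ⟨fun h => ⟨(h a ha).1, (h b hb).2⟩, fun h j hj => ?_⟩
    have := h1 j hj
    simp only [Fin.le_def] at this
    omega
  have e2 : ∀ x y, SpIn (v + C) x y ↔ x ≤ (c : ℕ) ∧ (d : ℕ) ≤ y := by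
    intro x y
    refine ⟨fun h => ⟨(h c hc).1, (h d hd).2⟩, fun h j hj => ?_⟩
    have := h2 j hj
    simp only [Fin.le_def] at this
    omega
  have hCb : ∀ j, C j ≠ 0 → ((a : ℕ) ≤ j ∨ (c : ℕ) ≤ j) ∧ ((j : ℕ) ≤ b ∨ (j : ℕ) ≤ d) := by
    intro j hj
    rcases hC j hj with h | h
    · have := h1 j h; simp only [Fin.le_def] at this; omega
    · have := h2 j h; simp only [Fin.le_def] at this; omega
  simp only [e1, e2]
  by_cases hac : (a : ℕ) < c
  · by_cases hbd : (b : ℕ) < d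
    · left; right
      exact ⟨fun x y h j hj => by have := hCb j hj; omega, fun x y h j hj => by have := hCb j hj; omega⟩
    · right; left
      intro x y h; omega
  · by_cases hbd : (b : ℕ) ≤ d
    · left; left
      intro x y h; omega
    · right; right
      exact ⟨fun x y h j hj => by have := hCb j hj; omega, fun x y h j hj => by have := hCb j hj; omega⟩

def SpGood {n N : ℕ} (P : Finset (Fin (n + 1))) (hP : P.card = N + 1)
    (x : {q : Fin (n + 1) // q ∉ P} ⊕ Fin N) (a b : ℕ) : Prop :=
  match x with
  | Sum.inl q => a ≤ (q.1 : ℕ) ∧ (q.1 : ℕ) ≤ b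
  | Sum.inr j =>
    (∀ l : Fin (N + 1), l ≤ j.castSucc →
      a ≤ (P.orderEmbOfFin hP l : ℕ) ∧ (P.orderEmbOfFin hP l : ℕ) ≤ b) ∨
    (∀ l : Fin (N + 1), j.castSucc < l →
      a ≤ (P.orderEmbOfFin hP l : ℕ) ∧ (P.orderEmbOfFin hP l : ℕ) ≤ b)

lemma sp_core0 {n : ℕ} (E : Fin n → Fin (n + 1) → ZMod 2) (C : Fin (n + 1) → ZMod 2)
    (hLI : LinearIndependent (ZMod 2) (fun o : Option (Fin n) => o.elim C E))
    (hTO : ∀ i, SpT C (E i) ∨ SpO C (E i)) :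
    ∃ (N : ℕ) (P : Finset (Fin (n + 1))) (hP : P.card = N + 1)
      (φ : Fin n → {q : Fin (n + 1) // q ∉ P} ⊕ Fin N), Function.Injective φ ∧
      ∀ i a b, (SpIn (E i) a b ∨ SpIn (E i + C) a b) → SpGood P hP (φ i) a b := by
  classical
  have hdecomp : ∀ v : Fin (n + 1) → ZMod 2,
      v = ∑ q, v q • (Pi.single q 1 : Fin (n + 1) → ZMod 2) := fun v => by
    ext j; simp [Finset.sum_apply, Pi.single_apply]
  -- first exchange
  obtain ⟨w, hw, hw1, hw2⟩ := sp_exchange _ hLI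
    (fun o => {y | ∃ q, o.elim C E q ≠ 0 ∧ y = Pi.single q 1})
    (Finset.univ.filter fun o : Option (Fin n) => ∃ i, o = some i ∧ SpT C (E i)) (by
      intro o _
      conv_rhs => rw [hdecomp (o.elim C E)]
      refine Submodule.sum_mem _ fun q _ => ?_
      by_cases hq : o.elim C E q = 0
      · rw [hq, zero_smul]; exact Submodule.zero_mem _
      · exact Submodule.smul_mem _ _ (Submodule.subset_span (Or.inl ⟨q, hq, rfl⟩)))
  have hwC : w none = C := hw1 none (by simp)
  have hwO : ∀ i, ¬ SpT C (E i) → w (some i) = E i := fun i hi => hw1 (some i) (by simpa using hi)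
  have hwT : ∀ i, SpT C (E i) → ∃ q, E i q ≠ 0 ∧ w (some i) = Pi.single q 1 :=
    fun i hi => hw2 (some i) (by simpa using hi)
  clear hw1 hw2
  set P : Finset (Fin (n + 1)) := Finset.univ.filter fun p =>
    C p ≠ 0 ∧ ∀ i, SpT C (E i) → w (some i) ≠ Pi.single p 1 with hPdef
  have hPmem : ∀ p, p ∈ P ↔ C p ≠ 0 ∧ ∀ i, SpT C (E i) → w (some i) ≠ Pi.single p 1 := by
    intro p; simp [hPdef]
  have hPne : P.Nonempty := by
    by_contra hcon
    rw [Finset.not_nonempty_iff_eq_empty] at hcon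
    have : w none ∈ Submodule.span (ZMod 2) (w '' {o | o ≠ none}) := by
      rw [hwC, hdecomp C]
      refine Submodule.sum_mem _ fun q _ => ?_
      by_cases hq : C q = 0
      · rw [hq, zero_smul]; exact Submodule.zero_mem _
      · refine Submodule.smul_mem _ _ (Submodule.subset_span ?_)
        have hqP : q ∉ P := by rw [hcon]; simp
        rw [hPmem] at hqP
        push Not at hqP
        obtain ⟨i, _, hi⟩ := hqP hq
        exact ⟨some i, by simp, hi⟩
    exact hw.notMem_span_image (s := {o | o ≠ none}) (x := none) (by simp) this
  obtain ⟨N, hP⟩ : ∃ N, P.card = N + 1 := ⟨P.card - 1, by have := hPne.card_pos; omega⟩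
  set pos := P.orderEmbOfFin hP with hpos
  let u : ℕ → Fin (n + 1) → ZMod 2 := fun k =>
    if h : k < N + 1 then Pi.single (pos ⟨k, h⟩) 1 else 0
  let g : Fin N → Fin (n + 1) → ZMod 2 := fun l => ∑ k ∈ Finset.range ((l : ℕ) + 1), u k
  -- sums over P
  have hsumP : ∀ F : Fin (n + 1) → (Fin (n + 1) → ZMod 2),
      ∑ p ∈ P, F p = ∑ k : Fin (N + 1), F (pos k) := by
    intro F
    have : P = Finset.univ.map pos.toEmbedding := by
      rw [hpos, Finset.map_eq_image]
      ext x
      simp only [Finset.mem_image, Finset.mem_univ, true_and]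
      have := Finset.range_orderEmbOfFin P hP
      have h2 := Set.ext_iff.1 this x
      simp only [Set.mem_range, Finset.mem_coe] at h2
      exact h2.symm
    conv_lhs => rw [this]
    rw [Finset.sum_map]
    rfl
  have hposmem : ∀ k, pos k ∈ P := fun k => Finset.orderEmbOfFin_mem P hP k
  -- second exchange
  obtain ⟨x, hx, hx1, hx2⟩ := sp_exchange w hw
    (fun o => {y | (∃ q, o.elim C E q ≠ 0 ∧ C q = 0 ∧ y = Pi.single q 1) ∨
      ∃ l : Fin N, o.elim C E (pos l.castSucc) ≠ o.elim C E (pos l.succ) ∧ y = g l})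
    (Finset.univ.filter fun o : Option (Fin n) => ∃ i, o = some i ∧ ¬ SpT C (E i)) (by
      intro o ho
      simp only [Finset.mem_filter, Finset.mem_univ, true_and] at ho
      obtain ⟨i, rfl, hi⟩ := ho
      rw [hwO i hi]
      set M := Submodule.span (ZMod 2) ({y | (∃ q, (some i).elim C E q ≠ 0 ∧ C q = 0 ∧
        y = Pi.single q 1) ∨ ∃ l : Fin N, (some i).elim C E (pos l.castSucc) ≠
          (some i).elim C E (pos l.succ) ∧ y = g l} ∪ w '' {j | j ∉ (Finset.univ.filter
            fun o : Option (Fin n) => ∃ i, o = some i ∧ ¬ SpT C (E i))}) with hM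
      have hMC : C ∈ M := Submodule.subset_span (Or.inr ⟨none, by simp, hwC⟩)
      have hMQ : ∀ q, q ∉ P → C q ≠ 0 → (Pi.single q 1 : Fin (n + 1) → ZMod 2) ∈ M := by
        intro q hq hCq
        rw [hPmem] at hq
        push Not at hq
        obtain ⟨i', hT, hi'⟩ := hq hCq
        exact Submodule.subset_span (Or.inr ⟨some i', by simpa using hT, hi'⟩)
      have hMP : ∑ p ∈ P, (Pi.single p 1 : Fin (n + 1) → ZMod 2) ∈ M := by
        have h1 := hdecomp C
        rw [← Finset.sum_add_sum_compl P] at h1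
        have h2 : ∑ p ∈ P, C p • (Pi.single p 1 : Fin (n + 1) → ZMod 2)
            = ∑ p ∈ P, Pi.single p 1 := by
          refine Finset.sum_congr rfl fun p hp => ?_
          have : C p = 1 := by
            have := ((hPmem p).1 hp).1
            revert this; generalize C p = z; revert z; decide
          rw [this, one_smul]
        rw [h2] at h1
        rw [← sub_eq_iff_eq_add] at h1
        rw [← h1]
        refine M.sub_mem hMC (M.sum_mem fun q hq => ?_)
        by_cases hCq : C q = 0
        · rw [hCq, zero_smul]; exact M.zero_mem
        · exact M.smul_mem _ (hMQ q (Finset.mem_compl.1 hq) hCq)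
      rw [hdecomp (E i), ← Finset.sum_add_sum_compl P]
      refine M.add_mem ?_ (M.sum_mem fun q hq => ?_)
      · rw [hsumP] at hMP ⊢
        have habel := sp_abel M (fun k => if h : k < N + 1 then E i (pos ⟨k, h⟩) else 0) u N
          (by
            intro l hl hne
            have hl1 : l < N + 1 := by omega
            have hl2 : l + 1 < N + 1 := by omega
            simp only [hl1, hl2, dif_pos] at hne
            exact Submodule.subset_span (Or.inl (Or.inr ⟨⟨l, hl⟩, hne, rfl⟩)))
          (by
            rw [Finset.sum_range]
            convert hMP using 2 with k
            simp only [u, k.isLt, dif_pos])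
        rw [Finset.sum_range] at habel
        convert habel using 2 with k
        simp only [u, k.isLt, dif_pos]
      · by_cases hE : E i q = 0
        · rw [hE, zero_smul]; exact M.zero_mem
        · refine M.smul_mem _ ?_
          by_cases hCq : C q = 0
          · exact Submodule.subset_span (Or.inl (Or.inl ⟨q, hE, hCq, rfl⟩))
          · exact hMQ q (Finset.mem_compl.1 hq) hCq)
  have hxT : ∀ i, SpT C (E i) → x (some i) = w (some i) := fun i hi => hx1 _ (by simpa using hi)
  have hxO : ∀ i, ¬ SpT C (E i) → (∃ q, E i q ≠ 0 ∧ C q = 0 ∧ x (some i) = Pi.single q 1) ∨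
      ∃ l : Fin N, E i (pos l.castSucc) ≠ E i (pos l.succ) ∧ x (some i) = g l :=
    fun i hi => hx2 (some i) (by simpa using hi)
  let val : {q : Fin (n + 1) // q ∉ P} ⊕ Fin N → Fin (n + 1) → ZMod 2 :=
    Sum.elim (fun q => Pi.single q.1 1) g
  have hφ : ∀ i, ∃ y, x (some i) = val y ∧
      ∀ a b, (SpIn (E i) a b ∨ SpIn (E i + C) a b) → SpGood P hP y a b := by
    intro i
    by_cases hT : SpT C (E i)
    · obtain ⟨q, hq, hwq⟩ := hwT i hT
      have hqP : q ∉ P := by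
        rw [hPmem]; push Not; exact fun _ => ⟨i, hT, hwq⟩
      refine ⟨Sum.inl ⟨q, hqP⟩, (hxT i hT).trans hwq, fun a b h => ?_⟩
      have h' : SpIn (E i) a b := h.elim id (hT a b)
      exact h' q hq
    · have hO := (hTO i).resolve_left hT
      rcases hxO i hT with ⟨q, hq, hCq, hxq⟩ | ⟨l, hl, hxl⟩
      · have hqP : q ∉ P := by
          rw [hPmem]; exact fun h => h.1 hCq
        refine ⟨Sum.inl ⟨q, hqP⟩, hxq, fun a b h => ?_⟩
        rcases h with h | h
        · exact h q hq
        · exact h q (by simpa [hCq] using hq)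
      · refine ⟨Sum.inr l, hxl, fun a b h => ?_⟩
        have hCpos : ∀ k, C (pos k) ≠ 0 := fun k => ((hPmem _).1 (hposmem k)).1
        have hmono : ∀ k k', k ≤ k' → (pos k : ℕ) ≤ pos k' := fun k k' hk => pos.monotone hk
        have hz : ∀ z1 z2 c1 c2 : ZMod 2, z1 ≠ z2 → c1 ≠ 0 → c2 ≠ 0 →
            (z1 ≠ 0 ∨ z2 ≠ 0) ∧ (z1 + c1 ≠ 0 ∨ z2 + c2 ≠ 0) := by decide
        have hz' := hz _ _ _ _ hl (hCpos l.castSucc) (hCpos l.succ)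
        have hls : (pos l.castSucc : ℕ) ≤ pos l.succ := hmono _ _ l.castSucc_lt_succ.le
        rcases h with h | h
        · left
          intro k hk
          change a ≤ (pos k : ℕ) ∧ (pos k : ℕ) ≤ b
          refine ⟨hO.1 a b h _ (hCpos k), ?_⟩
          have := hmono _ _ hk
          rcases hz'.1 with h1 | h1
          · have := (h _ h1).2; omega
          · have := (h _ h1).2; omega
        · right
          intro k hk
          change a ≤ (pos k : ℕ) ∧ (pos k : ℕ) ≤ b
          refine ⟨?_, hO.2 a b h _ (hCpos k)⟩
          have := hmono l.succ k (by simpa [Fin.le_def, Fin.lt_def] using hk)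
          rcases hz'.2 with h1 | h1
          · have := (h (pos l.castSucc) h1).1; omega
          · have := (h (pos l.succ) h1).1; omega
  choose φ hφ1 hφ2 using hφ
  refine ⟨N, P, hP, φ, ?_, hφ2⟩
  intro i i' hii
  have : x (some i) = x (some i') := by rw [hφ1, hφ1, hii]
  exact Option.some_injective _ (hx.injective this)

lemma sp_core1 {n : ℕ} (hn : 1 ≤ n) (E : Fin n → Fin (n + 1) → ZMod 2) (C : Fin (n + 1) → ZMod 2)
    (hLI : LinearIndependent (ZMod 2) (fun o : Option (Fin n) => o.elim C E))
    (hTO : ∀ i, SpT C (E i) ∨ SpO C (E i)) :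
    ∃ (N : ℕ) (_ : 1 ≤ N) (P : Finset (Fin (n + 1))) (hP : P.card = N + 1)
      (φ : Fin n → {q : Fin (n + 1) // q ∉ P} ⊕ Fin N), Function.Injective φ ∧
      ∀ i a b, (SpIn (E i) a b ∨ SpIn (E i + C) a b) → SpGood P hP (φ i) a b := by
  classical
  obtain ⟨N, P, hP, φ, hinj, hgood⟩ := sp_core0 E C hLI hTO
  rcases Nat.eq_zero_or_pos N with rfl | hN
  swap
  · exact ⟨N, hN, P, hP, φ, hinj, hgood⟩
  have hf : ∀ i, ∃ q : {q : Fin (n + 1) // q ∉ P}, φ i = Sum.inl q := by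
    intro i
    rcases h : φ i with q | j
    · exact ⟨q, rfl⟩
    · exact j.elim0
  choose f hf using hf
  have hfinj : ∀ i i', (f i).1 = (f i').1 → i = i' := fun i i' h =>
    hinj (by rw [hf, hf, Subtype.ext h])
  have hfgood : ∀ i a b, (SpIn (E i) a b ∨ SpIn (E i + C) a b) →
      a ≤ ((f i).1 : ℕ) ∧ ((f i).1 : ℕ) ≤ b := by
    intro i a b h
    have := hgood i a b h
    rw [hf] at this
    exact this
  let i0 : Fin n := ⟨0, hn⟩
  have hP' : (insert (f i0).1 P).card = 1 + 1 := by
    rw [Finset.card_insert_of_notMem (f i0).2, hP]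
  refine ⟨1, le_rfl, insert (f i0).1 P, hP', fun i => if h : i = i0 then Sum.inr 0 else
    Sum.inl ⟨(f i).1, by
      rw [Finset.mem_insert, not_or]
      exact ⟨fun h' => h (hfinj _ _ h'), (f i).2⟩⟩, ?_, ?_⟩
  · intro i i' h
    dsimp only at h
    split_ifs at h with h1 h2 h2
    · rw [h1, h2]
    · simp only [Sum.inl.injEq, Subtype.mk.injEq] at h
      exact hfinj _ _ h
  · intro i a b h
    have hg := hfgood i a b h
    dsimp only
    split_ifs with h1
    · subst h1
      have hmem : (f i0).1 ∈ Set.range ((insert (f i0).1 P).orderEmbOfFin hP') := by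
        rw [Finset.range_orderEmbOfFin]; simp
      obtain ⟨l, hl⟩ := hmem
      by_cases hl0 : l = 0
      · left
        intro k hk
        have : k = l := by
          rw [hl0]; apply Fin.ext; simpa [Fin.le_def] using hk
        rw [this, hl]; exact hg
      · right
        intro k hk
        have : k = l := by
          apply Fin.ext
          have h3 : (l : ℕ) ≠ 0 := fun h => hl0 (Fin.ext h)
          have h4 := k.isLt
          have h5 := l.isLt
          simp only [Fin.lt_def, Fin.val_castSucc] at hk
          have : ((0 : Fin 1) : ℕ) = 0 := rfl
          omega
        rw [this, hl]; exact hg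
    · exact hg

lemma sp_injective_of_recovers {n m : ℕ} (A : Fin m → Finset (Fin n))
    (h : ∀ i, ∃ a b, LinRecovers A a b i) : IsLinStore A := by
  have key : ∀ (x : Fin n → ZMod 2) i, ∃ D : Finset (Fin m), ∀ x : Fin n → ZMod 2,
      x i = ∑ j ∈ D, linMap A x j := by
    intro _ i
    obtain ⟨a, b, D, _, hD⟩ := h i
    refine ⟨D, fun x => ?_⟩
    have h1 : ∀ j, linMap A x j = ∑ i', (if i' ∈ A j then (1 : ZMod 2) else 0) * x i' := by
      intro j
      simp [linMap, Finset.sum_ite_mem]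
    simp only [h1]
    rw [Finset.sum_comm]
    simp only [← Finset.sum_mul, hD]
    simp
  intro x y hxy
  ext i
  obtain ⟨D, hD⟩ := key x i
  rw [hD x, hD y, hxy]

open Classical in
noncomputable def spStore {n N : ℕ} (P : Finset (Fin (n + 1))) (hP : P.card = N + 1)
    (φ : Fin n → {q : Fin (n + 1) // q ∉ P} ⊕ Fin N) (q : Fin (n + 1)) : Finset (Fin n) :=
  Finset.univ.filter fun i => Sum.elim (fun q' => q'.1 = q)
    (fun l => q = P.orderEmbOfFin hP l.castSucc ∨ q = P.orderEmbOfFin hP l.succ) (φ i)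

lemma sp_store_recovers {n N : ℕ} (P : Finset (Fin (n + 1))) (hP : P.card = N + 1)
    (φ : Fin n → {q : Fin (n + 1) // q ∉ P} ⊕ Fin N) (hφ : Function.Injective φ)
    (i : Fin n) (a b : ℕ) (h : SpGood P hP (φ i) a b) : LinRecovers (spStore P hP φ) a b i := by
  classical
  rcases hi : φ i with q | j
  · rw [hi] at h
    refine ⟨{q.1}, fun j hj => by rw [Finset.mem_singleton.1 hj]; exact h, fun i' => ?_⟩
    rw [Finset.sum_singleton]
    refine if_congr ?_ rfl rfl
    simp only [spStore, Finset.mem_filter, Finset.mem_univ, true_and]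
    constructor
    · intro h'
      rcases hi' : φ i' with q' | j'
      · rw [hi'] at h'
        apply hφ
        rw [hi, hi']
        exact congrArg _ (Subtype.ext h')
      · rw [hi'] at h'
        exfalso
        rcases h' with h' | h'
        · exact q.2 (h' ▸ Finset.orderEmbOfFin_mem P hP _)
        · exact q.2 (h' ▸ Finset.orderEmbOfFin_mem P hP _)
    · rintro rfl
      rw [hi]; rfl
  · rw [hi] at h
    have main : ∀ s : Finset (Fin (N + 1)), (∀ l : Fin N,
        ((if l.castSucc ∈ s then (1 : ZMod 2) else 0) + if l.succ ∈ s then 1 else 0)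
          = if l = j then 1 else 0) → ∀ i' : Fin n,
        (∑ k ∈ s.map (P.orderEmbOfFin hP).toEmbedding,
          if i' ∈ spStore P hP φ k then (1 : ZMod 2) else 0) = if i' = i then 1 else 0 := by
      intro s hs i'
      rw [Finset.sum_map]
      rcases hi' : φ i' with q' | l
      · have hne : i' ≠ i := by
          rintro rfl; rw [hi] at hi'; cases hi'
        rw [if_neg hne]
        refine Finset.sum_eq_zero fun k _ => if_neg ?_
        simp only [spStore, Finset.mem_filter, Finset.mem_univ, true_and, hi', Sum.elim_inl]
        intro h'
        exact q'.2 (h' ▸ Finset.orderEmbOfFin_mem P hP _)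
      · have h1 : (i' = i) ↔ l = j := by
          rw [← hφ.eq_iff, hi, hi', Sum.inr.injEq]
        rw [if_congr h1 rfl rfl, ← hs l, ← Finset.sum_ite_eq' s l.castSucc (fun _ => (1 : ZMod 2)),
          ← Finset.sum_ite_eq' s l.succ (fun _ => (1 : ZMod 2)), ← Finset.sum_add_distrib]
        refine Finset.sum_congr rfl fun k _ => ?_
        simp only [spStore, Finset.mem_filter, Finset.mem_univ, true_and, hi', Sum.elim_inr,
          RelEmbedding.coe_toEmbedding, EmbeddingLike.apply_eq_iff_eq]
        by_cases hk1 : k = l.castSucc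
        · have : k ≠ l.succ := by rw [hk1]; exact l.castSucc_lt_succ.ne
          simp [hk1, l.castSucc_lt_succ.ne]
        · simp [hk1]
    rcases h with h | h
    · refine ⟨(Finset.univ.filter fun l => l ≤ j.castSucc).map (P.orderEmbOfFin hP).toEmbedding,
        ?_, main _ ?_⟩
      · intro k hk
        simp only [Finset.mem_map, Finset.mem_filter, Finset.mem_univ, true_and] at hk
        obtain ⟨l, hl, rfl⟩ := hk
        exact h l hl
      · intro l
        simp only [Finset.mem_filter, Finset.mem_univ, true_and, Fin.le_def, Fin.val_castSucc,
          Fin.val_succ, Fin.ext_iff]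
        rcases lt_trichotomy (l : ℕ) j with h1 | h1 | h1
        · rw [if_pos (by omega), if_pos (by omega), if_neg (by omega)]; decide
        · rw [if_pos (by omega), if_neg (by omega), if_pos (by omega)]; decide
        · rw [if_neg (by omega), if_neg (by omega), if_neg (by omega)]; decide
    · refine ⟨(Finset.univ.filter fun l => j.castSucc < l).map (P.orderEmbOfFin hP).toEmbedding,
        ?_, main _ ?_⟩
      · intro k hk
        simp only [Finset.mem_map, Finset.mem_filter, Finset.mem_univ, true_and] at hk
        obtain ⟨l, hl, rfl⟩ := hk
        exact h l hl
      · intro l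
        simp only [Finset.mem_filter, Finset.mem_univ, true_and, Fin.lt_def, Fin.val_castSucc,
          Fin.val_succ, Fin.ext_iff]
        rcases lt_trichotomy (l : ℕ) j with h1 | h1 | h1
        · rw [if_neg (by omega), if_neg (by omega), if_neg (by omega)]; decide
        · rw [if_neg (by omega), if_pos (by omega), if_pos (by omega)]; decide
        · rw [if_pos (by omega), if_pos (by omega), if_neg (by omega)]; decide

lemma sp_store_special {n N : ℕ} (hN : 1 ≤ N) (P : Finset (Fin (n + 1))) (hP : P.card = N + 1)
    (φ : Fin n → {q : Fin (n + 1) // q ∉ P} ⊕ Fin N) (hφ : Function.Injective φ) :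
    SpecialForm (spStore P hP φ) := by
  classical
  have hNn : N ≤ n := by
    have := Finset.card_le_univ P
    rw [hP, Fintype.card_fin] at this
    omega
  have hbij : Function.Bijective φ := by
    rw [Fintype.bijective_iff_injective_and_card]
    refine ⟨hφ, ?_⟩
    rw [Fintype.card_sum, Fintype.card_fin, Fintype.card_fin, Fintype.card_subtype_compl]
    simp only [Fintype.card_fin, Fintype.card_coe, hP]
    omega
  let e := Equiv.ofBijective φ hbij
  have he : ∀ x, φ (e.symm x) = x := fun x => e.apply_symm_apply x
  have he' : ∀ i x, i = e.symm x ↔ φ i = x := fun i x => by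
    rw [Equiv.eq_symm_apply]; rfl
  have hrange : ∀ j, j ∉ Set.range (P.orderEmbOfFin hP) ↔ j ∉ P := by
    intro j; rw [Finset.range_orderEmbOfFin]; simp
  have hb : ∀ a, a ∉ Set.range (fun l => e.symm (Sum.inr l)) ↔ ∃ q, φ a = Sum.inl q := by
    intro a
    rcases h : φ a with q | l
    · simp only [Sum.inl.injEq, exists_eq', iff_true]
      rintro ⟨l, rfl⟩
      rw [he] at h; cases h
    · simp only [reduceCtorEq, exists_false, iff_false, not_not]
      exact ⟨l, ((he' _ _).2 h).symm⟩
  have hA : ∀ j (hj : j ∉ P), spStore P hP φ j = {e.symm (Sum.inl ⟨j, hj⟩)} := by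
    intro j hj
    ext i
    rw [Finset.mem_singleton, he']
    simp only [spStore, Finset.mem_filter, Finset.mem_univ, true_and]
    rcases h : φ i with q | l
    · simp [Subtype.ext_iff]
    · simp only [Sum.elim_inr, reduceCtorEq, iff_false]
      rintro (h | h)
      · exact hj (h ▸ Finset.orderEmbOfFin_mem P hP _)
      · exact hj (h ▸ Finset.orderEmbOfFin_mem P hP _)
  have hApos : ∀ k i, i ∈ spStore P hP φ (P.orderEmbOfFin hP k) ↔
      ∃ l : Fin N, φ i = Sum.inr l ∧ ((k : ℕ) = l ∨ (k : ℕ) = l + 1) := by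
    intro k i
    simp only [spStore, Finset.mem_filter, Finset.mem_univ, true_and]
    rcases h : φ i with q | l
    · simp only [Sum.elim_inl, reduceCtorEq, false_and, exists_false, iff_false]
      intro h'
      exact q.2 (h' ▸ Finset.orderEmbOfFin_mem P hP _)
    · simp only [Sum.elim_inr, EmbeddingLike.apply_eq_iff_eq, Sum.inr.injEq, exists_eq_left', Fin.ext_iff (n := N + 1), Fin.val_castSucc, Fin.val_succ]
  refine ⟨N, hN, hNn, fun l => e.symm (Sum.inr l), P.orderEmbOfFin hP, ?_, ?_, ?_, ?_, ?_, ?_⟩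
  · exact e.symm.injective.comp Sum.inr_injective
  · exact (P.orderEmbOfFin hP).strictMono
  · intro k
    have hk := k.isLt
    ext i
    rw [hApos]
    split_ifs with h0 h1
    · rw [Finset.mem_singleton, he']
      constructor
      · rintro ⟨l, hl, h⟩
        rw [hl]; congr 1; apply Fin.ext; dsimp only; omega
      · intro h; exact ⟨_, h, by dsimp only; omega⟩
    · rw [Finset.mem_singleton, he']
      constructor
      · rintro ⟨l, hl, h⟩
        have := l.isLt
        rw [hl]; congr 1; apply Fin.ext; dsimp only; omega
      · intro h; exact ⟨_, h, by dsimp only; omega⟩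
    · rw [Finset.mem_insert, Finset.mem_singleton, he', he']
      constructor
      · rintro ⟨l, hl, h⟩
        have := l.isLt
        rw [hl]
        rcases h with h | h
        · right; congr 1; apply Fin.ext; dsimp only; omega
        · left; congr 1; apply Fin.ext; dsimp only; omega
      · rintro (h | h)
        · exact ⟨_, h, by dsimp only; omega⟩
        · exact ⟨_, h, by dsimp only; omega⟩
  · intro j hj
    rw [hrange] at hj
    exact ⟨_, (hb _).2 ⟨_, he _⟩, hA j hj⟩
  · intro a ha
    obtain ⟨q, hq⟩ := (hb a).1 ha
    refine ⟨q.1, (hrange _).2 q.2, ?_⟩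
    rw [hA q.1 q.2, (he' a _).2 hq]
  · intro j j' hj hj' hne h
    rw [hrange] at hj hj'
    rw [hA j hj, hA j' hj', Finset.singleton_inj, e.symm.injective.eq_iff, Sum.inl.injEq,
      Subtype.mk.injEq] at h
    exact hne h

lemma sp_dominate {n : ℕ} (hn : 1 ≤ n) (A : Fin (n + 1) → Finset (Fin n)) (hA : IsLinStore A) :
    ∃ A' : Fin (n + 1) → Finset (Fin n), IsLinStore A' ∧ SpecialForm A' ∧
      ∀ a b i, LinRecovers A a b i → LinRecovers A' a b i := by
  classical
  -- the transpose map
  let L : (Fin (n + 1) → ZMod 2) →ₗ[ZMod 2] (Fin n → ZMod 2) :=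
    { toFun := fun v i => ∑ j, v j * (if i ∈ A j then (1 : ZMod 2) else 0)
      map_add' := by
        intro v w; ext i; simp only [Pi.add_apply, add_mul, Finset.sum_add_distrib]
      map_smul' := by
        intro c v; ext i
        simp only [Pi.smul_apply, smul_eq_mul, mul_assoc, Finset.mul_sum, RingHom.id_apply] }
  let M : (Fin n → ZMod 2) →ₗ[ZMod 2] (Fin (n + 1) → ZMod 2) :=
    { toFun := linMap A
      map_add' := by
        intro v w; ext j; simp only [linMap, Pi.add_apply, Finset.sum_add_distrib]
      map_smul' := by
        intro c v; ext j
        simp only [linMap, Pi.smul_apply, smul_eq_mul, Finset.mul_sum, RingHom.id_apply] }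
  have hMinj : LinearMap.ker M = ⊥ := LinearMap.ker_eq_bot.2 hA
  obtain ⟨g, hg⟩ := M.exists_leftInverse_of_injective hMinj
  have hM1 : ∀ i' j, M (Pi.single i' 1) j = if i' ∈ A j then (1 : ZMod 2) else 0 := by
    intro i' j
    change ∑ i ∈ A j, (Pi.single i' 1 : Fin n → ZMod 2) i = _
    simp [Pi.single_apply]
  have hD : ∀ i, ∃ v, L v = Pi.single i 1 := by
    intro i
    refine ⟨fun j => g (Pi.single j 1) i, ?_⟩
    ext i'
    change ∑ j, g (Pi.single j 1) i * (if i' ∈ A j then (1 : ZMod 2) else 0) = _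
    have h1 : g (M (Pi.single i' 1)) = Pi.single i' 1 := LinearMap.congr_fun hg _
    have h2 : M (Pi.single i' 1) = ∑ j, (if i' ∈ A j then (1 : ZMod 2) else 0) •
        (Pi.single j 1 : Fin (n + 1) → ZMod 2) := by
      ext j
      rw [hM1, Finset.sum_apply]
      simp only [Pi.smul_apply, Pi.single_apply, smul_eq_mul, mul_ite, mul_one, mul_zero]
      simp
    rw [h2, map_sum] at h1
    have h3 := congrFun h1 i
    rw [Finset.sum_apply] at h3
    simp only [map_smul, Pi.smul_apply, smul_eq_mul] at h3
    rw [show (Pi.single i 1 : Fin n → ZMod 2) i' = (Pi.single i' 1 : Fin n → ZMod 2) i by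
      simp [Pi.single_apply, eq_comm], ← h3]
    exact Finset.sum_congr rfl fun j _ => mul_comm _ _
  obtain ⟨C, hC, hC0⟩ : ∃ C, L C = 0 ∧ C ≠ 0 := by
    have : LinearMap.ker L ≠ ⊥ := LinearMap.ker_ne_bot_of_finrank_lt (by simp)
    obtain ⟨C, hC, h0⟩ := Submodule.exists_mem_ne_zero_of_ne_bot this
    exact ⟨C, hC, h0⟩
  have hE : ∀ i, ∃ v, L v = Pi.single i 1 ∧ (SpT C v ∨ SpO C v) := by
    intro i
    obtain ⟨v, hv⟩ := hD i
    have hne : ∀ v, L v = Pi.single i 1 → v ≠ 0 := by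
      rintro v hv rfl
      rw [map_zero] at hv
      have := congrFun hv i
      simp at this
    have hv2 : L (v + C) = Pi.single i 1 := by rw [map_add, hC, add_zero, hv]
    rcases sp_class C v (hne _ hv) (hne _ hv2) with h | h
    · exact ⟨v, hv, h⟩
    · exact ⟨v + C, hv2, h⟩
  choose E hE1 hE2 using hE
  have hLI : LinearIndependent (ZMod 2) (fun o : Option (Fin n) => o.elim C E) := by
    rw [Fintype.linearIndependent_iff]
    intro c hc
    rw [Fintype.sum_option] at hc
    simp only [Option.elim_none, Option.elim_some] at hc
    have h1 := congrArg L hc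
    rw [map_add, map_smul, hC, smul_zero, zero_add, map_sum, map_zero] at h1
    have h2 : ∀ i, c (some i) = 0 := by
      intro i
      have := congrFun h1 i
      simpa [hE1, Finset.sum_apply, Pi.single_apply] using this
    simp only [h2, zero_smul, Finset.sum_const_zero, add_zero] at hc
    rintro (_ | i)
    · exact (smul_eq_zero.1 hc).resolve_right hC0
    · exact h2 i
  have huniq : ∀ i v, L v = Pi.single i 1 → v = E i ∨ v = E i + C := by
    intro i v hv
    have hspan : v - E i ∈ Submodule.span (ZMod 2)
        (Set.range fun o : Option (Fin n) => o.elim C E) := by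
      rw [hLI.span_eq_top_of_card_eq_finrank (by simp)]
      trivial
    rw [Submodule.mem_span_range_iff_exists_fun] at hspan
    obtain ⟨c, hc⟩ := hspan
    rw [Fintype.sum_option] at hc
    simp only [Option.elim_none, Option.elim_some] at hc
    have h1 := congrArg L hc
    rw [map_add, map_smul, hC, smul_zero, zero_add, map_sum, map_sub, hv, hE1, sub_self] at h1
    have h2 : ∀ i, c (some i) = 0 := by
      intro i
      have := congrFun h1 i
      simpa [hE1, Finset.sum_apply, Pi.single_apply] using this
    simp only [h2, zero_smul, Finset.sum_const_zero, add_zero] at hc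
    have hz : ∀ z : ZMod 2, z = 0 ∨ z = 1 := by decide
    rcases hz (c none) with h | h
    · left
      rw [h, zero_smul] at hc
      exact sub_eq_zero.1 hc.symm
    · right
      rw [h, one_smul] at hc
      rw [hc]; abel
  obtain ⟨N, hN, P, hP, φ, hφ, hgood⟩ := sp_core1 hn E C hLI hE2
  have hrec : ∀ a b i, LinRecovers A a b i → LinRecovers (spStore P hP φ) a b i := by
    rintro a b i ⟨D, hDab, hDi⟩
    refine sp_store_recovers P hP φ hφ i a b (hgood i a b ?_)
    let v : Fin (n + 1) → ZMod 2 := fun j => if j ∈ D then 1 else 0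
    have hv : L v = Pi.single i 1 := by
      ext i'
      change ∑ j, (if j ∈ D then (1 : ZMod 2) else 0) * (if i' ∈ A j then (1 : ZMod 2) else 0) = _
      rw [Pi.single_apply, ← hDi i']
      simp only [ite_mul, one_mul, zero_mul]
      rw [Finset.sum_ite_mem, Finset.univ_inter]
    have hin : SpIn v a b := by
      intro j hj
      apply hDab
      by_contra h
      exact hj (if_neg h)
    rcases huniq i v hv with h | h
    · left; rw [← h]; exact hin
    · right; rw [← h]; exact hin
  refine ⟨spStore P hP φ, sp_injective_of_recovers _ fun i => ⟨0, n, ?_⟩,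
    sp_store_special hN P hP φ hφ, hrec⟩
  refine sp_store_recovers P hP φ hφ i 0 n (hgood i 0 n (Or.inl ?_))
  intro j _
  have := j.isLt
  omega

/-- For every finite simple graph `G` on `n ≥ 1` vertices and every `t ≥ 1`,
the optimum `S^c_t(G,n+1)` over linearly coded stores with one redundant chunk is attained by
a store of the special interleaved form of Theorem 5.4. -/
theorem statement_8 {n : ℕ} (hn : 1 ≤ n) (G : SimpleGraph (Fin n)) (t : ℕ) (ht : 1 ≤ t) :
    ∃ A : Fin (n + 1) → Finset (Fin n), IsLinStore A ∧ SpecialForm A ∧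
      ∀ (u v : Fin n) (p : G.Walk u v), p.IsPath → p.length + 1 ≤ t →
        ∃ a b : ℕ, a ≤ b ∧ b < n + 1 ∧ (∀ i ∈ p.support, LinRecovers A a b i) ∧
          ((b - a + 1 : ℕ) : ℝ) ≤ linStretch G t (n + 1) * ((p.length : ℝ) + 1) := by
  classical
  let Q : ℝ → (Fin (n + 1) → Finset (Fin n)) → Prop := fun r A =>
    ∀ (u v : Fin n) (p : G.Walk u v), p.IsPath → p.length + 1 ≤ t →
      ∃ a b : ℕ, a ≤ b ∧ b < n + 1 ∧ (∀ i ∈ p.support, LinRecovers A a b i) ∧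
        ((b - a + 1 : ℕ) : ℝ) ≤ r * ((p.length : ℝ) + 1)
  have hdef : linStretch G t (n + 1) = sInf {r : ℝ | ∃ A, IsLinStore A ∧ Q r A} := rfl
  have hne : {r : ℝ | ∃ A, IsLinStore A ∧ Q r A}.Nonempty := by
    let A0 : Fin (n + 1) → Finset (Fin n) := fun j => Finset.univ.filter fun i => i.castSucc = j
    have hrec : ∀ i, LinRecovers A0 0 n i := by
      intro i
      refine ⟨{i.castSucc}, ?_, ?_⟩
      · simp [i.isLt.le]
      · intro i'
        rw [Finset.sum_singleton]
        refine if_congr ?_ rfl rfl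
        simp [A0]
    refine ⟨(n : ℝ) + 1, A0, sp_injective_of_recovers _ fun i => ⟨0, n, hrec i⟩, ?_⟩
    intro u v p _ _
    refine ⟨0, n, by omega, by omega, fun i _ => hrec i, ?_⟩
    push_cast
    have : (0 : ℝ) ≤ p.length := by positivity
    have : (0 : ℝ) ≤ n := by positivity
    simp only [Nat.sub_zero]
    nlinarith
  have hseq : ∀ k : ℕ, ∃ A, (IsLinStore A ∧ SpecialForm A) ∧
      Q (linStretch G t (n + 1) + 1 / ((k : ℝ) + 1)) A := by
    intro k
    have hpos : (0 : ℝ) < 1 / ((k : ℝ) + 1) := by positivity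
    obtain ⟨r, ⟨A, hA, hQ⟩, hr⟩ := Real.lt_sInf_add_pos hne hpos
    obtain ⟨A', hA', hS, hdom⟩ := sp_dominate hn A hA
    refine ⟨A', ⟨hA', hS⟩, ?_⟩
    intro u v p hp hpt
    obtain ⟨a, b, hab, hb, hrec, hle⟩ := hQ u v p hp hpt
    refine ⟨a, b, hab, hb, fun i hi => hdom a b i (hrec i hi), hle.trans ?_⟩
    rw [hdef]
    exact mul_le_mul_of_nonneg_right hr.le (by positivity)
  choose F hF1 hF2 using hseq
  obtain ⟨A, hAinf⟩ := Finite.exists_infinite_fiber F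
  rw [Set.infinite_coe_iff] at hAinf
  obtain ⟨k0, hk0⟩ := hAinf.nonempty
  have hk0' : F k0 = A := hk0
  refine ⟨A, hk0' ▸ (hF1 k0).1, hk0' ▸ (hF1 k0).2, ?_⟩
  intro u v p hp hpt
  -- minimal length
  let R : ℕ → Prop := fun L => ∃ a b : ℕ, a ≤ b ∧ b < n + 1 ∧
    (∀ i ∈ p.support, LinRecovers A a b i) ∧ b - a + 1 = L
  have hR : ∃ L, R L := by
    obtain ⟨a, b, h1, h2, h3, _⟩ := hF2 k0 u v p hp hpt
    exact ⟨_, a, b, h1, h2, hk0' ▸ h3, rfl⟩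
  obtain ⟨a, b, h1, h2, h3, h4⟩ := Nat.find_spec hR
  refine ⟨a, b, h1, h2, h3, ?_⟩
  rw [h4]
  by_contra hcon
  push Not at hcon
  set s := linStretch G t (n + 1)
  have hl : (0 : ℝ) < (p.length : ℝ) + 1 := by positivity
  have hgap : 0 < (Nat.find hR : ℝ) / ((p.length : ℝ) + 1) - s := by
    rw [sub_pos, lt_div_iff₀ hl]; exact hcon
  obtain ⟨K, hK⟩ := exists_nat_one_div_lt hgap
  obtain ⟨k, hk, hkK⟩ := hAinf.exists_gt K
  have hk' : F k = A := hk
  obtain ⟨a', b', h1', h2', h3', h5⟩ := hF2 k u v p hp hpt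
  rw [hk'] at h3'
  have hmin : Nat.find hR ≤ b' - a' + 1 := Nat.find_min' hR ⟨a', b', h1', h2', h3', rfl⟩
  have hmin' : (Nat.find hR : ℝ) ≤ ((b' - a' + 1 : ℕ) : ℝ) := by exact_mod_cast hmin
  have hle := hmin'.trans h5
  rw [← div_le_iff₀ hl] at hle
  have : (1 : ℝ) / ((k : ℝ) + 1) ≤ 1 / ((K : ℝ) + 1) := by
    apply one_div_le_one_div_of_le (by positivity)
    have : (K : ℝ) < k := by exact_mod_cast hkK
    linarith
  linarith
end

section
/- Work over 𝔽_2 with 1 ≤ n < m and a matrix H ∈ 𝔽_2^{(m−n)×m}. Let h ∈ 𝔽_2^m with h ∉ span{H} and Min(h) ≤ Max(h). Then: (i) T_h is an 𝔽_2-linear subspace of 𝔽_2^m; (ii) e_{Min(h)} ∈ T_h and h + e_{Min(h)} ∈ T_h; and (iii) if additionally h + e_{Min(h)} ∉ span{H}, then Min(h + e_{Min(h)}) > Min(h). -/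
/-- Position of the first nonzero entry of `d ∈ 𝔽₂^m` (junk value `0` if `d = 0`). -/
noncomputable def minPos {m : ℕ} (d : Fin m → ZMod 2) : ℕ :=
  sInf { j : ℕ | ∃ hj : j < m, d ⟨j, hj⟩ ≠ 0 }

/-- Position of the last nonzero entry of `d ∈ 𝔽₂^m` (junk value `0` if `d = 0`). -/
noncomputable def maxPos {m : ℕ} (d : Fin m → ZMod 2) : ℕ :=
  sSup { j : ℕ | ∃ hj : j < m, d ⟨j, hj⟩ ≠ 0 }

/-- The interval `I(d) = [min(d), max(d)]` of positions, with `I(0) = ∅`. -/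
noncomputable def itv {m : ℕ} (d : Fin m → ZMod 2) : Set ℕ :=
  if d = 0 then ∅ else Set.Icc (minPos d) (maxPos d)

/-- The span of the rows of `H`. -/
def rowSpan {k m : ℕ} (H : Matrix (Fin k) (Fin m) (ZMod 2)) :
    Submodule (ZMod 2) (Fin m → ZMod 2) :=
  Submodule.span (ZMod 2) (Set.range H)

/-- `Min(h) := max_{d ∈ h + span H} min(d)`. -/
noncomputable def MinH {k m : ℕ} (H : Matrix (Fin k) (Fin m) (ZMod 2))
    (h : Fin m → ZMod 2) : ℕ :=
  sSup { j : ℕ | ∃ v ∈ rowSpan H, minPos (h + v) = j }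

/-- `Max(h) := min_{d ∈ h + span H} max(d)`. -/
noncomputable def MaxH {k m : ℕ} (H : Matrix (Fin k) (Fin m) (ZMod 2))
    (h : Fin m → ZMod 2) : ℕ :=
  sInf { j : ℕ | ∃ v ∈ rowSpan H, maxPos (h + v) = j }

/-- `(g,H) ≤ (h,H)`: for every `d_b ∈ h + span H` there is `d_a ∈ g + span H` with
`I(d_a) ⊆ I(d_b)`. -/
def covRel {k m : ℕ} (H : Matrix (Fin k) (Fin m) (ZMod 2)) (g h : Fin m → ZMod 2) : Prop :=
  ∀ v ∈ rowSpan H, ∃ w ∈ rowSpan H, itv (g + w) ⊆ itv (h + v)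

/-- `T_h := {g : (g,H) ≤ (h,H)}`. -/
def Th {k m : ℕ} (H : Matrix (Fin k) (Fin m) (ZMod 2)) (h : Fin m → ZMod 2) :
    Set (Fin m → ZMod 2) :=
  { g | covRel H g h }

/-- The standard basis vector of `𝔽₂^m` supported at (natural-number) position `j`. -/
def stdVec (m : ℕ) (j : ℕ) : Fin m → ZMod 2 :=
  fun i => if (i : ℕ) = j then 1 else 0

theorem aux_nonempty {m : ℕ} {d : Fin m → ZMod 2} (hd : d ≠ 0) :
    { j : ℕ | ∃ hj : j < m, d ⟨j, hj⟩ ≠ 0 }.Nonempty := by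
  obtain ⟨i, hi⟩ := Function.ne_iff.mp hd
  exact ⟨i, i.2, hi⟩

theorem aux_bdd {m : ℕ} (d : Fin m → ZMod 2) :
    BddAbove { j : ℕ | ∃ hj : j < m, d ⟨j, hj⟩ ≠ 0 } :=
  ⟨m, fun _ hj => hj.1.le⟩

theorem minPos_mem {m : ℕ} {d : Fin m → ZMod 2} (hd : d ≠ 0) :
    ∃ hj : minPos d < m, d ⟨minPos d, hj⟩ ≠ 0 :=
  Nat.sInf_mem (aux_nonempty hd)

theorem maxPos_mem {m : ℕ} {d : Fin m → ZMod 2} (hd : d ≠ 0) :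
    ∃ hj : maxPos d < m, d ⟨maxPos d, hj⟩ ≠ 0 :=
  Nat.sSup_mem (aux_nonempty hd) (aux_bdd d)

theorem minPos_le {m : ℕ} {d : Fin m → ZMod 2} {i : Fin m} (hi : d i ≠ 0) :
    minPos d ≤ i := Nat.sInf_le ⟨i.2, hi⟩

theorem le_maxPos {m : ℕ} {d : Fin m → ZMod 2} {i : Fin m} (hi : d i ≠ 0) :
    (i : ℕ) ≤ maxPos d := le_csSup (aux_bdd d) ⟨i.2, hi⟩

theorem itv_subset_iff {m : ℕ} (d : Fin m → ZMod 2) (a b : ℕ) :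
    itv d ⊆ Set.Icc a b ↔ ∀ i : Fin m, d i ≠ 0 → a ≤ i ∧ (i : ℕ) ≤ b := by
  by_cases hd : d = 0
  · simp [itv, hd]
  · rw [itv, if_neg hd]
    constructor
    · intro hs i hi
      exact hs ⟨minPos_le hi, le_maxPos hi⟩
    · intro hs
      obtain ⟨h1, h2⟩ := minPos_mem hd
      obtain ⟨h3, h4⟩ := maxPos_mem hd
      exact Set.Icc_subset_Icc (hs _ h2).1 (hs _ h4).2

theorem coset_ne_zero {k m : ℕ} {H : Matrix (Fin k) (Fin m) (ZMod 2)} {h : Fin m → ZMod 2}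
    (hh : h ∉ rowSpan H) {v : Fin m → ZMod 2} (hv : v ∈ rowSpan H) : h + v ≠ 0 := by
  intro h0
  exact hh (by rw [eq_neg_of_add_eq_zero_left h0]; exact neg_mem hv)

theorem mem_Th_iff {k m : ℕ} {H : Matrix (Fin k) (Fin m) (ZMod 2)} {h : Fin m → ZMod 2}
    (hh : h ∉ rowSpan H) (g : Fin m → ZMod 2) :
    g ∈ Th H h ↔ ∀ v ∈ rowSpan H, ∃ w ∈ rowSpan H, ∀ i : Fin m, (g + w) i ≠ 0 →
      minPos (h + v) ≤ i ∧ (i : ℕ) ≤ maxPos (h + v) := by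
  refine forall₂_congr fun v hv => exists_congr fun w => and_congr_right fun _ => ?_
  rw [← itv_subset_iff]
  conv_lhs => rw [show itv (h + v) = Set.Icc (minPos (h + v)) (maxPos (h + v)) from
    if_neg (coset_ne_zero hh hv)]

theorem minH_bdd {k m : ℕ} (H : Matrix (Fin k) (Fin m) (ZMod 2)) {h : Fin m → ZMod 2}
    (hh : h ∉ rowSpan H) : BddAbove { j : ℕ | ∃ v ∈ rowSpan H, minPos (h + v) = j } := by
  refine ⟨m, ?_⟩
  rintro _ ⟨v, hv, rfl⟩
  exact (minPos_mem (coset_ne_zero hh hv)).1.le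

/-- Lemma on the subspace `T_h`. Over `𝔽₂`, with `1 ≤ n < m`,
`H ∈ 𝔽₂^{(m−n)×m}`, `h ∉ span H` and `Min(h) ≤ Max(h)`:
(i) `T_h` is a linear subspace; (ii) `e_{Min(h)} ∈ T_h` and `h + e_{Min(h)} ∈ T_h`;
(iii) if moreover `h + e_{Min(h)} ∉ span H`, then `Min(h + e_{Min(h)}) > Min(h)`. -/
theorem statement_9 {n m : ℕ} (hn : 1 ≤ n) (hm : n < m)
    (H : Matrix (Fin (m - n)) (Fin m) (ZMod 2)) (h : Fin m → ZMod 2)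
    (hh : h ∉ rowSpan H) (hminmax : MinH H h ≤ MaxH H h) :
    (∃ S : Submodule (ZMod 2) (Fin m → ZMod 2), (S : Set (Fin m → ZMod 2)) = Th H h) ∧
    stdVec m (MinH H h) ∈ Th H h ∧
    h + stdVec m (MinH H h) ∈ Th H h ∧
    (h + stdVec m (MinH H h) ∉ rowSpan H →
      MinH H h < MinH H (h + stdVec m (MinH H h))) := by
  have hle : ∀ v ∈ rowSpan H, minPos (h + v) ≤ MinH H h := fun v hv =>
    le_csSup (minH_bdd H hh) ⟨v, hv, rfl⟩
  have hge : ∀ v ∈ rowSpan H, MinH H h ≤ maxPos (h + v) := fun v hv =>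
    hminmax.trans (Nat.sInf_le ⟨v, hv, rfl⟩)
  have hstd : ∀ i : Fin m, stdVec m (MinH H h) i ≠ 0 → (i : ℕ) = MinH H h := by
    intro i hi
    by_contra hne
    exact hi (if_neg hne)
  refine ⟨⟨{ carrier := Th H h, zero_mem' := ?_, add_mem' := ?_, smul_mem' := ?_ }, rfl⟩,
    ?_, ?_, ?_⟩
  · intro a b ha hb
    rw [mem_Th_iff hh] at ha hb ⊢
    intro v hv
    obtain ⟨w, hw, hw'⟩ := ha v hv
    obtain ⟨u, hu, hu'⟩ := hb v hv
    refine ⟨w + u, add_mem hw hu, fun i hi => ?_⟩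
    by_cases h1 : (a + w) i = 0
    · refine hu' i fun h2 => hi ?_
      rw [add_add_add_comm, Pi.add_apply, h1, h2, add_zero]
    · exact hw' i h1
  · rw [mem_Th_iff hh]
    intro v hv
    exact ⟨0, zero_mem _, fun i hi => absurd (by simp) hi⟩
  · intro c a ha
    rw [mem_Th_iff hh] at ha ⊢
    intro v hv
    obtain ⟨w, hw, hw'⟩ := ha v hv
    refine ⟨c • w, Submodule.smul_mem _ c hw, fun i hi => hw' i fun h1 => hi ?_⟩
    rw [← smul_add, Pi.smul_apply, h1, smul_zero]
  · rw [mem_Th_iff hh]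
    intro v hv
    refine ⟨0, zero_mem _, fun i hi => ?_⟩
    rw [add_zero] at hi
    rw [hstd i hi]
    exact ⟨hle v hv, hge v hv⟩
  · rw [mem_Th_iff hh]
    intro v hv
    refine ⟨v, hv, fun i hi => ?_⟩
    by_cases h1 : stdVec m (MinH H h) i = 0
    · have h2 : (h + v) i ≠ 0 := by
        intro h2
        apply hi
        rw [add_right_comm, Pi.add_apply, h1, h2, add_zero]
      exact ⟨minPos_le h2, le_maxPos h2⟩
    · rw [hstd i h1]
      exact ⟨hle v hv, hge v hv⟩
  · intro hne
    obtain ⟨v, hv, hvm⟩ : MinH H h ∈ { j : ℕ | ∃ v ∈ rowSpan H, minPos (h + v) = j } :=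
      Nat.sSup_mem ⟨_, 0, zero_mem _, rfl⟩ (minH_bdd H hh)
    refine lt_of_lt_of_le ?_ (le_csSup (minH_bdd H hne) ⟨v, hv, rfl⟩)
    obtain ⟨hj, hj'⟩ := minPos_mem (coset_ne_zero hne hv)
    generalize minPos (h + stdVec m (MinH H h) + v) = p at *
    rw [add_right_comm, Pi.add_apply] at hj'
    by_contra hlt
    rcases lt_or_eq_of_le (not_lt.mp hlt) with h1 | h1
    · apply hj'
      have h2 : (h + v) ⟨p, hj⟩ = 0 := by
        by_contra h3
        have := minPos_le h3
        simp only at this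
        omega
      have h4 : stdVec m (MinH H h) ⟨p, hj⟩ = 0 := if_neg h1.ne
      rw [h2, h4, add_zero]
    · obtain ⟨hk, hk'⟩ := minPos_mem (coset_ne_zero hh hv)
      have h2 : (h + v) ⟨p, hj⟩ ≠ 0 := by
        have : (⟨p, hj⟩ : Fin m) = ⟨minPos (h + v), hk⟩ := Fin.ext (h1.trans hvm.symm)
        rw [this]; exact hk'
      have h4 : stdVec m (MinH H h) ⟨p, hj⟩ = 1 := if_pos h1
      rw [h4] at hj'
      have key : ∀ x : ZMod 2, x + 1 ≠ 0 → x ≠ 0 → False := by decide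
      exact key _ hj' h2
end

section
/- For every finite simple graph G on n vertices and every t ≥ 1, the uncoded and linearly coded stretch metrics with one redundant chunk satisfy S^u_t(G,n+1) ≤ 2·S^c_t(G,n+1); i.e., the coding gain S^u_t(G,n+1)/S^c_t(G,n+1) is at most 2. -/
lemma fold_exists (N σ : ℕ) : ∃ τ : Equiv.Perm (Fin N), ∀ a b : ℕ, a ≤ b → b < N →
    ∃ a' b' : ℕ, a' ≤ b' ∧ b' < N ∧ b' - a' + 1 ≤ 2 * (b - a + 1) ∧
      ∀ j : Fin N, ((a ≤ (j : ℕ) ∧ (j : ℕ) ≤ b) ∨ ∃ w, a ≤ w ∧ w ≤ b ∧ w + (j : ℕ) = σ) →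
        a' ≤ (τ j : ℕ) ∧ (τ j : ℕ) ≤ b' := by
  classical
  let κ : Fin N → ℕ := fun j => (2 * (j : ℤ) - σ).natAbs
  have hmono : Monotone (κ ∘ Tuple.sort κ) := Tuple.monotone_sort κ
  refine ⟨(Tuple.sort κ).symm, ?_⟩
  intro a b hab hb
  set f := Tuple.sort κ with hf
  let S : Finset (Fin N) := Finset.univ.filter
    (fun p => ∃ w : ℕ, a ≤ w ∧ w ≤ b ∧ κ (f p) = (2 * (w : ℤ) - σ).natAbs)
  have hSne : S.Nonempty := by
    refine ⟨f.symm ⟨a, by omega⟩, ?_⟩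
    simp only [S, Finset.mem_filter, Finset.mem_univ, true_and]
    exact ⟨a, le_rfl, hab, by simp [κ]⟩
  have hcard : S.card ≤ 2 * (b - a + 1) := by
    have h1 : S.card ≤ (Finset.Icc a b ∪ (Finset.Icc a b).image (fun w => σ - w)).card := by
      apply Finset.card_le_card_of_injOn (fun p => ((f p : Fin N) : ℕ))
      · intro p hp
        simp only [S, Finset.coe_filter, Finset.mem_univ, true_and, Set.mem_ofPred_eq, κ] at hp
        obtain ⟨w, h1, h2, h3⟩ := hp
        simp only [Finset.coe_union, Finset.coe_image, Set.mem_union, Finset.coe_Icc,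
          Set.mem_Icc, Set.mem_image]
        by_cases h : ((f p : Fin N) : ℕ) = w
        · left; omega
        · right; exact ⟨w, ⟨h1, h2⟩, by omega⟩
      · intro p _ p' _ h
        exact f.injective (Fin.ext h)
    have h2 := Finset.card_union_le (Finset.Icc a b) ((Finset.Icc a b).image (fun w => σ - w))
    have h3 : ((Finset.Icc a b).image (fun w => σ - w)).card ≤ (Finset.Icc a b).card :=
      Finset.card_image_le
    simp only [Nat.card_Icc] at h2 h3
    omega
  have hmin := S.min'_mem hSne
  have hmax := S.max'_mem hSne
  have hle : S.min' hSne ≤ S.max' hSne := Finset.min'_le _ _ hmax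
  refine ⟨(S.min' hSne : ℕ), (S.max' hSne : ℕ), hle, (S.max' hSne).2, ?_, ?_⟩
  · have hsub : Finset.Icc (S.min' hSne) (S.max' hSne) ⊆ S := by
      intro p hp
      rw [Finset.mem_Icc] at hp
      have k1 : κ (f (S.min' hSne)) ≤ κ (f p) := hmono hp.1
      have k2 : κ (f p) ≤ κ (f (S.max' hSne)) := hmono hp.2
      simp only [S, Finset.mem_filter, Finset.mem_univ, true_and] at hmin hmax ⊢
      obtain ⟨w1, h1, h1', e1⟩ := hmin
      obtain ⟨w2, h2, h2', e2⟩ := hmax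
      rw [e1] at k1
      rw [e2] at k2
      simp only [κ] at k1 k2 ⊢
      by_cases h : a ≤ ((f p : Fin N) : ℕ) ∧ ((f p : Fin N) : ℕ) ≤ b
      · exact ⟨_, h.1, h.2, rfl⟩
      · refine ⟨σ - ((f p : Fin N) : ℕ), ?_, ?_, ?_⟩ <;> omega
    have := Finset.card_le_card hsub
    rw [Fin.card_Icc] at this
    have hle' : (S.min' hSne : ℕ) ≤ (S.max' hSne : ℕ) := hle
    omega
  · intro j hj
    have hm : f.symm j ∈ S := by
      simp only [S, Finset.mem_filter, Finset.mem_univ, true_and, Equiv.apply_symm_apply, κ]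
      rcases hj with hj | ⟨w, h1, h2, h3⟩
      · exact ⟨j, hj.1, hj.2, rfl⟩
      · exact ⟨w, h1, h2, by omega⟩
    exact ⟨Finset.min'_le _ _ hm, Finset.le_max' _ _ hm⟩

lemma zmod2_cases (x : ZMod 2) : x = 0 ∨ x = 1 := by
  revert x; decide

/-- Choice of a good representation among `d` and `d + c`. -/
lemma good_rep {N : ℕ} (c : Fin N → ZMod 2) (c1 c2 : Fin N) (h1 : c c1 = 1) (h2 : c c2 = 1)
    (hmin : ∀ j, c j ≠ 0 → c1 ≤ j) (hmax : ∀ j, c j ≠ 0 → j ≤ c2) (d : Fin N → ZMod 2) :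
    ∃ q, (q = d ∨ q = d + c) ∧ ∀ d', (d' = d ∨ d' = d + c) → ∀ a b : ℕ,
      (∀ j, d' j ≠ 0 → a ≤ (j : ℕ) ∧ (j : ℕ) ≤ b) → ∀ j, q j ≠ 0 →
        ((a ≤ (j : ℕ) ∧ (j : ℕ) ≤ b) ∨
          ∃ w, a ≤ w ∧ w ≤ b ∧ w + (j : ℕ) = (c1 : ℕ) + (c2 : ℕ)) := by
  classical
  have h11 : (1 : ZMod 2) + 1 = 0 := by decide
  have hcc : c + c = 0 := by
    funext j
    rcases zmod2_cases (c j) with h | h <;> simp [h, h11]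
  -- case 1
  have case1 : ∀ e : Fin N → ZMod 2, e c1 = 0 → e c2 = 0 → ∀ d', (d' = e ∨ d' = e + c) →
      ∀ a b : ℕ, (∀ j, d' j ≠ 0 → a ≤ (j : ℕ) ∧ (j : ℕ) ≤ b) → ∀ j, e j ≠ 0 →
        (a ≤ (j : ℕ) ∧ (j : ℕ) ≤ b) := by
    intro e he1 he2 d' hd' a b hab j hj
    rcases hd' with rfl | rfl
    · exact hab j hj
    · by_cases hc : c j = 0
      · exact hab j (by simpa [hc] using hj)
      · have p1 := hab c1 (by simp [he1, h1])
        have p2 := hab c2 (by simp [he2, h2])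
        have q1 : (c1 : ℕ) ≤ j := hmin j hc
        have q2 : (j : ℕ) ≤ c2 := hmax j hc
        omega
  -- case 2
  have case2 : ∀ e : Fin N → ZMod 2, e c1 = 1 → e c2 = 0 → ∃ q, (q = e ∨ q = e + c) ∧
      ∀ d', (d' = e ∨ d' = e + c) → ∀ a b : ℕ,
      (∀ j, d' j ≠ 0 → a ≤ (j : ℕ) ∧ (j : ℕ) ≤ b) → ∀ j, q j ≠ 0 →
        ((a ≤ (j : ℕ) ∧ (j : ℕ) ≤ b) ∨
          ∃ w, a ≤ w ∧ w ≤ b ∧ w + (j : ℕ) = (c1 : ℕ) + (c2 : ℕ)) := by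
    intro e he1 he2
    let Y : Finset (Fin N) := Finset.univ.filter (fun j => e j ≠ 0 ∧ c j ≠ 0)
    let X : Finset (Fin N) := Finset.univ.filter (fun j => (e + c) j ≠ 0 ∧ c j ≠ 0)
    have hY : Y.Nonempty := ⟨c1, by simp [Y, he1, h1]⟩
    have hX : X.Nonempty := ⟨c2, by simp [X, he2, h2]⟩
    obtain ⟨y, hyY, hy⟩ : ∃ y ∈ Y, ∀ j ∈ Y, j ≤ y :=
      ⟨Y.max' hY, Y.max'_mem hY, fun j hj => Y.le_max' j hj⟩
    obtain ⟨x, hxX, hx⟩ : ∃ x ∈ X, ∀ j ∈ X, x ≤ j :=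
      ⟨X.min' hX, X.min'_mem hX, fun j hj => X.min'_le j hj⟩
    simp only [Y, X, Finset.mem_filter, Finset.mem_univ, true_and] at hyY hy hxX hx
    have hy1 : (c1 : ℕ) ≤ y := hmin y hyY.2
    have hx2 : (x : ℕ) ≤ c2 := hmax x hxX.2
    rcases le_total ((y : ℕ) - c1) ((c2 : ℕ) - x) with hl | hl
    · refine ⟨e, Or.inl rfl, ?_⟩
      intro d' hd' a b hab j hj
      rcases hd' with rfl | rfl
      · exact Or.inl (hab j hj)
      · by_cases hc : c j = 0
        · exact Or.inl (hab j (by simpa [hc] using hj))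
        · right
          have p1 := hab x hxX.1
          have p2 := hab c2 (by simp [he2, h2])
          have q1 : (c1 : ℕ) ≤ j := hmin j hc
          have q2 : (j : ℕ) ≤ y := hy j ⟨hj, hc⟩
          exact ⟨(c1 : ℕ) + c2 - j, by omega, by omega, by omega⟩
    · refine ⟨e + c, Or.inr rfl, ?_⟩
      intro d' hd' a b hab j hj
      rcases hd' with rfl | rfl
      · by_cases hc : c j = 0
        · exact Or.inl (hab j (by simpa [hc] using hj))
        · right
          have p1 := hab y hyY.1
          have p2 := hab c1 (by simp [he1])
          have q1 : (j : ℕ) ≤ c2 := hmax j hc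
          have q2 : (x : ℕ) ≤ j := hx j ⟨hj, hc⟩
          exact ⟨(c1 : ℕ) + c2 - j, by omega, by omega, by omega⟩
      · exact Or.inl (hab j hj)
  have hdc : d + c + c = d := by rw [add_assoc, hcc, add_zero]
  rcases zmod2_cases (d c1) with k1 | k1 <;> rcases zmod2_cases (d c2) with k2 | k2
  · exact ⟨d, Or.inl rfl, fun d' hd' a b hab j hj => Or.inl (case1 d k1 k2 d' hd' a b hab j hj)⟩
  · obtain ⟨q, hq, H⟩ := case2 (d + c) (by simp [k1, h1]) (by simp [k2, h2, h11])
    rw [hdc] at hq H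
    exact ⟨q, hq.symm, fun d' hd' => H d' hd'.symm⟩
  · exact case2 d k1 k2
  · refine ⟨d + c, Or.inr rfl, fun d' hd' a b hab j hj =>
      Or.inl (case1 (d + c) (by simp [k1, h1, h11]) (by simp [k2, h2, h11]) d' ?_ a b hab j hj)⟩
    rw [hdc]; exact hd'.symm

/-- Hall matching from a right inverse. -/
lemma hall_match {n N : ℕ} (q : Matrix (Fin n) (Fin N) (ZMod 2))
    (M : Matrix (Fin N) (Fin n) (ZMod 2)) (h : q * M = 1) :
    ∃ π : Fin n → Fin N, Function.Injective π ∧ ∀ i, q i (π i) ≠ 0 := by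
  classical
  let T : Fin n → Finset (Fin N) := fun i => Finset.univ.filter (fun j => q i j ≠ 0)
  have hall : ∀ s : Finset (Fin n), s.card ≤ (s.biUnion T).card := by
    intro s
    let Q : Matrix s (s.biUnion T : Finset (Fin N)) (ZMod 2) := fun i j => q i j
    let R : Matrix (s.biUnion T : Finset (Fin N)) s (ZMod 2) := fun j i => M j i
    have hQR : Q * R = 1 := by
      ext i i'
      have h0 := congrFun (congrFun h i.1) i'.1
      rw [Matrix.mul_apply] at h0 ⊢
      have h1 : ∑ j, q i.1 j * M j i'.1 = ∑ j ∈ s.biUnion T, q i.1 j * M j i'.1 := by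
        symm
        apply Finset.sum_subset (Finset.subset_univ _)
        intro j _ hj
        have : q i.1 j = 0 := by
          by_contra hne
          exact hj (Finset.mem_biUnion.2 ⟨i.1, i.2, by simp [T, hne]⟩)
        simp [this]
      rw [h1, ← Finset.sum_coe_sort] at h0
      simp only [Q, R]
      rw [h0]
      rw [Matrix.one_apply, Matrix.one_apply]
      by_cases hii : i = i'
      · rw [if_pos hii, if_pos (congrArg Subtype.val hii)]
      · rw [if_neg hii, if_neg (fun h => hii (Subtype.ext h))]
    have h2 : (Q * R).rank ≤ Q.rank := Matrix.rank_mul_le_left Q R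
    have h3 := Matrix.rank_le_card_width Q
    rw [hQR, Matrix.rank_one] at h2
    have h4 := h2.trans h3
    rwa [Fintype.card_coe, Fintype.card_coe] at h4
  obtain ⟨π, h1, h2⟩ := (Finset.all_card_le_biUnion_card_iff_exists_injective T).1 hall
  exact ⟨π, h1, fun i => by simpa [T] using h2 i⟩

lemma core {n : ℕ} [Nonempty (Fin n)] (A : Fin (n + 1) → Finset (Fin n))
    (hrec : ∀ i, ∃ a b, LinRecovers A a b i) :
    ∃ s : Fin (n + 1) → Fin n, Function.Surjective s ∧ ∀ a b : ℕ, a ≤ b → b < n + 1 →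
      ∃ a' b' : ℕ, a' ≤ b' ∧ b' < n + 1 ∧ b' - a' + 1 ≤ 2 * (b - a + 1) ∧
        ∀ i, LinRecovers A a b i →
          ∃ j : Fin (n + 1), a' ≤ (j : ℕ) ∧ (j : ℕ) ≤ b' ∧ s j = i := by
  classical
  let M : Matrix (Fin (n + 1)) (Fin n) (ZMod 2) := fun j i => if i ∈ A j then 1 else 0
  let L : (Fin (n + 1) → ZMod 2) →ₗ[ZMod 2] (Fin n → ZMod 2) := M.vecMulLinear
  have hL : ∀ y i, L y i = ∑ j, y j * M j i := fun y i => rfl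
  have rep : ∀ a b i, LinRecovers A a b i → ∃ d, L d = Pi.single i 1 ∧
      ∀ j, d j ≠ 0 → a ≤ (j : ℕ) ∧ (j : ℕ) ≤ b := by
    rintro a b i ⟨D, hD, hs⟩
    refine ⟨fun j => if j ∈ D then 1 else 0, ?_, ?_⟩
    · funext i'
      rw [hL, Pi.single_apply, ← hs i']
      simp only [M, ite_mul, one_mul, zero_mul, Finset.sum_ite_mem, Finset.univ_inter]
    · intro j hj
      exact hD j (by by_contra h; simp [h] at hj)
  have hex : ∀ i, ∃ d, L d = Pi.single i 1 := by
    intro i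
    obtain ⟨a, b, h⟩ := hrec i
    obtain ⟨d, hd, _⟩ := rep a b i h
    exact ⟨d, hd⟩
  choose d hd using hex
  have hsurj : LinearMap.range L = ⊤ := by
    rw [eq_top_iff, ← (Pi.basisFun (ZMod 2) (Fin n)).span_eq, Submodule.span_le]
    rintro _ ⟨i, rfl⟩
    exact ⟨d i, by simp [hd i]⟩
  have hker : Module.finrank (ZMod 2) (LinearMap.ker L) = 1 := by
    have := LinearMap.finrank_range_add_finrank_ker L
    rw [hsurj, finrank_top] at this
    simp at this
    omega
  obtain ⟨⟨c, hcK⟩, hc0, hc⟩ := finrank_eq_one_iff'.1 hker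
  have hLc : L c = 0 := hcK
  have hc0' : c ≠ 0 := fun h => hc0 (Subtype.ext h)
  have hkerc : ∀ y, L y = 0 → y = 0 ∨ y = c := by
    intro y hy
    obtain ⟨k, hk⟩ := hc ⟨y, hy⟩
    have hk' : k • c = y := congrArg Subtype.val hk
    rcases zmod2_cases k with rfl | rfl
    · left; simpa using hk'.symm
    · right; simpa using hk'.symm
  let C : Finset (Fin (n + 1)) := Finset.univ.filter (fun j => c j ≠ 0)
  have hC : C.Nonempty := by
    obtain ⟨j, hj⟩ := Function.ne_iff.1 hc0'
    exact ⟨j, by simpa [C] using hj⟩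
  have one_of : ∀ j, c j ≠ 0 → c j = 1 := fun j hj => (zmod2_cases (c j)).resolve_left hj
  have hm1 : c (C.min' hC) ≠ 0 := by simpa [C] using C.min'_mem hC
  have hm2 : c (C.max' hC) ≠ 0 := by simpa [C] using C.max'_mem hC
  have good := fun i => good_rep c (C.min' hC) (C.max' hC) (one_of _ hm1) (one_of _ hm2)
    (fun j hj => C.min'_le j (by simpa [C] using hj))
    (fun j hj => C.le_max' j (by simpa [C] using hj)) (d i)
  choose q hq hgood using good
  have hLq : ∀ i, L (q i) = Pi.single i 1 := by
    intro i
    rcases hq i with h | h <;> rw [h]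
    · exact hd i
    · rw [map_add, hLc, add_zero, hd i]
  have hqM : (Matrix.of q) * M = 1 := by
    ext i i'
    rw [Matrix.mul_apply, Matrix.one_apply]
    have := congrFun (hLq i) i'
    rw [hL, Pi.single_apply] at this
    simpa [eq_comm] using this
  obtain ⟨π, hπ, hqπ⟩ := hall_match _ _ hqM
  obtain ⟨τ, hτ⟩ := fold_exists (n + 1) ((C.min' hC : ℕ) + (C.max' hC : ℕ))
  have hinv : ∀ i, Function.invFun π (π i) = i := Function.leftInverse_invFun hπ
  refine ⟨fun p => Function.invFun π (τ.symm p), fun i => ⟨τ (π i), by simp [hinv]⟩, ?_⟩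
  intro a b hab hb
  obtain ⟨a', b', h1, h2, h3, h4⟩ := hτ a b hab hb
  refine ⟨a', b', h1, h2, h3, ?_⟩
  intro i hi
  obtain ⟨d', hd', hsup⟩ := rep a b i hi
  have hd'' : d' = d i ∨ d' = d i + c := by
    rcases hkerc (d' - d i) (by rw [map_sub, hd', hd i, sub_self]) with h | h
    · left; exact sub_eq_zero.1 h
    · right; rw [← h]; abel
  have := h4 (π i) (hgood i d' hd'' a b hsup (π i) (hqπ i))
  exact ⟨τ (π i), this.1, this.2, by simp [hinv]⟩

lemma lin_nonempty {n : ℕ} (G : SimpleGraph (Fin n)) (t : ℕ) :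
    { r : ℝ | ∃ A : Fin (n + 1) → Finset (Fin n), IsLinStore A ∧
    ∀ (u v : Fin n) (p : G.Walk u v), p.IsPath → p.length + 1 ≤ t →
      ∃ a b : ℕ, a ≤ b ∧ b < n + 1 ∧ (∀ i ∈ p.support, LinRecovers A a b i) ∧
        ((b - a + 1 : ℕ) : ℝ) ≤ r * ((p.length : ℝ) + 1) }.Nonempty := by
  classical
  refine ⟨(n : ℝ) + 1, fun j => Finset.univ.filter (fun i => i.castSucc = j), ?_, ?_⟩
  · intro x y hxy
    funext i
    have := congrFun hxy i.castSucc
    simpa [linMap, Finset.filter_eq', Fin.castSucc_inj] using this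
  · intro u v p _ _
    refine ⟨0, n, Nat.zero_le _, Nat.lt_succ_self _, ?_, ?_⟩
    · intro i _
      refine ⟨{i.castSucc}, ?_, ?_⟩
      · intro j hj
        have := j.2
        omega
      · intro i'
        simp [Fin.castSucc_inj]
    · push_cast
      have h1 : (0 : ℝ) ≤ n := Nat.cast_nonneg n
      have h2 : (0 : ℝ) ≤ p.length := Nat.cast_nonneg _
      simp only [Nat.sub_zero]
      nlinarith [mul_nonneg h1 h2]

/-- For every finite simple graph `G` on `n` vertices and every `t ≥ 1`,
`S^u_t(G,n+1) ≤ 2·S^c_t(G,n+1)`: the coding gain with one redundant chunk is at most `2`. -/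
theorem statement_10 {n : ℕ} (G : SimpleGraph (Fin n)) (t : ℕ) (ht : 1 ≤ t) :
    uncodedStretch G t (n + 1) ≤ 2 * linStretch G t (n + 1) := by
  rcases Nat.eq_zero_or_pos n with rfl | hn
  · have h1 : uncodedStretch G t (0 + 1) = 0 := by
      unfold uncodedStretch
      convert Real.sInf_empty
      ext r
      simp only [Set.mem_ofPred_eq, Set.mem_empty_iff_false, iff_false]
      rintro ⟨s, _⟩
      exact (s 0).elim0
    have h2 : linStretch G t (0 + 1) = 0 := by
      unfold linStretch
      convert Real.sInf_univ
      ext r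
      simp only [Set.mem_ofPred_eq, Set.mem_univ, iff_true]
      exact ⟨fun _ => ∅, fun x y _ => funext fun i => i.elim0, fun u => u.elim0⟩
    rw [h1, h2]; simp
  · have : Nonempty (Fin n) := ⟨⟨0, hn⟩⟩
    suffices h : uncodedStretch G t (n + 1) / 2 ≤ linStretch G t (n + 1) by linarith
    refine le_csInf (lin_nonempty G t) ?_
    rintro r ⟨A, _, hA⟩
    have hrec : ∀ i, ∃ a b, LinRecovers A a b i := by
      intro i
      obtain ⟨a, b, _, _, h, _⟩ := hA i i SimpleGraph.Walk.nil (by simp) (by simpa using ht)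
      exact ⟨a, b, h i (by simp)⟩
    obtain ⟨s, hs, H⟩ := core A hrec
    have : uncodedStretch G t (n + 1) ≤ 2 * r := by
      refine csInf_le ⟨0, ?_⟩ ⟨s, hs, ?_⟩
      · rintro r' ⟨s', _, hs'⟩
        obtain ⟨a, b, _, _, _, h⟩ := hs' ⟨0, hn⟩ ⟨0, hn⟩ SimpleGraph.Walk.nil (by simp)
          (by simpa using ht)
        have h0 : (0 : ℝ) ≤ ((b - a + 1 : ℕ) : ℝ) := Nat.cast_nonneg _
        simp only [SimpleGraph.Walk.length_nil, Nat.cast_zero, zero_add, mul_one] at h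
        exact h0.trans h
      · intro u v p hp hpt
        obtain ⟨a, b, hab, hb, hr, hle⟩ := hA u v p hp hpt
        obtain ⟨a', b', h1, h2, h3, h4⟩ := H a b hab hb
        refine ⟨a', b', h1, h2, fun x hx => h4 x (hr x hx), ?_⟩
        have h3' : ((b' - a' + 1 : ℕ) : ℝ) ≤ 2 * ((b - a + 1 : ℕ) : ℝ) := by exact_mod_cast h3
        linarith
    linarith
end

section
/- Let G be a finite simple graph and t = 2, and let m* be the smallest m such that S^c_2(G,m) = 1 (the linearly coded stretch metric equals 1, i.e., no fragmentation). Then S^u_2(G,m*) = 1; that is, for t = 2, coding does not help to completely eliminate fragmentation: an uncoded store of the same length m* also achieves stretch 1. -/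
lemma recovers_cases {n m : ℕ} (A : Fin m → Finset (Fin n)) (j k : Fin m)
    (hjk : (j : ℕ) ≤ k) (hk : (k : ℕ) ≤ j + 1) (i : Fin n) (h : LinRecovers A j k i) :
    (∀ x, x ∈ A j ↔ x = i) ∨ (∀ x, x ∈ A k ↔ x = i) ∨
      (j ≠ k ∧ ∀ x, (¬ (x ∈ A j ↔ x ∈ A k)) ↔ x = i) := by
  obtain ⟨D, hD, hs⟩ := h
  have hsub : D ⊆ {j, k} := by
    intro x hx
    have := hD x hx
    simp only [Finset.mem_insert, Finset.mem_singleton, Fin.ext_iff]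
    omega
  have h1 : ∀ x, (∑ j ∈ D, if x ∈ A j then (1 : ZMod 2) else 0) = 1 ↔ x = i := by
    intro x
    rw [hs x]
    split_ifs with h <;> simp [h]
  have hsub : D = ∅ ∨ D = {j} ∨ D = {k} ∨ D = {j, k} := by
    rw [← Finset.coe_subset] at hsub
    push_cast at hsub
    rw [Set.subset_pair_iff_eq] at hsub
    exact_mod_cast hsub
  rcases hsub with rfl | rfl | rfl | rfl
  · have := (h1 i).2 rfl
    simp at this
  · left
    simpa [-Finset.sum_boole] using h1
  · right; left
    simpa [-Finset.sum_boole] using h1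
  · by_cases hne : j = k
    · subst hne
      left
      simpa [-Finset.sum_boole] using h1
    · right; right
      refine ⟨hne, fun x => ?_⟩
      rw [← h1 x, Finset.sum_pair hne]
      by_cases ha : x ∈ A j <;> by_cases hb : x ∈ A k <;> simp [ha, hb]

lemma edge_cases {n m : ℕ} (A : Fin m → Finset (Fin n)) (j k : Fin m)
    (hjk : (j : ℕ) ≤ k) (hk : (k : ℕ) ≤ j + 1) (u v : Fin n) (huv : u ≠ v)
    (hu : LinRecovers A j k u) (hv : LinRecovers A j k v) :
    ∃ a b : Fin m, (a : ℕ) ≤ b + 1 ∧ (b : ℕ) ≤ a + 1 ∧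
      ((A a = {u} ∧ A b = {v}) ∨ (A a = {u} ∧ A b = {u, v}) ∨ (A a = {v} ∧ A b = {u, v})) := by
  have hu := recovers_cases A j k hjk hk u hu
  have hv := recovers_cases A j k hjk hk v hv
  simp only [Finset.ext_iff, Finset.mem_singleton, Finset.mem_insert]
  rcases hu with hu | hu | ⟨hne, hu⟩ <;> rcases hv with hv | hv | ⟨hne', hv⟩
  · exact absurd (((hu u).2 rfl |> (hv u).1)) huv
  · exact ⟨j, k, by omega, by omega, by grind⟩
  · exact ⟨j, k, by omega, by omega, by grind⟩
  · exact ⟨k, j, by omega, by omega, by grind⟩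
  · exact absurd (((hu u).2 rfl |> (hv u).1)) huv
  · exact ⟨k, j, by omega, by omega, by grind⟩
  · exact ⟨j, k, by omega, by omega, by grind⟩
  · exact ⟨k, j, by omega, by omega, by grind⟩
  · exact absurd (((hu u).2 rfl |> (hv u).1)) huv

/-- Replacing the coded positions by uncoded ones. -/
lemma exists_uncoded {n m : ℕ} [Nonempty (Fin n)] (A : Fin m → Finset (Fin n)) :
    ∃ s : Fin m → Fin n, (∀ j u, A j = {u} → s j = u) ∧
      ∀ (j k : Fin m) (u v : Fin n), u ≠ v → (j : ℕ) ≤ k + 1 → (k : ℕ) ≤ j + 1 → A k = {u} → A j = {u, v} →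
        ∃ k' : Fin m, (j : ℕ) ≤ k' + 1 ∧ (k' : ℕ) ≤ j + 1 ∧
          ((s k' = u ∧ s j = v) ∨ (s k' = v ∧ s j = u)) := by
  have key : ∀ j : Fin m, ∃ w : Fin n, (∀ u, A j = {u} → w = u) ∧
      ∀ (k : Fin m) (u v : Fin n), u ≠ v → (j : ℕ) ≤ k + 1 → (k : ℕ) ≤ j + 1 → A k = {u} → A j = {u, v} →
        ∃ k' : Fin m, (j : ℕ) ≤ k' + 1 ∧ (k' : ℕ) ≤ j + 1 ∧
          ((A k' = {u} ∧ w = v) ∨ (A k' = {v} ∧ w = u)) := by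
    intro j
    by_cases h1 : ∃ u, A j = {u}
    · obtain ⟨u, hu⟩ := h1
      refine ⟨u, fun u' h => by simpa [hu] using h, ?_⟩
      intro k a b hab _ _ _ h
      rw [hu] at h
      have := congrArg Finset.card h
      rw [Finset.card_pair hab] at this
      simp at this
    · by_cases h2 : ∃ (k : Fin m) (u v : Fin n), u ≠ v ∧ (j : ℕ) ≤ k + 1 ∧ (k : ℕ) ≤ j + 1 ∧
          A k = {u} ∧ A j = {u, v}
      · obtain ⟨k, u, v, huv, hjk, hkj, hk, hj⟩ := h2
        refine ⟨v, fun u' h => absurd ⟨u', h⟩ h1, ?_⟩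
        intro k' a b hab _ _ _ h
        refine ⟨k, hjk, hkj, ?_⟩
        rw [hj] at h
        simp only [Finset.ext_iff, Finset.mem_insert, Finset.mem_singleton] at h
        have e1 := h a
        have e2 := h b
        have e3 := h u
        have e4 := h v
        by_cases hva : v = b
        · left
          refine ⟨?_, hva⟩
          have : u = a := by grind
          rw [hk, this]
        · right
          refine ⟨?_, by grind⟩
          have : u = b := by grind
          rw [hk, this]
      · exact ⟨Classical.arbitrary _, fun u' h => absurd ⟨u', h⟩ h1,
          fun k u v a b c d e => absurd ⟨k, u, v, a, b, c, d, e⟩ h2⟩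
  choose s hs1 hs2 using key
  refine ⟨s, hs1, ?_⟩
  intro j k u v huv h1 h2 h3 h4
  obtain ⟨k', a, b, c⟩ := hs2 j k u v huv h1 h2 h3 h4
  refine ⟨k', a, b, ?_⟩
  rcases c with ⟨c, d⟩ | ⟨c, d⟩
  · exact Or.inl ⟨hs1 _ _ c, d⟩
  · exact Or.inr ⟨hs1 _ _ c, d⟩

/-- For a finite simple graph `G` and `t = 2`: if `m*` is the smallest `m`
with `S^c_2(G,m) = 1`, then also `S^u_2(G,m*) = 1`; coding does not help to completely
eliminate fragmentation when `t = 2`. -/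
theorem statement_12 {n : ℕ} (G : SimpleGraph (Fin n)) (mstar : ℕ)
    (hm : IsLeast {m : ℕ | linStretch G 2 m = 1} mstar) :
    uncodedStretch G 2 mstar = 1 := by
  have h1 : linStretch G 2 mstar = 1 := hm.1
  clear hm
  rcases Nat.eq_zero_or_pos n with rfl | hn
  · exfalso
    unfold linStretch at h1
    have : { r : ℝ | ∃ A : Fin mstar → Finset (Fin 0), IsLinStore A ∧
        ∀ (u v : Fin 0) (p : G.Walk u v), p.IsPath → p.length + 1 ≤ 2 →
        ∃ a b : ℕ, a ≤ b ∧ b < mstar ∧ (∀ i ∈ p.support, LinRecovers A a b i) ∧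
        ((b - a + 1 : ℕ) : ℝ) ≤ r * ((p.length : ℝ) + 1) } = Set.univ := by
      ext r
      simp only [Set.mem_ofPred_eq, Set.mem_univ, iff_true]
      exact ⟨fun _ => ∅, fun x y _ => Subsingleton.elim _ _, fun u => u.elim0⟩
    rw [this, Real.sInf_univ] at h1
    norm_num at h1
  have : Nonempty (Fin n) := ⟨⟨0, hn⟩⟩
  -- a coded store of stretch below 3/2
  obtain ⟨r, ⟨A, -, hA⟩, hr⟩ : ∃ r ∈ { r : ℝ | ∃ A : Fin mstar → Finset (Fin n), IsLinStore A ∧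
        ∀ (u v : Fin n) (p : G.Walk u v), p.IsPath → p.length + 1 ≤ 2 →
        ∃ a b : ℕ, a ≤ b ∧ b < mstar ∧ (∀ i ∈ p.support, LinRecovers A a b i) ∧
        ((b - a + 1 : ℕ) : ℝ) ≤ r * ((p.length : ℝ) + 1) }, r < 3 / 2 := by
    unfold linStretch at h1
    apply exists_lt_of_csInf_lt
    · by_contra hne
      rw [Set.not_nonempty_iff_eq_empty] at hne
      rw [hne, Real.sInf_empty] at h1
      norm_num at h1
    · rw [h1]; norm_num
  have hsing : ∀ u, ∃ j, A j = {u} := by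
    intro u
    obtain ⟨a, b, hab, hb, hrec, hlen⟩ := hA u u SimpleGraph.Walk.nil (by simp) (by simp)
    have hba : b - a + 1 < 2 := by
      have : ((b - a + 1 : ℕ) : ℝ) < (2 : ℕ) := by
        simp only [SimpleGraph.Walk.length_nil] at hlen
        push_cast at hlen ⊢
        linarith
      exact_mod_cast this
    have hab' : a = b := by omega
    subst hab'
    have := recovers_cases A ⟨a, hb⟩ ⟨a, hb⟩ le_rfl (by simp) u (hrec u (by simp))
    refine ⟨⟨a, hb⟩, ?_⟩
    ext x
    simp only [Finset.mem_singleton]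
    rcases this with h | h | h
    · exact h x
    · exact h x
    · exact absurd rfl h.1
  obtain ⟨s, hs1, hs2⟩ := exists_uncoded A
  have hedge : ∀ u v, G.Adj u v → ∃ j k : Fin mstar, (j : ℕ) ≤ k + 1 ∧ (k : ℕ) ≤ j + 1 ∧
      s j = u ∧ s k = v := by
    intro u v huv
    have hne : u ≠ v := huv.ne
    obtain ⟨a, b, hab, hb, hrec, hlen⟩ := hA u v (SimpleGraph.Walk.cons huv SimpleGraph.Walk.nil)
      (by simp [hne]) (by simp)
    have hba : b - a + 1 < 3 := by
      have : ((b - a + 1 : ℕ) : ℝ) < (3 : ℕ) := by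
        simp only [SimpleGraph.Walk.length_cons, SimpleGraph.Walk.length_nil] at hlen
        push_cast at hlen ⊢
        linarith
      exact_mod_cast this
    obtain ⟨j, k, hjk, hkj, h⟩ := edge_cases A ⟨a, by omega⟩ ⟨b, hb⟩ hab
      (by simp only; omega) u v hne (hrec u (by simp)) (hrec v (by simp))
    rcases h with ⟨h, h'⟩ | ⟨h, h'⟩ | ⟨h, h'⟩
    · exact ⟨j, k, hjk, hkj, hs1 _ _ h, hs1 _ _ h'⟩
    · obtain ⟨k', h3, h4, h5 | h5⟩ := hs2 k j u v hne hkj hjk h h'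
      · exact ⟨k', k, h4, h3, h5.1, h5.2⟩
      · exact ⟨k, k', h3, h4, h5.2, h5.1⟩
    · rw [Finset.pair_comm] at h'
      obtain ⟨k', h3, h4, h5 | h5⟩ := hs2 k j v u hne.symm hkj hjk h h'
      · exact ⟨k, k', h3, h4, h5.2, h5.1⟩
      · exact ⟨k', k, h4, h3, h5.1, h5.2⟩
  unfold uncodedStretch
  apply IsLeast.csInf_eq
  constructor
  · refine ⟨s, fun u => ?_, ?_⟩
    · obtain ⟨j, hj⟩ := hsing u
      exact ⟨j, hs1 _ _ hj⟩
    · intro u v p hp hl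
      cases p with
      | nil =>
        obtain ⟨j, hj⟩ := hsing u
        refine ⟨j, j, le_rfl, j.2, ?_, by simp⟩
        intro x hx
        simp only [SimpleGraph.Walk.support_nil, List.mem_singleton] at hx
        exact ⟨j, le_rfl, le_rfl, hx ▸ hs1 _ _ hj⟩
      | cons huw q =>
        cases q with
        | nil =>
          obtain ⟨j, k, hjk, hkj, hj, hk⟩ := hedge _ _ huw
          refine ⟨min j k, max j k, by omega, by omega, ?_, ?_⟩
          · intro x hx
            simp only [SimpleGraph.Walk.support_cons, SimpleGraph.Walk.support_nil,
              List.mem_cons, List.not_mem_nil, or_false] at hx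
            rcases hx with rfl | rfl
            · exact ⟨j, by omega, by omega, hj⟩
            · exact ⟨k, by omega, by omega, hk⟩
          · have : max (j : ℕ) k - min (j : ℕ) k + 1 ≤ 2 := by omega
            have h2 : ((max (j : ℕ) k - min (j : ℕ) k + 1 : ℕ) : ℝ) ≤ (2 : ℕ) := by
              exact_mod_cast this
            simp only [SimpleGraph.Walk.length_cons, SimpleGraph.Walk.length_nil]
            refine h2.trans ?_
            norm_num
        | cons _ q' =>
          simp only [SimpleGraph.Walk.length_cons] at hl
          omega
  · rintro r' ⟨s', -, h⟩
    obtain ⟨a, b, -, -, -, hlen⟩ := h ⟨0, hn⟩ ⟨0, hn⟩ SimpleGraph.Walk.nil (by simp) (by simp)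
    simp only [SimpleGraph.Walk.length_nil] at hlen
    push_cast at hlen
    have : (0 : ℝ) ≤ ((b - a : ℕ) : ℝ) := Nat.cast_nonneg _
    linarith
end

section
/- Let k ≥ 1 and n ≥ 2k+1, and let G be the sparse Hamiltonian graph on vertices x_1,…,x_n with path edges {x_j,x_{j+1}} for 1 ≤ j ≤ n−1 and nested arcs {x_i, x_{2k+2−i}} for i = 1,…,k. Then B(G) = 2. -/
/-- For `k ≥ 1` and `n ≥ 2k+1`, the sparse Hamiltonian graph on `n`
vertices with the nested arcs `{x_i, x_{2k+2−i}}`, `i = 1,…,k` (1-indexed; 0-indexed, arcs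
`(i−1, 2k+1−i)`) has bandwidth exactly `2`. -/
theorem statement_14 (k n : ℕ) (hk : 1 ≤ k) (hn : 2 * k + 1 ≤ n)
    (A : Finset (Fin n × Fin n))
    (hA : ∀ p : Fin n × Fin n,
      p ∈ A ↔ ∃ i : ℕ, 1 ≤ i ∧ i ≤ k ∧ (p.1 : ℕ) = i - 1 ∧ (p.2 : ℕ) = 2 * k + 1 - i) :
    bandwidth (sparseHamGraph n A) = 2 := by
  have hup : 2 ∈ { B : ℕ | ∃ σ : Equiv.Perm (Fin n), ∀ u v : Fin n,
      (sparseHamGraph n A).Adj u v → ((σ u : ℤ) - (σ v : ℤ)).natAbs ≤ B } := by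
    let g : ℕ → ℕ := fun v => if v < k then 2 * (k - v) - 1 else
      if v ≤ 2 * k then 2 * (v - k) else v
    have hg : ∀ v, v < n → g v < n := by
      intro v hv
      simp only [g]
      split_ifs <;> omega
    let f : Fin n → Fin n := fun v => ⟨g v, hg v v.2⟩
    have hf : Function.Injective f := by
      intro a b hab
      have h : g a = g b := congrArg Fin.val hab
      apply Fin.ext
      simp only [g] at h
      split_ifs at h <;> omega
    refine ⟨Equiv.ofBijective f (Finite.injective_iff_bijective.mp hf), ?_⟩
    intro u v huv
    simp only [sparseHamGraph, SimpleGraph.fromRel_adj, hA] at huv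
    simp only [Equiv.ofBijective_apply, f, g]
    obtain ⟨-, (h | ⟨i, h1, h2, h3, h4⟩) | (h | ⟨i, h1, h2, h3, h4⟩)⟩ := huv <;>
      split_ifs <;> omega
  apply le_antisymm
  · exact Nat.sInf_le hup
  · refine le_csInf ⟨2, hup⟩ ?_
    rintro B ⟨σ, hσ⟩
    let a : Fin n := ⟨k - 1, by omega⟩
    let b : Fin n := ⟨k, by omega⟩
    let c : Fin n := ⟨k + 1, by omega⟩
    have hab : a ≠ b := by simp only [a, b, ne_eq, Fin.mk.injEq]; omega
    have hbc : b ≠ c := by simp only [c, b, ne_eq, Fin.mk.injEq]; omega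
    have hac : a ≠ c := by simp only [a, c, ne_eq, Fin.mk.injEq]; omega
    have h1 := hσ a b (by
      rw [sparseHamGraph, SimpleGraph.fromRel_adj]
      exact ⟨hab, Or.inl (Or.inl (by simp only [a, b]; omega))⟩)
    have h2 := hσ b c (by
      rw [sparseHamGraph, SimpleGraph.fromRel_adj]
      exact ⟨hbc, Or.inl (Or.inl rfl)⟩)
    have h3 := hσ a c (by
      rw [sparseHamGraph, SimpleGraph.fromRel_adj]
      refine ⟨hac, Or.inl (Or.inr ((hA _).2 ⟨k, hk, le_rfl, rfl, ?_⟩))⟩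
      simp only [c]; omega)
    have e1 : (σ a : ℕ) ≠ σ b := fun h => hab (σ.injective (Fin.ext h))
    have e2 : (σ b : ℕ) ≠ σ c := fun h => hbc (σ.injective (Fin.ext h))
    have e3 : (σ a : ℕ) ≠ σ c := fun h => hac (σ.injective (Fin.ext h))
    omega
end

section
/- Let k ≥ 1, let n be divisible by k with n/k ≥ 3 and k² < n, and let G be the sparse Hamiltonian graph on vertices x_1,…,x_n with path edges {x_j,x_{j+1}} for 1 ≤ j ≤ n−1 and long arcs {x_i, x_{i·n/k}} for i = 1,…,k. Then every two vertices of G are at graph distance at most n/k + k + 1, and consequently B(G) ≥ (n−1)/(n/k + k + 1). -/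
/-- There is a walk of length at most `d` (positions given as natural numbers). -/
def Near {n : ℕ} (G : SimpleGraph (Fin n)) (d : ℕ) (u v : Fin n) : Prop :=
  ∃ p : G.Walk u v, p.length ≤ d

theorem Near.trans {n : ℕ} {G : SimpleGraph (Fin n)} {d e : ℕ} {u v w : Fin n}
    (h : Near G d u v) (h' : Near G e v w) : Near G (d + e) u w := by
  obtain ⟨p, hp⟩ := h
  obtain ⟨q, hq⟩ := h'
  exact ⟨p.append q, by rw [SimpleGraph.Walk.length_append]; omega⟩

theorem Near.symm {n : ℕ} {G : SimpleGraph (Fin n)} {d : ℕ} {u v : Fin n}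
    (h : Near G d u v) : Near G d v u := by
  obtain ⟨p, hp⟩ := h
  exact ⟨p.reverse, by rw [SimpleGraph.Walk.length_reverse]; omega⟩

theorem Near.mono {n : ℕ} {G : SimpleGraph (Fin n)} {d e : ℕ} {u v : Fin n}
    (h : Near G d u v) (hde : d ≤ e) : Near G e u v := by
  obtain ⟨p, hp⟩ := h
  exact ⟨p, by omega⟩

theorem near_of_adj {n : ℕ} {G : SimpleGraph (Fin n)} {u v : Fin n}
    (h : G.Adj u v) : Near G 1 u v := ⟨h.toWalk, by simp⟩

theorem near_line_aux {n : ℕ} (A : Finset (Fin n × Fin n)) (d : ℕ) :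
    ∀ u v : Fin n, (u : ℕ) + d = v → Near (sparseHamGraph n A) d u v := by
  induction d with
  | zero =>
    intro u v h
    have : u = v := Fin.ext (by omega)
    subst this
    exact ⟨SimpleGraph.Walk.nil, by simp⟩
  | succ d ih =>
    intro u v h
    have hv := v.isLt
    have h1 := ih u ⟨u + d, by omega⟩ rfl
    refine h1.trans (near_of_adj ?_)
    rw [sparseHamGraph, SimpleGraph.fromRel_adj]
    refine ⟨?_, Or.inl (Or.inl ?_)⟩
    · intro h2
      have := congrArg Fin.val h2
      simp only at this
      omega
    · simp only
      omega

theorem near_line {n : ℕ} (A : Finset (Fin n × Fin n)) (d : ℕ) (u v : Fin n)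
    (h1 : (u : ℕ) ≤ v + d) (h2 : (v : ℕ) ≤ u + d) : Near (sparseHamGraph n A) d u v := by
  rcases le_total (u : ℕ) v with h | h
  · exact (near_line_aux A (v - u) u v (by omega)).mono (by omega)
  · exact (near_line_aux A (u - v) v u (by omega)).symm.mono (by omega)

theorem walk_stretch {n : ℕ} {G : SimpleGraph (Fin n)} (σ : Equiv.Perm (Fin n)) (B : ℕ)
    (h : ∀ u v : Fin n, G.Adj u v → ((σ u : ℤ) - (σ v : ℤ)).natAbs ≤ B) {u v : Fin n}
    (p : G.Walk u v) : ((σ u : ℤ) - (σ v : ℤ)).natAbs ≤ B * p.length := by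
  induction p with
  | nil => simp
  | cons hadj p ih =>
    have := h _ _ hadj
    rw [SimpleGraph.Walk.length_cons, mul_add, mul_one]
    omega

theorem near_head (k m n : ℕ) (hk : 1 ≤ k) (hm : 3 ≤ m) (hn : n = k * m)
    (A : Finset (Fin n × Fin n))
    (hA : ∀ p : Fin n × Fin n,
      p ∈ A ↔ ∃ i : ℕ, 1 ≤ i ∧ i ≤ k ∧ (p.1 : ℕ) = i - 1 ∧ (p.2 : ℕ) + 1 = i * m)
    (u : Fin n) :
    ∃ w : Fin n, (w : ℕ) + 1 ≤ k ∧ Near (sparseHamGraph n A) (m / 2 + 1) u w := by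
  have hu := u.isLt
  have hkn : k ≤ n := by nlinarith
  have key : ∀ i : ℕ, 1 ≤ i → i ≤ k → (u : ℕ) + 1 ≤ i * m + m / 2 → i * m ≤ u + 1 + m / 2 →
      ∃ w : Fin n, (w : ℕ) + 1 ≤ k ∧ Near (sparseHamGraph n A) (m / 2 + 1) u w := by
    intro i hi hik h1 h2
    have h3 : i * m ≤ n := hn ▸ Nat.mul_le_mul_right m hik
    have h4 : i * 3 ≤ i * m := Nat.mul_le_mul_left i hm
    refine ⟨⟨i - 1, by omega⟩, by simp only; omega, ?_⟩
    refine (near_line A (m / 2) u ⟨i * m - 1, by omega⟩ (by simp only; omega)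
      (by simp only; omega)).trans (near_of_adj ?_).symm
    rw [sparseHamGraph, SimpleGraph.fromRel_adj]
    refine ⟨?_, Or.inl (Or.inr ((hA _).2 ⟨i, hi, hik, rfl, by simp only; omega⟩))⟩
    intro h5
    have := congrArg Fin.val h5
    simp only at this
    omega
  have hdm := Nat.div_add_mod ((u : ℕ) + 1) m
  have hlt := Nat.mod_lt ((u : ℕ) + 1) (by omega : m > 0)
  set q := ((u : ℕ) + 1) / m with hq
  set r := ((u : ℕ) + 1) % m with hr
  have hqk : q ≤ k := by
    by_contra hc
    have : (k + 1) * m ≤ q * m := Nat.mul_le_mul_right m (by omega)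
    nlinarith
  have hcomm : m * q = q * m := mul_comm _ _
  by_cases hr2 : r ≤ m / 2
  · rcases Nat.eq_zero_or_pos q with h0 | h0
    · rw [h0] at hdm
      exact ⟨⟨0, by omega⟩, by simp only; omega,
        near_line A _ _ _ (by simp only; omega) (by simp only; omega)⟩
    · exact key q h0 hqk (by omega) (by omega)
  · have hqk' : q < k := by
      rcases Nat.lt_or_ge q k with h | h
      · exact h
      · have : q = k := by omega
        rw [this] at hcomm hdm
        omega
    have : (q + 1) * m = q * m + m := by ring
    exact key (q + 1) (Nat.succ_pos q) hqk' (by omega) (by omega)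

/-- For `k ≥ 1`, `k ∣ n`, `n/k ≥ 3` and `k² < n`, the long-arc sparse
Hamiltonian graph on `n` vertices with arcs `{x_i, x_{i·n/k}}`, `i = 1,…,k` (1-indexed;
0-indexed, arcs `(i−1, i·(n/k)−1)`) has all pairwise graph distances at most `n/k + k + 1`,
and consequently `B(G) ≥ (n−1)/(n/k + k + 1)`, i.e. `B(G)·(n/k + k + 1) ≥ n − 1`. -/
theorem statement_15 (k n : ℕ) (hk : 1 ≤ k) (hdvd : k ∣ n) (hnk : 3 ≤ n / k)
    (hk2 : k * k < n) (A : Finset (Fin n × Fin n))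
    (hA : ∀ p : Fin n × Fin n,
      p ∈ A ↔ ∃ i : ℕ, 1 ≤ i ∧ i ≤ k ∧ (p.1 : ℕ) = i - 1 ∧ (p.2 : ℕ) + 1 = i * (n / k)) :
    (∀ u v : Fin n, (sparseHamGraph n A).dist u v ≤ n / k + k + 1) ∧
    n - 1 ≤ bandwidth (sparseHamGraph n A) * (n / k + k + 1) := by
  have hn : n = k * (n / k) := (Nat.mul_div_cancel' hdvd).symm
  have hnear : ∀ u v : Fin n, Near (sparseHamGraph n A) (n / k + k + 1) u v := by
    intro u v
    obtain ⟨a, ha, hua⟩ := near_head k (n / k) n hk hnk hn A hA u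
    obtain ⟨b, hb, hvb⟩ := near_head k (n / k) n hk hnk hn A hA v
    exact ((hua.trans (near_line A (k - 1) a b (by omega) (by omega))).trans hvb.symm).mono
      (by omega)
  refine ⟨fun u v => ?_, ?_⟩
  · obtain ⟨p, hp⟩ := hnear u v
    exact (SimpleGraph.dist_le p).trans hp
  · have hne : { B : ℕ | ∃ σ : Equiv.Perm (Fin n), ∀ u v : Fin n,
        (sparseHamGraph n A).Adj u v → ((σ u : ℤ) - (σ v : ℤ)).natAbs ≤ B }.Nonempty := by
      refine ⟨n, Equiv.refl _, fun u v _ => ?_⟩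
      have := u.isLt
      have := v.isLt
      simp only [Equiv.refl_apply]
      omega
    obtain ⟨σ, hσ⟩ := Nat.sInf_mem hne
    obtain ⟨p, hp⟩ := hnear (σ.symm ⟨0, by omega⟩) (σ.symm ⟨n - 1, by omega⟩)
    have h1 := walk_stretch σ _ hσ p
    simp only [Equiv.apply_symm_apply] at h1
    have h2 : n - 1 ≤ bandwidth (sparseHamGraph n A) * p.length := by
      refine le_trans ?_ h1
      omega
    exact h2.trans (Nat.mul_le_mul_left _ hp)
end
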